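/- arXiv:2512.07751 — 2 statements merged into one kernel-verified Lean document; each statement's English description precedes it below -/
import Mathlib

section
/- Let k ≥ 3, ℓ ∈ [k−1], t = ⌊k/(k−ℓ)⌋·(k−ℓ), and let H be an n-vertex k-graph whose edge set is exactly the edge set of a Hamilton ℓ-cycle on its vertex set (so (k−ℓ) | n). Then every strong independent set of H has size at most ⌊n/t⌋. -/
open Finset

theorem Finset.sum_range_mul_eq_sum_sum {M : Type*} [AddCommMonoid M] (h : ℕ → M) (m d : ℕ) :
    ∑ x ∈ range (m * d), h x = ∑ i ∈ range m, ∑ r ∈ range d, h (i * d + r) := by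
  induction m with
  | zero => simp
  | succ m ih => rw [Nat.succ_mul, Finset.sum_range_add, ih, Finset.sum_range_succ]

theorem ZMod.sum_range_natCast {M : Type*} [AddCommMonoid M] (n : ℕ) [NeZero n] (g : ZMod n → M) :
    ∑ x ∈ range n, g (x : ZMod n) = ∑ x, g x := by
  refine Finset.sum_nbij' (fun x => (x : ZMod n)) ZMod.val ?_ ?_ ?_ ?_ ?_
  · simp
  · intro a _
    simpa using ZMod.val_lt a
  · intro a ha
    exact ZMod.val_cast_of_lt (by simpa using ha)
  · simp
  · simp

/-- If the edge set of an `n`-vertex `k`-graph is exactly the edge set of a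
Hamilton ℓ-cycle (given by a cyclic ordering `f` of the vertices), then every
strong independent set has size at most `⌊n/t⌋` where `t = ⌊k/(k-ℓ)⌋(k-ℓ)`. -/
theorem strong_independent_set_in_hamilton_ell_cycle
    (k l t n : ℕ) (hk : 3 ≤ k) (hl : 1 ≤ l) (hlk : l ≤ k - 1)
    (ht : t = k / (k - l) * (k - l)) (hn : (k - l) ∣ n)
    (E : Finset (Finset (Fin n))) (hE : ∀ e ∈ E, e.card = k)
    (f : ZMod n → Fin n) (hf : Function.Bijective f)
    (hEdges : E = (Finset.range n).image fun i =>
      Finset.image (fun j : Fin k => f (((i * (k - l) + (j : ℕ)) : ℕ) : ZMod n))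
        Finset.univ)
    (A : Finset (Fin n)) (hA : ∀ e ∈ E, (e ∩ A).card ≤ 1) :
    A.card ≤ n / t := by
  have hn0 : n ≠ 0 := by
    rintro rfl
    exact (f 0).elim0
  have : NeZero n := ⟨hn0⟩
  obtain ⟨m, hm⟩ := hn
  set d := k - l
  have hd : 0 < d := by omega
  set q := k / d
  have hq : 0 < q := Nat.div_pos (by omega) hd
  have hqk : q * d ≤ k := Nat.div_mul_le_self k d
  let G : Fin n → ℕ := fun v => if v ∈ A then 1 else 0
  have edge_sum_le : ∀ i < n, ∑ j ∈ range (q * d), G (f ((i * d + j : ℕ) : ZMod n)) ≤ 1 := by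
    intro i hi
    let φ : Fin k → Fin n := fun j => f ((i * d + (j : ℕ) : ℕ) : ZMod n)
    have he : Finset.image φ univ ∈ E := by
      rw [hEdges]
      exact Finset.mem_image.2 ⟨i, Finset.mem_range.2 hi, rfl⟩
    have hinj : Set.InjOn φ (univ : Finset (Fin k)) := by
      rw [← Finset.card_image_iff, hE _ he]
      simp
    calc ∑ j ∈ range (q * d), G (f ((i * d + j : ℕ) : ZMod n))
        ≤ ∑ j ∈ range k, G (f ((i * d + j : ℕ) : ZMod n)) :=
          Finset.sum_le_sum_of_subset (Finset.range_mono hqk)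
      _ = ∑ j : Fin k, G (φ j) := Finset.sum_range _
      _ = ∑ v ∈ Finset.image φ univ, G v := (Finset.sum_image hinj).symm
      _ = (Finset.image φ univ ∩ A).card := by
          simp only [G, Finset.sum_boole, Finset.filter_mem_eq_inter, Nat.cast_id]
      _ ≤ 1 := hA _ he
  have shifted_sum : ∀ s, ∑ i ∈ range m, ∑ r ∈ range d,
      G (f ((i * d + (s * d + r) : ℕ) : ZMod n)) = A.card := by
    intro s
    calc ∑ i ∈ range m, ∑ r ∈ range d, G (f ((i * d + (s * d + r) : ℕ) : ZMod n))
        = ∑ x ∈ range (m * d), G (f ((x : ZMod n) + ((s * d : ℕ) : ZMod n))) := by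
          rw [Finset.sum_range_mul_eq_sum_sum]
          refine Finset.sum_congr rfl fun i _ => Finset.sum_congr rfl fun r _ => ?_
          congr 2
          push_cast
          ring
      _ = ∑ x : ZMod n, G (f (x + ((s * d : ℕ) : ZMod n))) := by
          rw [mul_comm m d, ← hm]
          exact ZMod.sum_range_natCast n fun x => G (f (x + ((s * d : ℕ) : ZMod n)))
      _ = ∑ x : ZMod n, G (f x) :=
          Equiv.sum_comp (Equiv.addRight ((s * d : ℕ) : ZMod n)) fun x => G (f x)
      _ = ∑ v, G v := hf.sum_comp G
      _ = A.card := by simp [G]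
  have hcount : q * A.card ≤ m := by
    calc q * A.card
        = ∑ s ∈ range q, ∑ i ∈ range m, ∑ r ∈ range d,
            G (f ((i * d + (s * d + r) : ℕ) : ZMod n)) := by
          simp only [shifted_sum, Finset.sum_const, Finset.card_range, smul_eq_mul]
      _ = ∑ i ∈ range m, ∑ j ∈ range (q * d), G (f ((i * d + j : ℕ) : ZMod n)) := by
          rw [Finset.sum_comm]
          exact Finset.sum_congr rfl fun i _ => (Finset.sum_range_mul_eq_sum_sum
            (fun j => G (f ((i * d + j : ℕ) : ZMod n))) q d).symm
      _ ≤ ∑ i ∈ range m, 1 := by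
          refine Finset.sum_le_sum fun i hi => edge_sum_le i ?_
          rw [hm]
          exact (Finset.mem_range.1 hi).trans_le (Nat.le_mul_of_pos_left m hd)
      _ = m := by simp
  rw [ht, Nat.le_div_iff_mul_le (Nat.mul_pos hq hd)]
  calc A.card * (q * d) = d * (q * A.card) := by ring
    _ ≤ d * m := Nat.mul_le_mul_left d hcount
    _ = n := hm.symm
end

section
/- Let k ≥ 3 and ℓ ∈ [k−1] with (k,ℓ) ≠ (3,1), and set t = ⌊k/(k−ℓ)⌋·(k−ℓ). There exists μ₀ > 0 such that for every μ ∈ (0, μ₀] there exists ε₀ > 0 such that for every ε ∈ (0, ε₀] there exists n₀ such that the following holds for every n ≥ n₀ divisible by k−ℓ: if G is an n-vertex k-graph with no isolated vertices and δ*(G) ≥ (1 − 1/t − ε)·n, such that every set of ⌊n/t⌋ vertices of G contains at least μn² supported pairs, then G has a Hamilton ℓ-cycle. -/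
open Finset

/-- The number of supported pairs (supported 2-sets) contained in `A`. -/
def suppPairs {n : ℕ} (E : Finset (Finset (Fin n))) (A : Finset (Fin n)) : ℕ :=
  ((A.powersetCard 2).filter fun p => ∃ e ∈ E, p ⊆ e).card

/-- A Hamilton ℓ-cycle in the `k`-graph with edge set `E` on vertex set `Fin n`. -/
def HamCycle {n : ℕ} (k l : ℕ) (E : Finset (Finset (Fin n))) : Prop :=
  ∃ f : ZMod n → Fin n, Function.Bijective f ∧
    ∀ i : ℕ,
      (Finset.image (fun j : Fin k => f (((i * (k - l) + (j : ℕ)) : ℕ) : ZMod n))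
        Finset.univ) ∈ E

section Lists

variable {V : Type}

theorem List.split_window {x m y p w s : List V} (h : x ++ m ++ y = p ++ w ++ s)
    (hw : w.length ≤ m.length + 1) :
    (∃ s', x ++ m = p ++ w ++ s') ∨
      (∃ p', m ++ y = p' ++ w ++ s ∧ p.length = x.length + p'.length) := by
  by_cases hp : x.length ≤ p.length
  · right
    rw [List.append_assoc, List.append_assoc, List.append_eq_append_iff] at h
    rcases h with ⟨as, h1, h2⟩ | ⟨bs, h1, h2⟩
    · exact ⟨as, by simpa using h2, by simp [h1]⟩
    · have : bs = [] := by
        have := congrArg List.length h1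
        simp at this
        exact List.eq_nil_of_length_eq_zero (by omega)
      subst this
      exact ⟨[], by simpa using h2.symm, by simp [h1]⟩
  · left
    rw [List.append_eq_append_iff] at h
    rcases h with ⟨as, h1, -⟩ | ⟨bs, h1, -⟩
    · have : as = [] := by
        have := congrArg List.length h1
        simp at this
        exact List.eq_nil_of_length_eq_zero (by omega)
      subst this
      exact ⟨[], by simpa using h1.symm⟩
    · exact ⟨bs, h1⟩

theorem List.infix_split {x m y w : List V} (h : w <:+: x ++ m ++ y)
    (hw : w.length ≤ m.length + 1) : w <:+: x ++ m ∨ w <:+: m ++ y := by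
  obtain ⟨p, s, h⟩ := h
  rcases List.split_window h.symm hw with ⟨s', h'⟩ | ⟨p', h', -⟩
  · exact Or.inl ⟨p, s', h'.symm⟩
  · exact Or.inr ⟨p', s, h'.symm⟩

variable [DecidableEq V]

/-- A family of sets closed under taking subsets. -/
def DownClosed (C : Finset V → Prop) : Prop := ∀ S T, S ⊆ T → C T → C S

/-- Every window of at most `k` consecutive entries of `l` consists of distinct vertices
spanning a face of `C`. -/
def Tight (C : Finset V → Prop) (k : ℕ) (l : List V) : Prop :=
  ∀ w, w <:+: l → w.length ≤ k → w.Nodup ∧ C w.toFinset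

theorem Tight.infix {C : Finset V → Prop} {k : ℕ} {l m : List V} (h : Tight C k l)
    (hm : m <:+: l) : Tight C k m := fun w hw hk => h w (hw.trans hm) hk

theorem tight_of_nodup {C : Finset V → Prop} (hC : DownClosed C) (k : ℕ) {l : List V}
    (h : l.Nodup) (hl : C l.toFinset) : Tight C k l := fun w hw _ =>
  ⟨h.sublist hw.sublist, hC _ _ (fun v hv => by
    simp only [List.mem_toFinset] at hv ⊢; exact hw.subset hv) hl⟩

theorem Tight.face {C : Finset V → Prop} {k : ℕ} {l : List V} (h : Tight C k l)
    (hl : l.length ≤ k) : l.Nodup ∧ C l.toFinset := h l (List.infix_refl l) hl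

theorem Tight.glue {C : Finset V → Prop} {k : ℕ} {x m y : List V} (h1 : Tight C k (x ++ m))
    (h2 : Tight C k (m ++ y)) (hm : k ≤ m.length + 1) : Tight C k (x ++ m ++ y) := by
  intro w hw hk
  rcases List.infix_split hw (by omega) with h | h
  · exact h1 w h hk
  · exact h2 w h hk

open Classical in
/-- The vertices of `R` extending the set `S` to a larger face of `C`. -/
noncomputable def extSet (C : Finset V → Prop) (R S : Finset V) : Finset V :=
  R.filter fun v => v ∉ S ∧ C (insert v S)

theorem mem_extSet {C : Finset V → Prop} {R S : Finset V} {v : V} :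
    v ∈ extSet C R S ↔ v ∈ R ∧ v ∉ S ∧ C (insert v S) := by
  simp [extSet]

/-- Every face with fewer than `k` vertices has at least `d` extensions inside `R`. -/
def HasExt (C : Finset V → Prop) (k : ℕ) (R : Finset V) (d : ℝ) : Prop :=
  ∀ S, C S → S.card < k → d ≤ ((extSet C R S).card : ℝ)

theorem Tight.snoc {C : Finset V → Prop} (hC : DownClosed C) {k : ℕ} {R : Finset V}
    {x a : List V} {v : V} (h : Tight C k (x ++ a)) (ha : a.length + 1 = k)
    (hv : v ∈ extSet C R a.toFinset) : Tight C k (x ++ a ++ [v]) := by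
  refine h.glue (tight_of_nodup hC _ ?_ ?_) (by omega)
  · have := ((h.infix (List.suffix_append x a).isInfix).face (by omega)).1
    have hv := (mem_extSet.1 hv).2.1
    rw [List.nodup_append]
    simp only [List.mem_toFinset] at hv
    exact ⟨this, by simp, by rintro u hu w hw rfl; simp at hw; exact hv (hw ▸ hu)⟩
  · have hv := (mem_extSet.1 hv).2.2
    convert hv using 1
    ext; simp

/-- Lists of length `s` with entries in `A`. -/
noncomputable def listsOf (A : Finset V) (s : ℕ) : Finset (List V) :=
  (Fintype.piFinset fun _ : Fin s => A).image List.ofFn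

theorem mem_listsOf {A : Finset V} {s : ℕ} {l : List V} :
    l ∈ listsOf A s ↔ l.length = s ∧ ∀ v ∈ l, v ∈ A := by
  simp only [listsOf, Finset.mem_image, Fintype.mem_piFinset]
  constructor
  · rintro ⟨f, hf, rfl⟩
    refine ⟨by simp, fun v hv => ?_⟩
    obtain ⟨i, rfl⟩ := (List.mem_ofFn' _ _).1 hv
    exact hf i
  · rintro ⟨rfl, h⟩
    exact ⟨fun i => l.get i, fun i => h _ (List.get_mem l i), by simp⟩

theorem card_listsOf (A : Finset V) (s : ℕ) : (listsOf A s).card = A.card ^ s := by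
  rw [listsOf, Finset.card_image_of_injective _ List.ofFn_injective]
  simp

/-- Counting lists built by choosing entries one after another. -/
theorem exists_many_lists (Q : List V → Prop) (D : ℝ) (hD : 0 ≤ D) (j : ℕ)
    (Z : Finset (List V)) (hZ : ∀ z ∈ Z, z.length = j ∧ Q z) (N : ℕ)
    (hstep : ∀ z, Q z → j ≤ z.length → z.length < j + N →
      ∃ A : Finset V, D ≤ (A.card : ℝ) ∧ ∀ v ∈ A, Q (z ++ [v])) :
    ∃ Z' : Finset (List V), (Z.card : ℝ) * D ^ N ≤ (Z'.card : ℝ) ∧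
      ∀ z ∈ Z', z.length = j + N ∧ Q z := by
  induction N with
  | zero => exact ⟨Z, by simp, by simpa using hZ⟩
  | succ N ih =>
    obtain ⟨Z', h1, h2⟩ := ih (fun z hz hj hl => hstep z hz hj (by omega))
    choose! A hA hA' using fun z (hz : z ∈ Z') =>
      hstep z (h2 z hz).2 (by have := (h2 z hz).1; omega) (by have := (h2 z hz).1; omega)
    refine ⟨(Z'.sigma A).image fun q => q.1 ++ [q.2], ?_, ?_⟩
    · rw [Finset.card_image_of_injective, Finset.card_sigma]
      · push_cast
        calc (Z.card : ℝ) * D ^ (N + 1) = (Z.card * D ^ N) * D := by ring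
          _ ≤ Z'.card * D := by gcongr
          _ = ∑ z ∈ Z', D := by simp
          _ ≤ _ := Finset.sum_le_sum hA
      · rintro ⟨a, b⟩ ⟨c, d⟩ h
        have h : a ++ [b] = c ++ [d] := h
        obtain ⟨rfl, h⟩ := List.append_inj' h rfl
        simp at h
        simp [h]
    · simp only [Finset.mem_image, Finset.mem_sigma, Sigma.exists]
      rintro z ⟨a, b, ⟨ha, hb⟩, rfl⟩
      exact ⟨by simp [(h2 a ha).1]; omega, hA' a ha b hb⟩

/-- Lists over a large ground set `R` mostly have distinct entries. -/
theorem exists_nodup_of_many {R : Finset V} {s : ℕ} {c : ℝ} (W : Finset (List V))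
    (hW : ∀ w ∈ W, w.length = s ∧ ∀ v ∈ w, v ∈ R) (hc : c * (R.card : ℝ) ^ s ≤ W.card)
    (hR : (s : ℝ) ^ 2 < c * R.card) (hc0 : 0 < c): ∃ w ∈ W, w.Nodup := by
  rcases Nat.eq_zero_or_pos s with rfl | hs
  · have : 0 < W.card := by
      have : (0 : ℝ) < W.card := lt_of_lt_of_le (by simpa using hc0) hc
      exact_mod_cast this
    obtain ⟨w, hw⟩ := Finset.card_pos.1 this
    exact ⟨w, hw, by rw [List.eq_nil_of_length_eq_zero (hW w hw).1]; exact List.nodup_nil⟩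
  by_contra! hcon
  have hR0 : (0 : ℝ) < R.card := by
    by_contra h
    nlinarith [sq_nonneg (s : ℝ)]
  have hsub' : W ⊆ listsOf R s := fun w hw => mem_listsOf.2 (hW w hw)
  have hWc : (W.card : ℝ) ≤ (R.card : ℝ) ^ s := by
    have := Finset.card_le_card hsub'
    rw [card_listsOf] at this
    exact_mod_cast this
  have hc1 : c ≤ 1 := by
    by_contra h
    have : 0 < (R.card : ℝ) ^ s := by positivity
    nlinarith
  have hs1 : (1 : ℝ) ≤ s := by exact_mod_cast hs
  have hsR : (s : ℝ) ≤ R.card := by nlinarith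
  have hsR' : (s : ℝ) ^ 2 < R.card := by nlinarith
  obtain ⟨Z, h1, h2⟩ := exists_many_lists (fun z : List V => z.Nodup ∧ ∀ v ∈ z, v ∈ R)
    ((R.card : ℝ) - s) (by linarith) 0 {[]} (by simp) s (by
    intro z hz _ hl
    refine ⟨R \ z.toFinset, ?_, ?_⟩
    · have h3 : R.card ≤ (R \ z.toFinset).card + z.toFinset.card := by
        have := Finset.le_card_sdiff z.toFinset R
        omega
      have h4 := z.toFinset_card_le
      have : (R.card : ℝ) ≤ (R \ z.toFinset).card + s := by
        norm_cast; omega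
      linarith
    · intro v hv
      simp only [Finset.mem_sdiff, List.mem_toFinset] at hv
      refine ⟨?_, ?_⟩
      · rw [List.nodup_append]
        exact ⟨hz.1, by simp, by rintro u hu w hw rfl; simp at hw; exact hv.2 (hw ▸ hu)⟩
      · intro u hu
        simp at hu
        rcases hu with hu | rfl
        · exact hz.2 u hu
        · exact hv.1)
  have hd : Disjoint Z W := by
    rw [Finset.disjoint_left]
    intro z hz hw
    exact hcon z hw (h2 z hz).2.1
  have hsub : Z ∪ W ⊆ listsOf R s := by
    intro z hz
    rw [mem_listsOf]
    rcases Finset.mem_union.1 hz with hz | hz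
    · exact ⟨by simpa using (h2 z hz).1, (h2 z hz).2.2⟩
    · exact hW z hz
  have hcard := Finset.card_le_card hsub
  rw [Finset.card_union_of_disjoint hd, card_listsOf] at hcard
  have hcard : (Z.card : ℝ) + W.card ≤ (R.card : ℝ) ^ s := by exact_mod_cast hcard
  simp only [Finset.card_singleton, Nat.cast_one, one_mul] at h1
  have hb := one_add_mul_le_pow (a := -(s : ℝ) / R.card) (by
    have : (s : ℝ) / R.card ≤ 1 := by rw [div_le_one hR0]; exact hsR
    rw [neg_div]; linarith) s
  have h3 : ((R.card : ℝ) - s) ^ s = (R.card : ℝ) ^ s * (1 + -(s : ℝ) / R.card) ^ s := by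
    rw [← mul_pow]; congr 1; field_simp; ring
  have h4 : 0 < (R.card : ℝ) ^ s := by positivity
  have h5 : (R.card : ℝ) ^ s * (1 + s * (-(s : ℝ) / R.card)) ≤ ((R.card : ℝ) - s) ^ s := by
    rw [h3]; gcongr
  have h6 : (s : ℝ) * ((s : ℝ) / R.card) < c := by
    rw [← mul_div_assoc, div_lt_iff₀ hR0, ← sq]; exact hR
  have h7 : (R.card : ℝ) ^ s * (1 + c + s * (-(s : ℝ) / R.card)) ≤ (R.card : ℝ) ^ s := by
    linarith
  have h8 : 1 + c + s * (-(s : ℝ) / R.card) ≤ 1 := by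
    by_contra h
    nlinarith
  rw [neg_div] at h8
  linarith

end Lists

section Connecting

variable {V : Type}

/-- Place the entries of `xs` before, between and after the blocks of size `k` of `u`. -/
def interleave (k : ℕ) : List V → List V → List V
  | _, [] => []
  | u, x :: xs => x :: (u.take k ++ interleave k (u.drop k) xs)

theorem length_interleave (k : ℕ) (u xs : List V) (h : u.length + k = k * xs.length)
    (hk : 0 < k) : (interleave k u xs).length = u.length + xs.length := by
  induction xs generalizing u with
  | nil => simp at h; omega
  | cons x xs ih =>
    rcases xs with _ | ⟨y, xs⟩
    · simp at h; simp [h, interleave]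
    · rw [interleave]
      simp only [List.length_cons, List.length_append] at h ih ⊢
      have : k ≤ u.length := by nlinarith
      rw [ih (u.drop k) (by simp; rw [mul_add] at h; omega)]
      simp
      omega

theorem mem_interleave (k : ℕ) (u xs : List V) (v : V) (h : v ∈ interleave k u xs) :
    v ∈ u ∨ v ∈ xs := by
  induction xs generalizing u with
  | nil => simp [interleave] at h
  | cons x xs ih =>
    simp only [interleave, List.mem_cons, List.mem_append] at h ⊢
    rcases h with h | h | h
    · exact Or.inr (Or.inl h)
    · exact Or.inl (List.mem_of_mem_take h)
    · rcases ih _ h with h | h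
      · exact Or.inl (List.mem_of_mem_drop h)
      · exact Or.inr (Or.inr h)

theorem interleave_injective (k : ℕ) (hk : 0 < k) (u u' xs xs' : List V)
    (h : u.length + k = k * xs.length) (h' : u'.length = u.length) (hx : xs'.length = xs.length)
    (he : interleave k u xs = interleave k u' xs') : u = u' ∧ xs = xs' := by
  induction xs generalizing u u' xs' with
  | nil => simp at h; omega
  | cons x xs ih =>
    rcases xs' with _ | ⟨x', xs'⟩
    · simp at hx
    · simp only [interleave, List.cons.injEq] at he
      obtain ⟨rfl, he⟩ := he
      obtain ⟨h1, h2⟩ := List.append_inj he (by simp [h'])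
      simp only [List.length_cons] at h hx
      rcases xs with _ | ⟨y, xs⟩
      · simp at h hx
        subst h
        exact ⟨(List.eq_nil_of_length_eq_zero (by simpa using h')).symm, by
          rw [hx]⟩
      · simp only [List.length_cons] at h ih hx
        have : k ≤ u.length := by nlinarith
        obtain ⟨h3, h4⟩ := ih (u.drop k) (u'.drop k) xs' (by
            rw [List.length_drop]; simp only [mul_add] at h ⊢; omega)
          (by simp [h']) (by omega) h2
        refine ⟨?_, by simp [h4]⟩
        rw [← List.take_append_drop k u, ← List.take_append_drop k u', h1, h3]

variable [DecidableEq V]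

/-- The link of the vertex `x` in the complex `C`. -/
def linkOf (C : Finset V → Prop) (x : V) (S : Finset V) : Prop := x ∉ S ∧ C (insert x S)

theorem DownClosed.link {C : Finset V → Prop} (hC : DownClosed C) (x : V) :
    DownClosed (linkOf C x) := fun _ _ hST hT =>
  ⟨fun h => hT.1 (hST h), hC _ _ (Finset.insert_subset_insert x hST) hT.2⟩

theorem HasExt.link {C : Finset V → Prop} {k : ℕ} {R : Finset V} {d : ℝ}
    (h : HasExt C (k + 1) R d) (x : V) : HasExt (linkOf C x) k R d := by
  intro S hS hSk
  refine (h (insert x S) hS.2 (by rw [Finset.card_insert_of_notMem hS.1]; omega)).trans ?_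
  refine Nat.cast_le.2 (Finset.card_le_card fun v hv => ?_)
  rw [mem_extSet] at hv ⊢
  obtain ⟨h1, h2, h3⟩ := hv
  simp only [Finset.mem_insert, not_or] at h2
  refine ⟨h1, h2.2, ?_, by rwa [Finset.insert_comm]⟩
  simp only [Finset.mem_insert, not_or]
  exact ⟨fun h => h2.1 h.symm, hS.1⟩

theorem tight_insert_of_link {C : Finset V → Prop} (hC : DownClosed C) {k : ℕ} {B B' : List V}
    {x : V} (hB : B.length = k) (hB' : B'.length = k) (h : Tight (linkOf C x) k (B ++ B')) :
    Tight C (k + 1) (B ++ x :: B') := by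
  intro w hw hk
  have key : ∀ w, w <:+: B ++ B' → w.length ≤ k → w.Nodup ∧ C w.toFinset := fun w hw hk =>
    ⟨(h w hw hk).1, hC _ _ (Finset.subset_insert _ _) (h w hw hk).2.2⟩
  have main : ∀ p s, p ++ (w ++ s) = B ++ x :: B' → p.length ≤ B.length →
      w.Nodup ∧ C w.toFinset := by
    intro p s hps hp
    have h1 : ∃ as, B = p ++ as ∧ w ++ s = as ++ x :: B' := by
      rcases List.append_eq_append_iff.1 hps with ⟨as, h1, h2⟩ | ⟨bs, h1, h2⟩
      · exact ⟨as, h1, h2⟩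
      · have : bs = [] := by
          have := congrArg List.length h1
          simp at this
          exact List.eq_nil_of_length_eq_zero (by omega)
        subst this
        exact ⟨[], by simpa using h1.symm, by simpa using h2.symm⟩
    obtain ⟨as, h1, h2⟩ := h1
    rcases List.append_eq_append_iff.1 h2 with ⟨cs, h3, -⟩ | ⟨ds, h3, h4⟩
    · refine key w ⟨p, cs ++ B', by simp [h1, h3]⟩ ?_
      rw [← hB, h1, h3]; simp; omega
    · rcases ds with _ | ⟨y, ds⟩
      · refine key w ⟨p, B', by simp [h1, h3]⟩ ?_
        rw [← hB, h1, h3]; simp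
      · simp only [List.cons_append, List.cons.injEq] at h4
        obtain ⟨rfl, h4⟩ := h4
        subst h3
        have h5 := h (as ++ ds) ⟨p, s, by simp [h1, h4]⟩ (by simp at hk ⊢; omega)
        refine ⟨?_, ?_⟩
        · rw [List.nodup_middle, List.nodup_cons]
          exact ⟨fun hx => h5.2.1 (by simpa using hx), h5.1⟩
        · have h6 := h5.2.2
          convert h6 using 1
          ext; simp
  obtain ⟨p, s, hps⟩ := hw
  rw [List.append_assoc] at hps
  by_cases hp : p.length ≤ B.length
  · exact main p s hps hp
  · rcases List.append_eq_append_iff.1 hps with ⟨as, h1, -⟩ | ⟨bs, h1, h2⟩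
    · have := congrArg List.length h1
      simp at this; omega
    · rcases bs with _ | ⟨y, bs⟩
      · simp at h1; simp [h1] at hp
      · simp only [List.cons_append, List.cons.injEq] at h2
        refine key w ⟨B ++ bs, s, by simp [h2]⟩ ?_
        rw [← hB', h2.2]; simp; omega

theorem tight_interleave {C : Finset V → Prop} (hC : DownClosed C) {k : ℕ} (hk : 0 < k)
    (xs u a b : List V) (ha : a.length = k) (hb : b.length = k)
    (h : u.length + k = k * xs.length)
    (ht : ∀ x ∈ xs, Tight (linkOf C x) k (a ++ u ++ b)) :
    Tight C (k + 1) (a ++ interleave k u xs ++ b) := by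
  induction xs generalizing u a with
  | nil => simp at h; omega
  | cons x xs ih =>
    rcases xs with _ | ⟨y, xs⟩
    · simp at h
      subst h
      simp only [interleave, List.take_nil, List.nil_append]
      rw [List.append_assoc, List.singleton_append]
      exact tight_insert_of_link hC ha hb (by simpa using ht x (by simp))
    · have hku : k ≤ u.length := by simp only [List.length_cons] at h; nlinarith
      have h1 : Tight C (k + 1) (a ++ x :: u.take k) := by
        refine tight_insert_of_link hC ha (by simpa using hku) ?_
        refine (ht x (by simp)).infix ⟨[], u.drop k ++ b, ?_⟩
        rw [List.nil_append, List.append_assoc, List.append_assoc,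
          ← List.append_assoc (List.take k u), List.take_append_drop, ← List.append_assoc]
      have h2 := ih (u.drop k) (u.take k) (by simpa using hku)
        (by simp at h ⊢; rw [mul_add] at h; omega) (fun z hz => by
          refine (ht z (List.mem_cons_of_mem _ hz)).infix ⟨a, [], ?_⟩
          simp)
      rw [interleave]
      have := Tight.glue (x := a ++ [x]) (m := u.take k)
        (y := interleave k (u.drop k) (y :: xs) ++ b) (by simpa using h1) (by simpa using h2)
        (by simp; omega)
      simpa using this

/-- Any two tight ends can be joined by a `c`-fraction of all lists of length `s`. -/
def Connects (k s : ℕ) (γ c : ℝ) : Prop :=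
  ∀ (V : Type) [DecidableEq V] (C : Finset V → Prop) (R : Finset V) (d : ℝ), DownClosed C →
    HasExt C k R d → (1 + γ) * R.card ≤ 2 * d → ∀ a b : List V, a.length + 1 = k →
    b.length + 1 = k → Tight C k a → Tight C k b →
    ∃ W : Finset (List V), (∀ w ∈ W, w.length = s ∧ (∀ v ∈ w, v ∈ R) ∧ Tight C k (a ++ w ++ b)) ∧
      c * (R.card : ℝ) ^ s ≤ W.card

theorem Connects.succ {k s : ℕ} {γ c : ℝ} (hγ : 0 < γ) (hc : 0 < c) (h : Connects k s γ c) :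
    Connects k (s + 1) γ (c / 2) := by
  intro V _ C R d hC hE hd a b ha hb hta htb
  have hR0 : (0 : ℝ) ≤ R.card := by positivity
  have hface := hta.face (by omega)
  have hA := hE a.toFinset hface.2 (by rw [List.toFinset_card_of_nodup hface.1]; omega)
  have hsn : ∀ v ∈ extSet C R a.toFinset, Tight C k (a ++ [v]) := fun v hv => by
    simpa using Tight.snoc (x := []) hC (by simpa using hta) ha hv
  have hlen : ∀ v, ((a ++ [v]).tail).length + 1 = k := fun v => by simp; omega
  have hcons : ∀ v, ∃ y, a ++ [v] = y :: (a ++ [v]).tail := fun v => by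
    rcases h : a ++ [v] with _ | ⟨y, l⟩
    · simp at h
    · exact ⟨y, by simp⟩
  choose! W hW hWc using fun v (hv : v ∈ extSet C R a.toFinset) =>
    h V C R d hC hE hd (a ++ [v]).tail b (hlen v) hb
      ((hsn v hv).infix (List.tail_suffix _).isInfix) htb
  refine ⟨((extSet C R a.toFinset).sigma W).image fun q => q.1 :: q.2, ?_, ?_⟩
  · simp only [Finset.mem_image, Finset.mem_sigma, Sigma.exists]
    rintro w ⟨v, w, ⟨hv, hw⟩, rfl⟩
    obtain ⟨h1, h2, h3⟩ := hW v hv w hw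
    refine ⟨by simp [h1], ?_, ?_⟩
    · intro u hu
      rcases List.mem_cons.1 hu with rfl | hu
      · exact (mem_extSet.1 hv).1
      · exact h2 u hu
    · obtain ⟨y, hy⟩ := hcons v
      have h4 := hsn v hv
      rw [hy] at h4
      have := Tight.glue (x := [y]) (m := (a ++ [v]).tail) (y := w ++ b) (by simpa using h4)
        (by simpa using h3) (by have := hlen v; omega)
      rw [List.singleton_append, ← hy] at this
      simpa using this
  · rw [Finset.card_image_of_injective, Finset.card_sigma]
    · push_cast
      have h5 : (R.card : ℝ) / 2 ≤ (extSet C R a.toFinset).card := by nlinarith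
      calc c / 2 * (R.card : ℝ) ^ (s + 1) = (R.card : ℝ) / 2 * (c * (R.card : ℝ) ^ s) := by ring
        _ ≤ (extSet C R a.toFinset).card * (c * (R.card : ℝ) ^ s) := by gcongr
        _ = ∑ v ∈ extSet C R a.toFinset, c * (R.card : ℝ) ^ s := by simp
        _ ≤ _ := Finset.sum_le_sum hWc
    · rintro ⟨a, b⟩ ⟨c, d⟩ h
      have h : a :: b = c :: d := h
      simp only [List.cons.injEq] at h
      obtain ⟨rfl, rfl⟩ := h
      rfl

theorem Connects.one (s : ℕ) {γ : ℝ} (hγ : 0 < γ) : Connects 1 s γ ((1 / 2) ^ s) := by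
  intro V _ C R d hC hE hd a b ha hb hta htb
  have hR0 : (0 : ℝ) ≤ R.card := by positivity
  have ha : a = [] := List.eq_nil_of_length_eq_zero (by omega)
  have hb : b = [] := List.eq_nil_of_length_eq_zero (by omega)
  subst ha hb
  have h0 := (hta.face (by simp)).2
  refine ⟨listsOf (extSet C R ∅) s, ?_, ?_⟩
  · intro w hw
    rw [mem_listsOf] at hw
    refine ⟨hw.1, fun v hv => (mem_extSet.1 (hw.2 v hv)).1, ?_⟩
    intro u hu hk
    simp only [List.nil_append, List.append_nil] at hu
    rcases u with _ | ⟨v, _ | ⟨z, u⟩⟩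
    · exact ⟨List.nodup_nil, h0⟩
    · have := mem_extSet.1 (hw.2 v (hu.subset (by simp)))
      exact ⟨by simp, by simpa using this.2.2⟩
    · simp at hk
  · rw [card_listsOf]
    have h1 := hE ∅ h0 (by simp)
    push_cast
    rw [← mul_pow]
    gcongr
    nlinarith

theorem Connects.exists_succ_dim {k m : ℕ} {γ c : ℝ} (hk : 0 < k) (hγ : 0 < γ) (hc : 0 < c)
    (h : Connects k (m * k) γ c) :
    Connects (k + 1) (m * k + m + 1) γ ((γ * c) ^ (m + 1)) := by
  classical
  intro V _ C R d hC hE hd a b ha hb hta htb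
  rcases Nat.eq_zero_or_pos R.card with hR | hR
  · exact ⟨∅, by simp, by simp [hR]⟩
  have hR : (0 : ℝ) < R.card := by exact_mod_cast hR
  have ha' : a.length = k := by omega
  have hb' : b.length = k := by omega
  have hfa := hta.face (by omega)
  have hfb := htb.face (by omega)
  have hA := hE a.toFinset hfa.2 (by rw [List.toFinset_card_of_nodup hfa.1]; omega)
  have hB := hE b.toFinset hfb.2 (by rw [List.toFinset_card_of_nodup hfb.1]; omega)
  set X := extSet C R a.toFinset ∩ extSet C R b.toFinset with hXdef
  have hX : γ * R.card ≤ (X.card : ℝ) := by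
    have h1 := Finset.card_union_add_card_inter (extSet C R a.toFinset) (extSet C R b.toFinset)
    have h2 : (extSet C R a.toFinset ∪ extSet C R b.toFinset).card ≤ R.card :=
      Finset.card_le_card (Finset.union_subset (Finset.filter_subset _ _)
        (Finset.filter_subset _ _))
    have h1' : ((extSet C R a.toFinset ∪ extSet C R b.toFinset).card : ℝ) + X.card =
      (extSet C R a.toFinset).card + (extSet C R b.toFinset).card := by exact_mod_cast h1
    have h2' : ((extSet C R a.toFinset ∪ extSet C R b.toFinset).card : ℝ) ≤ R.card := by
      exact_mod_cast h2
    linarith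
  have hlink : ∀ x ∈ X, Tight (linkOf C x) k a ∧ Tight (linkOf C x) k b := by
    intro x hx
    obtain ⟨hxa, hxb⟩ := Finset.mem_inter.1 hx
    exact ⟨tight_of_nodup (hC.link x) k hfa.1 (mem_extSet.1 hxa).2,
      tight_of_nodup (hC.link x) k hfb.1 (mem_extSet.1 hxb).2⟩
  choose! W hW hWc using fun x (hx : x ∈ X) =>
    h V (linkOf C x) R d (hC.link x) (hE.link x) hd a.tail b.dropLast
      (by simp; omega) (by simp; omega)
      ((hlink x hx).1.infix (List.tail_suffix _).isInfix)
      ((hlink x hx).2.infix (List.dropLast_prefix _).isInfix)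
  have hWt : ∀ x ∈ X, ∀ u ∈ W x, Tight (linkOf C x) k (a ++ u ++ b) := by
    intro x hx u hu
    obtain ⟨h1, h2⟩ := hlink x hx
    have h3 := (hW x hx u hu).2.2
    obtain ⟨y, hy⟩ : ∃ y, a = [y] ++ a.tail := by
      rcases h : a with _ | ⟨y, l⟩
      · simp [h] at ha'; omega
      · exact ⟨y, by simp⟩
    obtain ⟨z, hz⟩ : ∃ z, b = b.dropLast ++ [z] := by
      have hne : b ≠ [] := by rintro rfl; simp at hb'; omega
      exact ⟨b.getLast hne, (List.dropLast_append_getLast hne).symm⟩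
    rw [hy] at h1
    rw [hz] at h2
    have h4 := Tight.glue (x := [y]) (m := a.tail) (y := u ++ b.dropLast) h1 (by simpa using h3)
      (by simp; omega)
    rw [← hy] at h4
    have h5 := Tight.glue (x := a ++ u) (m := b.dropLast) (y := [z]) (by simpa using h4) h2
      (by simp; omega)
    rw [List.append_assoc, ← hz] at h5
    exact h5
  set N : List V → Finset V := fun u => X.filter fun x => u ∈ W x with hN
  set P := (listsOf R (m * k)).sigma fun u => listsOf (N u) (m + 1) with hP
  refine ⟨P.image fun q => interleave k q.1 q.2, ?_, ?_⟩
  · simp only [Finset.mem_image, Sigma.exists, hP, Finset.mem_sigma, mem_listsOf]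
    rintro w ⟨u, xs, ⟨⟨hu, huR⟩, hxs, hx⟩, rfl⟩
    have hlen : u.length + k = k * xs.length := by rw [hu, hxs]; ring
    refine ⟨by rw [length_interleave k u xs hlen hk, hu, hxs]; ring, ?_, ?_⟩
    · intro v hv
      rcases mem_interleave k u xs v hv with hv | hv
      · exact huR v hv
      · have := (Finset.mem_filter.1 (hx v hv)).1
        exact (mem_extSet.1 (Finset.mem_inter.1 this).1).1
    · refine tight_interleave hC hk xs u a b ha' hb' hlen fun x hx' => ?_
      have := Finset.mem_filter.1 (hx x hx')
      exact hWt x this.1 u this.2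
  · have hinj : Set.InjOn (fun q : Σ _ : List V, List V => interleave k q.1 q.2) P := by
      rintro ⟨u, xs⟩ hq ⟨u', xs'⟩ hq' he
      simp only [hP, Finset.coe_sigma, Set.mem_sigma_iff, Finset.mem_coe, mem_listsOf] at hq hq'
      obtain ⟨h1, h2⟩ := interleave_injective k hk u u' xs xs'
        (by rw [hq.1.1, hq.2.1]; ring) (by rw [hq.1.1, hq'.1.1]) (by rw [hq.2.1, hq'.2.1]) he
      simp [h1, h2]
    rw [Finset.card_image_of_injOn hinj, hP, Finset.card_sigma]
    simp only [card_listsOf]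
    push_cast
    have hsum : ∑ u ∈ listsOf R (m * k), ((N u).card : ℝ) = ∑ x ∈ X, ((W x).card : ℝ) := by
      have h1 : ∀ u, ((N u).card : ℝ) = ∑ x ∈ X, if u ∈ W x then (1 : ℝ) else 0 := by
        intro u; simp [hN]
      simp only [h1]
      rw [Finset.sum_comm]
      refine Finset.sum_congr rfl fun x hx => ?_
      rw [Finset.sum_ite_mem]
      simp only [Finset.sum_const, nsmul_eq_mul, mul_one]
      congr 2
      exact Finset.inter_eq_right.2 fun u hu =>
        mem_listsOf.2 ⟨(hW x hx u hu).1, (hW x hx u hu).2.1⟩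
    have hge : γ * c * (R.card : ℝ) ^ (m * k + 1) ≤ ∑ u ∈ listsOf R (m * k), ((N u).card : ℝ) := by
      rw [hsum]
      calc γ * c * (R.card : ℝ) ^ (m * k + 1) = (γ * R.card) * (c * (R.card : ℝ) ^ (m * k)) := by
            ring
        _ ≤ X.card * (c * (R.card : ℝ) ^ (m * k)) := by gcongr
        _ = ∑ x ∈ X, c * (R.card : ℝ) ^ (m * k) := by simp
        _ ≤ _ := Finset.sum_le_sum hWc
    have hpm := pow_sum_div_card_le_sum_pow (s := listsOf R (m * k))
      (f := fun u => ((N u).card : ℝ)) (fun u _ => by positivity) m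
    refine le_trans ?_ hpm
    rw [card_listsOf, le_div_iff₀ (by positivity)]
    push_cast
    refine le_trans (le_of_eq ?_) (pow_le_pow_left₀ (by positivity) hge (m + 1))
    rw [mul_pow (γ * c), ← pow_mul, ← pow_mul, mul_assoc, ← pow_add]
    congr 2
    ring

theorem exists_connects (k : ℕ) (hk : 0 < k) {γ : ℝ} (hγ : 0 < γ) :
    ∃ s₀, ∀ s, s₀ ≤ s → ∃ c, 0 < c ∧ Connects k s γ c := by
  induction k, hk using Nat.le_induction with
  | base => exact ⟨0, fun s _ => ⟨_, by positivity, Connects.one s hγ⟩⟩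
  | succ k hk ih =>
    obtain ⟨s₀, h⟩ := ih
    obtain ⟨c, hc, h1⟩ := h (s₀ * k) (Nat.le_mul_of_pos_right _ hk)
    refine ⟨s₀ * k + s₀ + 1, fun s hs => ?_⟩
    induction s, hs using Nat.le_induction with
    | base => exact ⟨_, by positivity, h1.exists_succ_dim hk hγ hc⟩
    | succ s hs ih =>
      obtain ⟨c, hc, h2⟩ := ih
      exact ⟨_, by positivity, h2.succ hγ hc⟩

/-- Connection with a constant that is uniform over a window of lengths. -/
theorem exists_connects_uniform (k : ℕ) (hk : 0 < k) {γ : ℝ} (hγ : 0 < γ) :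
    ∃ s₀ c, 0 < c ∧ ∀ s, s₀ ≤ s → s ≤ s₀ + k → Connects k s γ c := by
  obtain ⟨s₀, h⟩ := exists_connects k hk hγ
  choose! c hc hcon using h
  have hne : (Finset.Icc s₀ (s₀ + k)).Nonempty := ⟨s₀, by simp⟩
  refine ⟨s₀, (Finset.Icc s₀ (s₀ + k)).inf' hne c, ?_, fun s h1 h2 => ?_⟩
  · rw [Finset.lt_inf'_iff]
    intro s hs
    exact hc s (Finset.mem_Icc.1 hs).1
  · intro V _ C R d hC hE hd a b ha hb hta htb
    obtain ⟨W, hW, hWc⟩ := hcon s h1 V C R d hC hE hd a b ha hb hta htb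
    refine ⟨W, hW, le_trans ?_ hWc⟩
    gcongr
    exact Finset.inf'_le _ (Finset.mem_Icc.2 ⟨h1, h2⟩)

end Connecting

section MultiConnect

variable {V : Type} [DecidableEq V]

theorem HasExt.sdiff {C : Finset V → Prop} {k : ℕ} {R : Finset V} {d : ℝ}
    (h : HasExt C k R d) (U : Finset V) : HasExt C k (R \ U) (d - U.card) := by
  intro S hS hSk
  have h1 := h S hS hSk
  have h2 : extSet C R S ⊆ extSet C (R \ U) S ∪ U := by
    intro v hv
    rw [mem_extSet] at hv
    by_cases hvU : v ∈ U
    · exact Finset.mem_union_right _ hvU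
    · exact Finset.mem_union_left _
        (mem_extSet.2 ⟨Finset.mem_sdiff.2 ⟨hv.1, hvU⟩, hv.2⟩)
  have h3 := (Finset.card_le_card h2).trans (Finset.card_union_le _ _)
  have h4 : ((extSet C R S).card : ℝ) ≤ (extSet C (R \ U) S).card + U.card := by
    exact_mod_cast h3
  linarith

theorem HasExt.mono {C : Finset V → Prop} {k : ℕ} {R : Finset V} {d d' : ℝ}
    (h : HasExt C k R d) (hd : d' ≤ d) : HasExt C k R d' :=
  fun S hS hSk => hd.trans (h S hS hSk)

/-- Join many pairs of tight ends by pairwise disjoint connectors inside a reservoir. -/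
theorem exists_connectors {k s₀ : ℕ} {γ c : ℝ} (hγ : 0 < γ) (hc : 0 < c)
    (hcon : ∀ s, s₀ ≤ s → s ≤ s₀ + k → Connects k s γ c)
    {C : Finset V → Prop} (hC : DownClosed C) (a b : ℕ → List V) (s : ℕ → ℕ) (N : ℕ)
    (hs : ∀ i < N, s₀ ≤ s i ∧ s i ≤ s₀ + k)
    (ha : ∀ i < N, (a i).length + 1 = k ∧ Tight C k (a i))
    (hb : ∀ i < N, (b i).length + 1 = k ∧ Tight C k (b i))
    (R : Finset V) (d : ℝ) (hE : HasExt C k R d)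
    (hd : (1 + γ) * R.card ≤ 2 * (d - N * (s₀ + k : ℕ)))
    (hR : ((s₀ + k : ℕ) : ℝ) ^ 2 < c * (R.card - N * (s₀ + k : ℕ))) :
    ∃ w : ℕ → List V, (∀ i < N, (w i).length = s i ∧ (∀ v ∈ w i, v ∈ R) ∧ (w i).Nodup ∧
      Tight C k (a i ++ w i ++ b i)) ∧ ∀ i < N, ∀ j < i, List.Disjoint (w i) (w j) := by
  induction N with
  | zero => exact ⟨fun _ => [], by simp, by simp⟩
  | succ N ih =>
    have hB : (0 : ℝ) ≤ (s₀ + k : ℕ) := by positivity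
    push_cast at hd hR
    obtain ⟨w, hw, hdis⟩ := ih (fun i hi => hs i (by omega)) (fun i hi => ha i (by omega))
      (fun i hi => hb i (by omega)) (by push_cast; push_cast at hB; nlinarith)
      (by push_cast; push_cast at hB; nlinarith)
    set U : Finset V := (Finset.range N).biUnion fun i => (w i).toFinset with hU
    have hUc : (U.card : ℝ) ≤ N * (s₀ + k : ℕ) := by
      have : U.card ≤ N * (s₀ + k) := by
        refine Finset.card_biUnion_le.trans ?_
        have : ∀ i ∈ Finset.range N, ((w i).toFinset).card ≤ s₀ + k := fun i hi => by
          have hi := Finset.mem_range.1 hi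
          exact ((w i).toFinset_card_le).trans ((hw i hi).1.le.trans (hs i (by omega)).2)
        exact (Finset.sum_le_sum this).trans (by simp)
      exact_mod_cast this
    push_cast at hUc hB
    have hRU : ((R \ U).card : ℝ) ≤ R.card :=
      Nat.cast_le.2 (Finset.card_le_card Finset.sdiff_subset)
    have hRU' : (R.card : ℝ) - U.card ≤ (R \ U).card := by
      have := Finset.le_card_sdiff U R
      have : R.card ≤ (R \ U).card + U.card := by omega
      have : (R.card : ℝ) ≤ (R \ U).card + U.card := by exact_mod_cast this
      linarith
    obtain ⟨W, hW, hWc⟩ := hcon (s N) (hs N (by omega)).1 (hs N (by omega)).2 V C (R \ U)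
      (d - U.card) hC (hE.sdiff U) (by nlinarith) (a N) (b N) (ha N (by omega)).1
      (hb N (by omega)).1 (ha N (by omega)).2 (hb N (by omega)).2
    obtain ⟨u, hu, hun⟩ := exists_nodup_of_many W (fun w hw => ⟨(hW w hw).1, (hW w hw).2.1⟩) hWc
      (by
        have h1 : (s N : ℝ) ≤ s₀ + k := by exact_mod_cast (hs N (by omega)).2
        have h2 : (s N : ℝ) ^ 2 ≤ ((s₀ : ℝ) + k) ^ 2 := by gcongr
        refine (h2.trans_lt hR).trans_le ?_
        gcongr
        linarith) hc
    obtain ⟨hu1, hu2, hu3⟩ := hW u hu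
    refine ⟨fun i => if i = N then u else w i, ?_, ?_⟩
    · intro i hi
      by_cases h : i = N
      · subst h
        simp only [if_true]
        exact ⟨hu1, fun v hv => (Finset.mem_sdiff.1 (hu2 v hv)).1, hun, hu3⟩
      · simp only [h, if_false]
        exact hw i (by omega)
    · intro i hi j hj
      have hjN : j ≠ N := by omega
      by_cases h : i = N
      · subst h
        simp only [if_true, hjN, if_false]
        intro v hv hv'
        refine (Finset.mem_sdiff.1 (hu2 v hv)).2 ?_
        rw [hU, Finset.mem_biUnion]
        exact ⟨j, Finset.mem_range.2 hj, by simpa using hv'⟩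
      · simp only [h, hjN, if_false]
        exact hdis i (by omega) j hj

end MultiConnect

section Absorb

variable {V : Type} [DecidableEq V]

/-- The vertex `x` can be inserted in the middle of the tight list `z` of length `2(k - 1)`. -/
def AbsorbedBy (C : Finset V → Prop) (k : ℕ) (x : V) (z : List V) : Prop :=
  x ∉ z ∧ Tight C k (z.take (k - 1) ++ x :: z.drop (k - 1))

theorem card_extSet_inter [Fintype V] {C : Finset V → Prop} {k : ℕ} {d : ℝ}
    (hE : HasExt C k univ d) {S T : Finset V} (hS : C S) (hT : C T) (hSk : S.card < k)
    (hTk : T.card < k) (U : Finset V) :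
    2 * d - Fintype.card V - U.card ≤
      (((extSet C univ S ∩ extSet C univ T) \ U).card : ℝ) := by
  have h1 := hE S hS hSk
  have h2 := hE T hT hTk
  have h3 := Finset.card_union_add_card_inter (extSet C univ S) (extSet C univ T)
  have h4 := Finset.card_le_univ (extSet C univ S ∪ extSet C univ T)
  have h5 := Finset.le_card_sdiff U (extSet C univ S ∩ extSet C univ T)
  have h6 : (extSet C univ S).card + (extSet C univ T).card ≤
      Fintype.card V + U.card + ((extSet C univ S ∩ extSet C univ T) \ U).card := by omega
  have h7 : ((extSet C univ S).card : ℝ) + (extSet C univ T).card ≤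
      Fintype.card V + U.card + ((extSet C univ S ∩ extSet C univ T) \ U).card := by
    exact_mod_cast h6
  linarith

theorem HasExt.le_card [Fintype V] {C : Finset V → Prop} {k : ℕ} {d : ℝ}
    (hE : HasExt C k univ d) (hk : 0 < k) (h : C ∅) : d ≤ Fintype.card V :=
  (hE ∅ h (by simpa using hk)).trans (by exact_mod_cast Finset.card_le_univ _)

theorem exists_many_absorbers [Fintype V] {C : Finset V → Prop} (hC : DownClosed C) {k : ℕ}
    (hk : 0 < k) {d D : ℝ} (hE : HasExt C k univ d) (U : Finset V) {x : V} (hx : C {x})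
    (hD0 : 0 ≤ D) (hD : D ≤ 2 * d - Fintype.card V - U.card - 2 * k) :
    ∃ Z : Finset (List V), D ^ (2 * (k - 1)) ≤ Z.card ∧ ∀ z ∈ Z, z.length = 2 * (k - 1) ∧
      z.Nodup ∧ (∀ v ∈ z, v ∉ U) ∧ Tight C k z ∧ AbsorbedBy C k x z := by
  have hdn := hE.le_card hk (hC _ _ (Finset.empty_subset _) hx)
  obtain ⟨Z₁, hZ₁, hZ₁'⟩ := exists_many_lists
    (fun z : List V => z.Nodup ∧ (∀ v ∈ z, v ∉ U) ∧ x ∉ z ∧ C (insert x z.toFinset)) D hD0 0 {[]}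
    (by simpa using hx) (k - 1) (by
      rintro z ⟨h1, h2, h3, h4⟩ - hl
      have hc : (insert x z.toFinset).card < k := by
        rw [Finset.card_insert_of_notMem (by simpa using h3), List.toFinset_card_of_nodup h1]
        omega
      refine ⟨extSet C univ (insert x z.toFinset) \ U, ?_, ?_⟩
      · have := card_extSet_inter hE h4 h4 hc hc U
        rw [Finset.inter_self] at this
        have hk' : (0 : ℝ) ≤ k := by positivity
        linarith
      · intro v hv
        rw [Finset.mem_sdiff, mem_extSet] at hv
        obtain ⟨⟨-, hv1, hv2⟩, hv3⟩ := hv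
        simp only [Finset.mem_insert, List.mem_toFinset, not_or] at hv1
        refine ⟨?_, ?_, ?_, ?_⟩
        · rw [List.nodup_append]
          exact ⟨h1, by simp, by rintro u hu w hw rfl; simp at hw; exact hv1.2 (hw ▸ hu)⟩
        · intro u hu
          rcases List.mem_append.1 hu with hu | hu
          · exact h2 u hu
          · simp at hu; exact hu ▸ hv3
        · simp only [List.mem_append, List.mem_singleton, not_or]
          exact ⟨h3, fun h => hv1.1 h.symm⟩
        · convert hv2 using 1
          ext; simp; tauto)
  obtain ⟨Z₂, hZ₂, hZ₂'⟩ := exists_many_lists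
    (fun z : List V => k - 1 ≤ z.length ∧ z.Nodup ∧ (∀ v ∈ z, v ∉ U) ∧ Tight C k z ∧
      AbsorbedBy C k x z) D hD0 (k - 1) Z₁ (by
      intro z hz
      obtain ⟨h0, h1, h2, h3, h4⟩ := hZ₁' z hz
      have hl : z.length = k - 1 := by simpa using h0
      refine ⟨hl, hl.ge, h1, h2, ?_, h3, ?_⟩
      · exact tight_of_nodup hC k h1 (hC _ _ (Finset.subset_insert _ _) h4)
      · rw [List.take_of_length_le hl.le, List.drop_of_length_le hl.le]
        refine tight_of_nodup hC k ?_ ?_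
        · rw [List.nodup_append]
          exact ⟨h1, by simp, by rintro u hu w hw rfl; simp at hw; exact h3 (hw ▸ hu)⟩
        · convert h4 using 1
          ext; simp) (k - 1) (by
      rintro z ⟨h0, h1, h2, h3, h4, h5⟩ - hl
      have hins : (z.take (k - 1) ++ x :: z.drop (k - 1)).length = z.length + 1 := by
        simp; omega
      set y := z.take (k - 1) ++ x :: z.drop (k - 1) with hy
      obtain ⟨p, m, hpm, hm⟩ : ∃ p m, z = p ++ m ∧ m.length = k - 1 :=
        ⟨z.take (z.length - (k - 1)), z.drop (z.length - (k - 1)), by simp, by simp; omega⟩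
      obtain ⟨p', m', hpm', hm'⟩ : ∃ p m, y = p ++ m ∧ m.length = k - 1 :=
        ⟨y.take (y.length - (k - 1)), y.drop (y.length - (k - 1)), by simp, by simp; omega⟩
      rw [hpm] at h3
      rw [hpm'] at h5
      have hf := (h3.infix (List.suffix_append p m).isInfix).face (by omega)
      have hf' := (h5.infix (List.suffix_append p' m').isInfix).face (by omega)
      refine ⟨(extSet C univ m.toFinset ∩ extSet C univ m'.toFinset) \
        (U ∪ insert x z.toFinset), ?_, ?_⟩
      · have := card_extSet_inter hE hf.2 hf'.2
          (by rw [List.toFinset_card_of_nodup hf.1]; omega)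
          (by rw [List.toFinset_card_of_nodup hf'.1]; omega) (U ∪ insert x z.toFinset)
        have h6 : (U ∪ insert x z.toFinset).card ≤ U.card + 2 * k := by
          refine (Finset.card_union_le _ _).trans ?_
          have := Finset.card_insert_le x z.toFinset
          have := z.toFinset_card_le
          omega
        have h7 : ((U ∪ insert x z.toFinset).card : ℝ) ≤ U.card + 2 * k := by exact_mod_cast h6
        linarith
      · intro v hv
        simp only [Finset.mem_sdiff, Finset.mem_inter, Finset.mem_union, Finset.mem_insert,
          List.mem_toFinset, not_or] at hv
        obtain ⟨⟨hv1, hv2⟩, hv3, hv4, hv5⟩ := hv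
        refine ⟨by simp; omega, ?_, ?_, ?_, ?_, ?_⟩
        · rw [List.nodup_append]
          exact ⟨h1, by simp, by rintro u hu w hw rfl; simp at hw; exact hv5 (hw ▸ hu)⟩
        · intro u hu
          rcases List.mem_append.1 hu with hu | hu
          · exact h2 u hu
          · simp at hu; exact hu ▸ hv3
        · rw [hpm]
          exact h3.snoc hC (by omega) hv1
        · simp only [List.mem_append, List.mem_singleton, not_or]
          exact ⟨h4, fun h => hv4 h.symm⟩
        · have := h5.snoc hC (by omega) hv2
          rw [← hpm', hy] at this
          rw [List.take_append_of_le_length h0, List.drop_append_of_le_length h0]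
          simpa using this)
  refine ⟨Z₂, ?_, fun z hz => ?_⟩
  · refine le_trans ?_ hZ₂
    rw [two_mul, pow_add]
    gcongr
    simpa using hZ₁
  · obtain ⟨h1, -, h2⟩ := hZ₂' z hz
    exact ⟨by omega, h2⟩

open Classical in
/-- Choose disjoint absorbing sites greedily so that every vertex is absorbed by many of them. -/
theorem exists_sites [Fintype V] {C : Finset V → Prop} (hC : DownClosed C) {k : ℕ} (hk : 0 < k)
    {d δ : ℝ} (hE : HasExt C k univ d) (hV : 0 < Fintype.card V) (hx : ∀ x, C {x}) (hδ : 0 < δ)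
    (M : ℕ) (hM : δ * Fintype.card V ≤
      2 * d - Fintype.card V - M * (2 * (k - 1) : ℕ) - 2 * k) :
    ∃ z : ℕ → List V, (∀ i < M, (z i).length = 2 * (k - 1) ∧ (z i).Nodup ∧ Tight C k (z i)) ∧
      (∀ i < M, ∀ j < i, List.Disjoint (z i) (z j)) ∧
      ∑ x, (1 / 2 : ℝ) ^ ((Finset.range M).filter fun i => AbsorbedBy C k x (z i)).card ≤
        Fintype.card V * (1 - δ ^ (2 * (k - 1)) / 2) ^ M := by
  set n := Fintype.card V with hn
  have hnR : (0 : ℝ) < n := by exact_mod_cast hV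
  induction M with
  | zero => exact ⟨fun _ => [], by simp, by simp, by simp [hn]⟩
  | succ M ih =>
    push_cast at hM
    obtain ⟨z, hz, hdis, hpot⟩ := ih (by
      push_cast
      have : (0 : ℝ) ≤ 2 * ((k - 1 : ℕ) : ℝ) := by positivity
      linarith)
    set wt : V → ℝ := fun x =>
      (1 / 2 : ℝ) ^ ((Finset.range M).filter fun i => AbsorbedBy C k x (z i)).card with hwt
    have hwt0 : ∀ x, 0 < wt x := fun x => by simp only [hwt]; positivity
    set U : Finset V := (Finset.range M).biUnion fun i => (z i).toFinset with hU
    have hUc : (U.card : ℝ) ≤ M * (2 * ((k - 1 : ℕ) : ℝ)) := by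
      have : U.card ≤ M * (2 * (k - 1)) := by
        refine Finset.card_biUnion_le.trans ?_
        have : ∀ i ∈ Finset.range M, ((z i).toFinset).card ≤ 2 * (k - 1) := fun i hi =>
          ((z i).toFinset_card_le).trans (hz i (Finset.mem_range.1 hi)).1.le
        exact (Finset.sum_le_sum this).trans (by simp)
      exact_mod_cast this
    have hk1 : (0 : ℝ) ≤ ((k - 1 : ℕ) : ℝ) := by positivity
    choose Z hZc hZ using fun x => exists_many_absorbers hC hk hE U (hx x)
      (D := δ * n) (by positivity) (by rw [← hn]; linarith)
    have hsum : δ ^ (2 * (k - 1)) * (n : ℝ) ^ (2 * (k - 1)) * ∑ x, wt x ≤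
        ∑ u ∈ listsOf (univ : Finset V) (2 * (k - 1)), ∑ x, if u ∈ Z x then wt x else 0 := by
      rw [Finset.sum_comm, Finset.mul_sum]
      refine Finset.sum_le_sum fun x _ => ?_
      rw [Finset.sum_ite_mem, Finset.inter_eq_right.2 (fun u hu =>
        mem_listsOf.2 ⟨(hZ x u hu).1, by simp⟩)]
      simp only [Finset.sum_const, nsmul_eq_mul]
      rw [← mul_pow]
      exact mul_le_mul_of_nonneg_right (hZc x) (hwt0 x).le
    obtain ⟨u, hu, huw⟩ : ∃ u ∈ listsOf (univ : Finset V) (2 * (k - 1)),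
        δ ^ (2 * (k - 1)) * ∑ x, wt x ≤ ∑ x, if u ∈ Z x then wt x else 0 := by
      refine Finset.exists_le_of_sum_le ?_ (le_trans (le_of_eq ?_) hsum)
      · rw [← Finset.card_pos, card_listsOf, Finset.card_univ]; positivity
      · simp only [Finset.sum_const, card_listsOf, Finset.card_univ, nsmul_eq_mul]
        push_cast
        ring
    have hWpos : 0 < ∑ x, wt x := by
      obtain ⟨v⟩ : Nonempty V := Fintype.card_pos_iff.1 hV
      exact Finset.sum_pos (fun x _ => hwt0 x) ⟨v, by simp⟩
    obtain ⟨x₀, hx₀⟩ : ∃ x, u ∈ Z x := by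
      by_contra! h
      simp only [h, if_false, Finset.sum_const_zero] at huw
      have : 0 < δ ^ (2 * (k - 1)) * ∑ x, wt x := by positivity
      linarith
    obtain ⟨hu1, hu2, hu3, hu4, -⟩ := hZ x₀ u hx₀
    refine ⟨fun i => if i = M then u else z i, ?_, ?_, ?_⟩
    · intro i hi
      by_cases h : i = M
      · simp only [h, if_true]
        exact ⟨hu1, hu2, hu4⟩
      · simp only [h, if_false]
        exact hz i (by omega)
    · intro i hi j hj
      have hjN : j ≠ M := by omega
      by_cases h : i = M
      · subst h
        simp only [if_true, hjN, if_false]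
        intro v hv hv'
        refine hu3 v hv ?_
        rw [hU, Finset.mem_biUnion]
        exact ⟨j, Finset.mem_range.2 hj, by simpa using hv'⟩
      · simp only [h, hjN, if_false]
        exact hdis i (by omega) j hj
    · have hstep : ∀ x, (1 / 2 : ℝ) ^ ((Finset.range (M + 1)).filter fun i =>
          AbsorbedBy C k x (if i = M then u else z i)).card ≤
          wt x - (if u ∈ Z x then wt x else 0) / 2 := by
        intro x
        have hsplit : ((Finset.range (M + 1)).filter fun i =>
            AbsorbedBy C k x (if i = M then u else z i)).card =
            ((Finset.range M).filter fun i => AbsorbedBy C k x (z i)).card +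
              if AbsorbedBy C k x u then 1 else 0 := by
          rw [Finset.range_add_one, Finset.filter_insert]
          have hsame : ((Finset.range M).filter fun i =>
              AbsorbedBy C k x (if i = M then u else z i)) =
              (Finset.range M).filter fun i => AbsorbedBy C k x (z i) :=
            Finset.filter_congr fun i hi => by
              have : i ≠ M := (Finset.mem_range.1 hi).ne
              simp [this]
          rw [hsame]
          by_cases h : AbsorbedBy C k x u <;> simp [h]
        rw [hsplit, pow_add]
        change wt x * _ ≤ _
        by_cases h : u ∈ Z x
        · have := (hZ x u h).2.2.2.2
          simp only [this, h, if_true]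
          linarith
        · simp only [h, if_false]
          have h1 : (1 / 2 : ℝ) ^ (if AbsorbedBy C k x u then 1 else 0) ≤ 1 :=
            pow_le_one₀ (by norm_num) (by norm_num)
          have := hwt0 x
          nlinarith
      refine (Finset.sum_le_sum fun x _ => hstep x).trans ?_
      rw [Finset.sum_sub_distrib, ← Finset.sum_div]
      have hc1 : δ ^ (2 * (k - 1)) / 2 ≤ 1 := by
        have hd := hE.le_card hk (hC _ _ (Finset.empty_subset _) (hx x₀))
        have h0 : (0 : ℝ) ≤ M := by positivity
        have : δ * n ≤ 1 * n := by rw [← hn] at hd; nlinarith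
        have : δ ≤ 1 := le_of_mul_le_mul_right this hnR
        have : δ ^ (2 * (k - 1)) ≤ 1 := pow_le_one₀ hδ.le this
        linarith
      rw [pow_succ]
      nlinarith

end Absorb

section Assembly

/-- Concatenate the sites `z i` and connectors `w i`, inserting `o i` in the middle of `z i`. -/
def absorbPath {V : Type} (k : ℕ) (z w o : ℕ → List V) : ℕ → List V
  | 0 => (z 0).take (k - 1) ++ o 0 ++ (z 0).drop (k - 1)
  | i + 1 => absorbPath k z w o i ++ w i ++
      ((z (i + 1)).take (k - 1) ++ o (i + 1) ++ (z (i + 1)).drop (k - 1))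

variable {V : Type}

theorem absorbPath_prefix (k : ℕ) (z w o : ℕ → List V) (m : ℕ) :
    ∃ r, absorbPath k z w o m = (z 0).take (k - 1) ++ r := by
  induction m with
  | zero => exact ⟨_, by rw [absorbPath, List.append_assoc]⟩
  | succ m ih =>
    obtain ⟨r, hr⟩ := ih
    exact ⟨_, by rw [absorbPath, hr, List.append_assoc, List.append_assoc]⟩

theorem absorbPath_suffix (k : ℕ) (z w o : ℕ → List V) (m : ℕ) :
    ∃ r, absorbPath k z w o m = r ++ (z m).drop (k - 1) := by
  cases m with
  | zero => exact ⟨_, rfl⟩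
  | succ m => exact ⟨_, by rw [absorbPath, ← List.append_assoc]⟩

variable [DecidableEq V]

theorem absorbPath_perm (k : ℕ) (z w o : ℕ → List V) (m : ℕ) :
    (absorbPath k z w o m).Perm ((List.range (m + 1)).flatMap z ++ (List.range m).flatMap w ++
      (List.range (m + 1)).flatMap o) := by
  have h : ∀ i v, List.count v ((z i).take (k - 1)) + List.count v ((z i).drop (k - 1)) =
      List.count v (z i) := fun i v => by
    rw [← List.count_append, List.take_append_drop]
  rw [List.perm_iff_count]
  intro v
  induction m with
  | zero => have := h 0 v; simp [absorbPath]; omega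
  | succ m ih =>
    have h1 := h (m + 1) v
    rw [List.range_succ (n := m + 1), List.range_succ (n := m)]
    simp only [absorbPath, List.count_append, List.flatMap_append, List.flatMap_singleton,
      List.range_succ (n := m)] at ih ⊢
    omega

theorem absorbPath_tight {C : Finset V → Prop} {k : ℕ} {z w o : ℕ → List V} {m : ℕ}
    (hz : ∀ i ≤ m, (z i).length = 2 * (k - 1))
    (ho : ∀ i ≤ m, Tight C k ((z i).take (k - 1) ++ o i ++ (z i).drop (k - 1)))
    (hw : ∀ i < m, Tight C k ((z i).drop (k - 1) ++ w i ++ (z (i + 1)).take (k - 1))) :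
    Tight C k (absorbPath k z w o m) := by
  induction m with
  | zero => exact ho 0 le_rfl
  | succ m ih =>
    have h1 := ih (fun i hi => hz i (by omega)) (fun i hi => ho i (by omega))
      (fun i hi => hw i (by omega))
    obtain ⟨r, hr⟩ := absorbPath_suffix k z w o m
    have h2 := Tight.glue (x := r) (m := (z m).drop (k - 1))
      (y := w m ++ (z (m + 1)).take (k - 1)) (hr ▸ h1) (by simpa using hw m (by omega))
      (by have := hz m (by omega); simp; omega)
    rw [← hr, ← List.append_assoc] at h2
    have h3 := Tight.glue (x := absorbPath k z w o m ++ w m) (m := (z (m + 1)).take (k - 1))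
      (y := o (m + 1) ++ (z (m + 1)).drop (k - 1)) h2 (by simpa using ho (m + 1) le_rfl)
      (by have := hz (m + 1) (by omega); simp; omega)
    rw [absorbPath]
    simpa using h3

/-- Every window of `k` entries starting at a multiple of `e` is an edge. -/
def LoosePath (E : Finset (Finset V)) (k e : ℕ) (l : List V) : Prop :=
  ∀ p w s, l = p ++ w ++ s → w.length = k → e ∣ p.length → w.toFinset ∈ E

theorem LoosePath.glue {E : Finset (Finset V)} {k e : ℕ} {x m y : List V}
    (h1 : LoosePath E k e (x ++ m)) (h2 : LoosePath E k e (m ++ y)) (hm : k ≤ m.length + 1)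
    (hx : e ∣ x.length) : LoosePath E k e (x ++ m ++ y) := by
  intro p w s h hw hp
  rcases List.split_window h (by omega) with ⟨s', h'⟩ | ⟨p', h', hl⟩
  · exact h1 p w s' h' hw hp
  · exact h2 p' w s h' hw ((Nat.dvd_add_right hx).1 (hl ▸ hp))

/-- The faces of the complex generated by `E`. -/
def faceOf (E : Finset (Finset V)) (S : Finset V) : Prop := ∃ e ∈ E, S ⊆ e

omit [DecidableEq V] in
theorem downClosed_faceOf (E : Finset (Finset V)) : DownClosed (faceOf E) :=
  fun _ _ hST ⟨e, he, hTe⟩ => ⟨e, he, hST.trans hTe⟩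

theorem Tight.mem_of_infix {E : Finset (Finset V)} {k : ℕ} (hE : ∀ e ∈ E, e.card = k)
    {l w : List V} (h : Tight (faceOf E) k l) (hw : w <:+: l) (hk : w.length = k) :
    w.toFinset ∈ E := by
  obtain ⟨h1, e, he, hs⟩ := h w hw hk.le
  rwa [Finset.eq_of_subset_of_card_le hs
    (by rw [hE e he, List.toFinset_card_of_nodup h1, hk])]

theorem LoosePath.glue_tight {E : Finset (Finset V)} {k e : ℕ} (hE : ∀ e ∈ E, e.card = k)
    {x m y : List V} (h1 : LoosePath E k e (x ++ m)) (h2 : Tight (faceOf E) k (m ++ y))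
    (hm : k ≤ m.length + 1) : LoosePath E k e (x ++ m ++ y) := by
  intro p w s h hw hp
  rcases List.split_window h (by omega) with ⟨s', h'⟩ | ⟨p', h', hl⟩
  · exact h1 p w s' h' hw hp
  · exact h2.mem_of_infix hE ⟨p', s, h'.symm⟩ hw

/-- Chain loose paths `P i` by tight connectors `D i`, then a tight path `A`, into a cycle. -/
theorem loosePath_chain {E : Finset (Finset V)} {k e : ℕ} (hE : ∀ e ∈ E, e.card = k)
    {P D st en : ℕ → List V} {A : List V} (N : ℕ)
    (hst : ∀ i ≤ N, (st i).length + 1 = k) (hen : ∀ i ≤ N, (en i).length + 1 = k)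
    (hPs : ∀ i < N, ∃ r, P i = st i ++ r) (hPe : ∀ i < N, ∃ r, P i = r ++ en i)
    (hAs : ∃ r, A = st N ++ r) (hAe : ∃ r, A = r ++ en N)
    (hP : ∀ i < N, LoosePath E k e (P i)) (hA : Tight (faceOf E) k A)
    (hdvd : ∀ i < N, e ∣ (P i).length + (D i).length)
    (hD : ∀ i < N, Tight (faceOf E) k (en i ++ D i ++ st (i + 1)))
    (hDN : Tight (faceOf E) k (en N ++ D N ++ st 0)) :
    LoosePath E k e ((List.range N).flatMap (fun i => P i ++ D i) ++ A ++ D N ++ st 0) := by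
  have hpre : ∀ i ≤ N, e ∣ ((List.range i).flatMap (fun i => P i ++ D i)).length := by
    intro i hi
    induction i with
    | zero => simp
    | succ i ih =>
      rw [List.range_succ, List.flatMap_append, List.length_append, List.flatMap_singleton,
        List.length_append]
      exact Nat.dvd_add (ih (by omega)) (hdvd i (by omega))
  have hmain : ∀ i ≤ N,
      LoosePath E k e ((List.range i).flatMap (fun i => P i ++ D i) ++ st i) := by
    intro i hi
    induction i with
    | zero =>
      intro p w s h hw hp
      have h1 := congrArg List.length h
      have := hst 0 (by omega)
      simp at h1; omega
    | succ i ih =>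
      obtain ⟨r, hr⟩ := hPs i (by omega)
      obtain ⟨r', hr'⟩ := hPe i (by omega)
      have h1 := (ih (by omega)).glue (y := r) (hr ▸ hP i (by omega))
        (by have := hst i (by omega); omega) (hpre i (by omega))
      rw [List.append_assoc, ← hr, hr', ← List.append_assoc] at h1
      have h2 := h1.glue_tight hE (y := D i ++ st (i + 1)) (by simpa using hD i (by omega))
        (by have := hen i (by omega); omega)
      rw [List.range_succ, List.flatMap_append, List.flatMap_singleton]
      simpa [hr'] using h2
  obtain ⟨r, hr⟩ := hAs
  obtain ⟨r', hr'⟩ := hAe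
  have h1 := (hmain N le_rfl).glue_tight hE (y := r) (hr ▸ hA)
    (by have := hst N le_rfl; omega)
  rw [List.append_assoc, ← hr, hr', ← List.append_assoc] at h1
  have h2 := h1.glue_tight hE (y := D N ++ st 0) (by simpa using hDN)
    (by have := hen N le_rfl; omega)
  simpa [hr'] using h2

theorem hamCycle_of_list {n k l : ℕ} {E : Finset (Finset (Fin n))} (hn : 0 < n)
    (hk : 0 < k) (hkn : k ≤ n) (hdvd : (k - l) ∣ n) (c : List (Fin n)) (hc : c.Nodup)
    (hcl : c.length = n) (h : LoosePath E k (k - l) (c ++ c.take (k - 1))) : HamCycle k l E := by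
  have : NeZero n := ⟨hn.ne'⟩
  have hlt : ∀ z : ZMod n, z.val < c.length := fun z => by rw [hcl]; exact ZMod.val_lt z
  refine ⟨fun z => c.get ⟨z.val, hlt z⟩, ?_, ?_⟩
  · rw [Fintype.bijective_iff_injective_and_card]
    refine ⟨fun a b hab => ?_, by simp [ZMod.card]⟩
    have := List.nodup_iff_injective_get.1 hc hab
    exact ZMod.val_injective n (by simpa using this)
  · intro i
    set p := i * (k - l) % n with hp
    have hpn : p < n := Nat.mod_lt _ hn
    have hdp : (k - l) ∣ p := (Nat.dvd_mod_iff hdvd).2 (Nat.dvd_mul_left _ _)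
    set L := c ++ c.take (k - 1) with hL
    have hLl : L.length = n + (k - 1) := by simp [hL, hcl]; omega
    have hw := h (L.take p) ((L.drop p).take k) ((L.drop p).drop k) (by simp)
      (by simp [hLl]; omega) (by simpa [hLl, Nat.min_eq_left (by omega : p ≤ n + (k - 1))] using hdp)
    convert hw using 1
    have hval : ∀ j < k, ∃ h1 h2, c.get ⟨((i * (k - l) + j : ℕ) : ZMod n).val, h1⟩ =
        ((L.drop p).take k)[j]'h2 := by
      intro j hj
      refine ⟨hlt _, by simp [hLl]; omega, ?_⟩
      simp only [List.get_eq_getElem, List.getElem_take, List.getElem_drop, hL, ZMod.val_natCast]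
      have hmod : (i * (k - l) + j) % n = (p + j) % n := by rw [hp, Nat.mod_add_mod]
      rw [List.getElem_append]
      split_ifs with hlt'
      · congr 1
        rw [hmod, Nat.mod_eq_of_lt (by omega)]
      · rw [List.getElem_take]
        congr 1
        rw [hmod, hcl, Nat.mod_eq_sub_mod (by omega), Nat.mod_eq_of_lt (by omega)]
    ext v
    simp only [Finset.mem_image, Finset.mem_univ, true_and, List.mem_toFinset,
      List.mem_iff_getElem]
    constructor
    · rintro ⟨j, rfl⟩
      obtain ⟨h1, h2, h3⟩ := hval j j.2
      exact ⟨j, h2, h3.symm⟩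
    · rintro ⟨j, h2, rfl⟩
      have hj : j < k := by simp at h2; omega
      obtain ⟨h1, h2, h3⟩ := hval j hj
      exact ⟨⟨j, hj⟩, h3⟩

end Assembly

section Weights

variable {V ι : Type} [DecidableEq V] [Fintype ι]

/-- The density of the test set `T` in `A`. -/
noncomputable def relDens (T A : Finset V) : ℝ := ((T ∩ A).card : ℝ) / A.card

/-- The density of no test set drops by more than `γ` when passing from `A` to `B`. -/
def Inherits (τ : ι → Finset V) (γ : ℝ) (A B : Finset V) : Prop :=
  ∀ T, relDens (τ T) A - relDens (τ T) B ≤ γ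

/-- The exponential potential measuring how badly `B` represents the test sets. -/
noncomputable def potential (τ : ι → Finset V) (lam : ℝ) (A B : Finset V) : ℝ :=
  ∑ T, Real.exp (lam * (relDens (τ T) A - relDens (τ T) B))

theorem relDens_mem_Icc (T A : Finset V) : 0 ≤ relDens T A ∧ relDens T A ≤ 1 := by
  refine ⟨by unfold relDens; positivity, div_le_one_of_le₀ ?_ (by positivity)⟩
  exact_mod_cast Finset.card_le_card Finset.inter_subset_right

theorem inherits_of_potential {τ : ι → Finset V} {γ lam : ℝ} {A B : Finset V} (hl : 0 < lam)
    (h : potential τ lam A B ≤ Real.exp (lam * γ)) : Inherits τ γ A B := by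
  intro T
  have h1 : Real.exp (lam * (relDens (τ T) A - relDens (τ T) B)) ≤ potential τ lam A B :=
    Finset.single_le_sum (f := fun T => Real.exp (lam * (relDens (τ T) A - relDens (τ T) B)))
      (fun _ _ => (Real.exp_pos _).le) (Finset.mem_univ T)
  exact le_of_mul_le_mul_left (Real.exp_le_exp.1 (h1.trans h)) hl

theorem relDens_sdiff {T B : Finset V} {P : Finset V} (hP : P ⊆ B) (hB : P.card < B.card) :
    relDens T B - relDens T (B \ P) =
      ((T ∩ P).card - P.card * relDens T B) / ((B.card : ℝ) - P.card) := by
  have h1 : (B \ P).card + P.card = B.card := Finset.card_sdiff_add_card_eq_card hP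
  have h2 : (T ∩ (B \ P)).card + (T ∩ P).card = (T ∩ B).card := by
    rw [← Finset.inter_sdiff_assoc,
      ← Finset.card_sdiff_add_card_eq_card (Finset.inter_subset_inter_left hP (s := T))]
    congr 2
    ext v; simp; tauto
  have h1' : ((B \ P).card : ℝ) = B.card - P.card := by
    rw [← h1]; push_cast; ring
  have h2' : ((T ∩ (B \ P)).card : ℝ) = (T ∩ B).card - (T ∩ P).card := by
    rw [← h2]; push_cast; ring
  have h3 : (0 : ℝ) < (B.card : ℝ) - P.card := by
    have : (P.card : ℝ) < B.card := by exact_mod_cast hB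
    linarith
  have h4 : (0 : ℝ) < B.card := by
    have : (0 : ℝ) ≤ P.card := by positivity
    linarith
  unfold relDens
  rw [h1', h2']
  field_simp
  ring

theorem potential_step {τ : ι → Finset V} {lam η m : ℝ} {A B P : Finset V} (hl : 0 < lam)
    (hη : 0 ≤ η) (hm : 0 < m) (hB : m ≤ B.card) (hP : P ⊆ B) (hPm : 2 * P.card ≤ m)
    (hlm : 2 * lam * P.card ≤ m)
    (hy : ∑ v ∈ P, (∑ T, if v ∈ τ T then Real.exp (lam * (relDens (τ T) A - relDens (τ T) B)) else 0) ≤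
      P.card * ((∑ v ∈ B, ∑ T, if v ∈ τ T then
        Real.exp (lam * (relDens (τ T) A - relDens (τ T) B)) else 0) / B.card +
        η * potential τ lam A B)) :
    potential τ lam A (B \ P) ≤ potential τ lam A B *
      (1 + (2 * lam * P.card / m * η + (2 * lam * P.card / m) ^ 2)) := by
  have hp0 : (0 : ℝ) ≤ P.card := by positivity
  have hBP : (P.card : ℝ) < B.card := by linarith
  have hBP' : P.card < B.card := by exact_mod_cast hBP
  have hgap : m / 2 ≤ (B.card : ℝ) - P.card := by linarith
  have hgap0 : 0 < (B.card : ℝ) - P.card := by linarith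
  have hB0 : (0 : ℝ) < B.card := by linarith
  set e : ι → ℝ := fun T => Real.exp (lam * (relDens (τ T) A - relDens (τ T) B)) with he
  have he0 : ∀ T, 0 < e T := fun T => Real.exp_pos _
  set Φ := potential τ lam A B with hΦ
  have hΦe : Φ = ∑ T, e T := rfl
  have hΦ0 : 0 ≤ Φ := hΦe ▸ Finset.sum_nonneg fun T _ => (he0 T).le
  set x : ι → ℝ := fun T => lam * (((τ T ∩ P).card - P.card * relDens (τ T) B) /
    ((B.card : ℝ) - P.card)) with hx
  have hxbd : ∀ T, |x T| ≤ 2 * lam * P.card / m := by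
    intro T
    have h1 := relDens_mem_Icc (τ T) B
    have h2 : ((τ T ∩ P).card : ℝ) ≤ P.card := by
      exact_mod_cast Finset.card_le_card Finset.inter_subset_right
    have h3 : |((τ T ∩ P).card : ℝ) - P.card * relDens (τ T) B| ≤ P.card := by
      rw [abs_le]
      constructor
      · have : (0 : ℝ) ≤ (τ T ∩ P).card := by positivity
        nlinarith
      · nlinarith
    rw [hx]
    simp only
    rw [abs_mul, abs_div, abs_of_pos hl, abs_of_pos hgap0]
    calc lam * (|((τ T ∩ P).card : ℝ) - P.card * relDens (τ T) B| / ((B.card : ℝ) - P.card))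
        ≤ lam * (P.card / (m / 2)) := by gcongr
      _ = _ := by field_simp
  have hb1 : 2 * lam * P.card / m ≤ 1 := (div_le_one hm).2 hlm
  have hterm : ∀ T, Real.exp (lam * (relDens (τ T) A - relDens (τ T) (B \ P))) ≤
      e T + e T * x T + e T * (2 * lam * P.card / m) ^ 2 := by
    intro T
    have h1 : lam * (relDens (τ T) A - relDens (τ T) (B \ P)) =
        lam * (relDens (τ T) A - relDens (τ T) B) + x T := by
      rw [hx]; simp only; rw [← relDens_sdiff hP hBP']; ring
    rw [h1, Real.exp_add]
    have h2 := (abs_le.1 (Real.abs_exp_sub_one_sub_id_le ((hxbd T).trans hb1))).2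
    have h3 : x T ^ 2 ≤ (2 * lam * P.card / m) ^ 2 := by
      rw [← sq_abs]; gcongr; exact hxbd T
    have h4 : Real.exp (x T) ≤ 1 + x T + (2 * lam * P.card / m) ^ 2 := by linarith
    calc e T * Real.exp (x T) ≤ e T * (1 + x T + (2 * lam * P.card / m) ^ 2) :=
          mul_le_mul_of_nonneg_left h4 (he0 T).le
      _ = _ := by ring
  have hswap : ∀ S : Finset V, ∑ v ∈ S, (∑ T, if v ∈ τ T then e T else 0) =
      ∑ T, e T * (τ T ∩ S).card := by
    intro S
    rw [Finset.sum_comm]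
    refine Finset.sum_congr rfl fun T _ => ?_
    rw [← Finset.sum_filter, Finset.sum_const, nsmul_eq_mul, mul_comm, Finset.inter_comm,
      Finset.filter_mem_eq_inter]
  rw [hswap, hswap] at hy
  have hlin : ∑ T, e T * x T ≤ Φ * (2 * lam * P.card / m * η) := by
    have h1 : ∑ T, e T * x T = lam / ((B.card : ℝ) - P.card) *
        (∑ T, e T * (τ T ∩ P).card - P.card * ((∑ T, e T * (τ T ∩ B).card) / B.card)) := by
      rw [Finset.sum_div, Finset.mul_sum, ← Finset.sum_sub_distrib, Finset.mul_sum]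
      refine Finset.sum_congr rfl fun T _ => ?_
      rw [hx]; simp only [relDens]; field_simp
    rw [h1]
    have h2 : ∑ T, e T * (τ T ∩ P).card - P.card * ((∑ T, e T * (τ T ∩ B).card) / B.card) ≤
        P.card * (η * Φ) := by linarith
    calc _ ≤ lam / ((B.card : ℝ) - P.card) * (P.card * (η * Φ)) := by gcongr
      _ ≤ lam / (m / 2) * (P.card * (η * Φ)) := by gcongr
      _ = _ := by field_simp
  calc potential τ lam A (B \ P) ≤
        ∑ T, (e T + e T * x T + e T * (2 * lam * P.card / m) ^ 2) :=
        Finset.sum_le_sum fun T _ => hterm T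
    _ = Φ + ∑ T, e T * x T + Φ * (2 * lam * P.card / m) ^ 2 := by
        rw [Finset.sum_add_distrib, Finset.sum_add_distrib, ← Finset.sum_mul, ← hΦe]
    _ ≤ _ := by linarith

/-- If every well-behaved set contains a good path which is light for any given weighting, then
such paths can be removed one by one until few vertices are left, keeping all test densities. -/
theorem exists_tiling (good : List V → Prop) (τ : ι → Finset V) {γ lam η m : ℝ} {L : ℕ}
    (A : Finset V) (hl : 0 < lam) (hη : 0 ≤ η) (hL : 0 < L) (hm : 2 * L ≤ m)
    (hlm : 2 * lam * L ≤ m)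
    (hpot : Fintype.card ι * Real.exp ((2 * lam * L / m * η + (2 * lam * L / m) ^ 2) *
      (A.card / L)) ≤ Real.exp (lam * γ))
    (hstep : ∀ B ⊆ A, m ≤ B.card → Inherits τ γ A B → ∀ y : V → ℝ, (∀ v, 0 ≤ y v ∧ y v ≤ 1) →
      ∃ P : List V, good P ∧ P.Nodup ∧ P.length = L ∧ (∀ v ∈ P, v ∈ B) ∧
        ∑ v ∈ P.toFinset, y v ≤ L * ((∑ v ∈ B, y v) / B.card + η))
    (hA : m ≤ A.card) :
    ∃ Ps : List (List V), (∀ P ∈ Ps, good P ∧ P.length = L) ∧ Ps.flatten.Nodup ∧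
      (∀ v ∈ Ps.flatten, v ∈ A) ∧ ((A \ Ps.flatten.toFinset).card : ℝ) < m ∧
      m - L ≤ (A \ Ps.flatten.toFinset).card ∧ Inherits τ γ A (A \ Ps.flatten.toFinset) := by
  have hLR : (0 : ℝ) < L := by exact_mod_cast hL
  have hm0 : 0 < m := by linarith
  set a := 2 * lam * L / m * η + (2 * lam * L / m) ^ 2 with ha
  have ha0 : 0 ≤ a := by positivity
  have hinh : ∀ (B : Finset V) (i : ℕ), (B.card : ℝ) + i * L = A.card →
      potential τ lam A B ≤ Fintype.card ι * (1 + a) ^ i → Inherits τ γ A B := by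
    intro B i hBi hB
    refine inherits_of_potential hl (hB.trans (le_trans ?_ hpot))
    gcongr
    have h1 : (1 + a) ^ i ≤ Real.exp a ^ i := by
      gcongr
      linarith [Real.add_one_le_exp a]
    refine h1.trans ?_
    rw [← Real.exp_nat_mul]
    refine Real.exp_le_exp.2 ?_
    rw [mul_comm]
    gcongr
    rw [le_div_iff₀ hLR]
    have : (0 : ℝ) ≤ B.card := by positivity
    linarith
  have main : ∀ (N : ℕ) (B : Finset V) (i : ℕ), B.card = N → B ⊆ A →
      (B.card : ℝ) + i * L = A.card → m - L ≤ B.card →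
      potential τ lam A B ≤ Fintype.card ι * (1 + a) ^ i →
      ∃ Ps : List (List V), (∀ P ∈ Ps, good P ∧ P.length = L) ∧ Ps.flatten.Nodup ∧
      (∀ v ∈ Ps.flatten, v ∈ B) ∧ ((B \ Ps.flatten.toFinset).card : ℝ) < m ∧
      m - L ≤ (B \ Ps.flatten.toFinset).card ∧ Inherits τ γ A (B \ Ps.flatten.toFinset) := by
    intro N
    induction N using Nat.strong_induction_on with
    | _ N ih =>
      intro B i hBN hBA hBi hBm hBp
      have hI := hinh B i hBi hBp
      by_cases hBm' : (B.card : ℝ) < m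
      · exact ⟨[], by simp, by simp, by simp, by simpa using hBm', by simpa using hBm,
          by simpa using hI⟩
      · push Not at hBm'
        set e : ι → ℝ := fun T => Real.exp (lam * (relDens (τ T) A - relDens (τ T) B)) with he
        set Φ := potential τ lam A B with hΦ
        have hΦe : Φ = ∑ T, e T := rfl
        have hΦ0 : 0 ≤ Φ := hΦe ▸ Finset.sum_nonneg fun T _ => (Real.exp_pos _).le
        have hle : ∀ v, (∑ T, if v ∈ τ T then e T else 0) ≤ Φ := fun v => by
          rw [hΦe]
          refine Finset.sum_le_sum fun T _ => ?_
          split_ifs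
          · exact le_rfl
          · exact (Real.exp_pos _).le
        have hge : ∀ v, 0 ≤ (∑ T, if v ∈ τ T then e T else 0) := fun v =>
          Finset.sum_nonneg fun T _ => by
            split_ifs
            · exact (Real.exp_pos _).le
            · exact le_rfl
        obtain ⟨P, hPg, hPn, hPl, hPB, hPy⟩ := hstep B hBA hBm' hI
          (fun v => (∑ T, if v ∈ τ T then e T else 0) / Φ)
          (fun v => ⟨div_nonneg (hge v) hΦ0, div_le_one_of_le₀ (hle v) hΦ0⟩)
        have hPc : P.toFinset.card = L := by rw [List.toFinset_card_of_nodup hPn, hPl]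
        have hPsub : P.toFinset ⊆ B := fun v hv => hPB v (List.mem_toFinset.1 hv)
        have hcard : (B \ P.toFinset).card + L = B.card := by
          rw [← hPc]; exact Finset.card_sdiff_add_card_eq_card hPsub
        have hcardR : ((B \ P.toFinset).card : ℝ) + L = B.card := by exact_mod_cast hcard
        have hy : ∑ v ∈ P.toFinset, (∑ T, if v ∈ τ T then e T else 0) ≤
            P.toFinset.card * ((∑ v ∈ B, ∑ T, if v ∈ τ T then e T else 0) / B.card +
              η * Φ) := by
          rcases hΦ0.eq_or_lt with h0 | h0
          · have hz : ∀ v, (∑ T, if v ∈ τ T then e T else 0) = 0 := fun v =>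
              le_antisymm ((hle v).trans h0.symm.le) (hge v)
            simp [hz, ← h0]
          · rw [← Finset.sum_div, ← Finset.sum_div] at hPy
            rw [hPc]
            have := mul_le_mul_of_nonneg_right hPy h0.le
            rw [div_mul_cancel₀ _ h0.ne'] at this
            refine this.trans (le_of_eq ?_)
            field_simp
        have hst := potential_step (A := A) hl hη hm0 hBm' hPsub (by rw [hPc]; exact hm)
          (by rw [hPc]; exact hlm) hy
        rw [hPc] at hst
        obtain ⟨Ps, h1, h2, h3, h4, h5, h6⟩ := ih (B \ P.toFinset).card (by omega)
          (B \ P.toFinset) (i + 1) rfl (Finset.sdiff_subset.trans hBA)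
          (by push_cast; linarith) (by linarith) (hst.trans (by
            rw [pow_succ (1 + a), ← mul_assoc]
            gcongr))
        have hset : B \ (P :: Ps).flatten.toFinset =
            (B \ P.toFinset) \ Ps.flatten.toFinset := by
          ext v; simp; tauto
        refine ⟨P :: Ps, ?_, ?_, ?_, ?_, ?_, ?_⟩
        · intro Q hQ
          rcases List.mem_cons.1 hQ with rfl | hQ
          · exact ⟨hPg, hPl⟩
          · exact h1 Q hQ
        · rw [List.flatten_cons, List.nodup_append]
          refine ⟨hPn, h2, ?_⟩
          rintro v hv w hw rfl
          exact (Finset.mem_sdiff.1 (h3 v hw)).2 (List.mem_toFinset.2 hv)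
        · intro v hv
          rw [List.flatten_cons, List.mem_append] at hv
          rcases hv with hv | hv
          · exact hPB v hv
          · exact (Finset.mem_sdiff.1 (h3 v hv)).1
        · rw [hset]; exact h4
        · rw [hset]; exact h5
        · rw [hset]; exact h6
  have h := main A.card A 0 rfl Subset.rfl (by simp) (by linarith) (by simp [potential])
  exact h

end Weights

/-- A colouring of the positions of a loose path in which every edge is rainbow and two colours
have known frequencies. -/
theorem exists_colouring {k e t : ℕ} (he : 0 < e) (hek : e ≤ k) (ht : t = k / e * e)
    (ht3 : 3 ≤ t) :
    ∃ (col : ℕ → Fin k) (i₀ i₁ : Fin k), i₀ ≠ i₁ ∧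
      (∀ s, e ∣ s → Set.InjOn col (Set.Ico s (s + k))) ∧
      (∀ L : ℕ, (L : ℝ) / t - 1 ≤ ((Finset.range L).filter fun p => col p = i₁).card) ∧
      ∀ L : ℕ, (L : ℝ) / (2 * t) ≤ ((Finset.range L).filter fun p => col p = i₀).card := by
  obtain ⟨q, hq⟩ : ∃ q, q = k / e := ⟨_, rfl⟩
  obtain ⟨r, hr⟩ : ∃ r, r = k % e := ⟨_, rfl⟩
  have hre : r < e := hr ▸ Nat.mod_lt _ he
  have hkq : e * q + r = k := by rw [hq, hr]; exact Nat.div_add_mod k e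
  have hq1 : 1 ≤ q := by rw [hq]; exact (Nat.one_le_div_iff he).2 hek
  have htq : t = e * q := by rw [ht, hq, mul_comm]
  set m : ℕ → ℕ := fun ρ => if ρ < r then q + 1 else q with hm
  have hm0 : ∀ ρ, 0 < m ρ := fun ρ => by simp only [hm]; split_ifs <;> omega
  have hbd : ∀ p, p % e + e * (p / e % m (p % e)) < k := by
    intro p
    have h1 := Nat.mod_lt (p / e) (hm0 (p % e))
    have h2 := Nat.mod_lt p he
    by_cases h : p % e < r
    · have h3 : m (p % e) = q + 1 := by simp [hm, h]
      rw [h3] at h1 ⊢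
      have : e * (p / e % (q + 1)) ≤ e * q := Nat.mul_le_mul_left _ (by omega)
      omega
    · have h3 : m (p % e) = q := by simp [hm, h]
      rw [h3] at h1 ⊢
      have : e * (p / e % q) ≤ e * (q - 1) := Nat.mul_le_mul_left _ (by omega)
      rw [Nat.mul_sub, mul_one] at this
      have : e ≤ e * q := Nat.le_mul_of_pos_right _ hq1
      omega
  have hcount : ∀ (a d L : ℕ) (p : ℕ → Prop) [DecidablePred p], 0 < d → 
      (∀ j, p (a + d * j)) → (L : ℝ) - a ≤ d * ((Finset.range L).filter p).card := by
    intro a d L p _ hd hp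
    have h1 : (Finset.range ((L - a + d - 1) / d)).image (fun j => a + d * j) ⊆
        (Finset.range L).filter p := by
      intro x hx
      obtain ⟨j, hj, rfl⟩ := Finset.mem_image.1 hx
      rw [Finset.mem_range, Nat.lt_div_iff_mul_lt hd] at hj
      rw [Finset.mem_filter, Finset.mem_range]
      refine ⟨?_, hp j⟩
      rw [mul_comm] at hj
      omega
    have h2 := Finset.card_le_card h1
    rw [Finset.card_image_of_injective _ (fun x y hxy => by
      have hxy : a + d * x = a + d * y := hxy
      exact Nat.eq_of_mul_eq_mul_left hd (by omega)), Finset.card_range] at h2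
    have h3 : L ≤ a + d * ((Finset.range L).filter p).card := by
      have h4 : L - a ≤ d * ((L - a + d - 1) / d) := by
        have := Nat.lt_mul_div_succ (L - a + d - 1) hd
        rw [mul_add] at this
        omega
      have := Nat.mul_le_mul_left d h2
      omega
    have : (L : ℝ) ≤ a + d * ((Finset.range L).filter p).card := by exact_mod_cast h3
    linarith
  have htR : (0 : ℝ) < t := by exact_mod_cast (by omega : 0 < t)
  refine ⟨fun p => ⟨_, hbd p⟩, ⟨0, by omega⟩, ⟨t - 1, by omega⟩, ?_, ?_, ?_, ?_⟩
  · simp; omega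
  · rintro s ⟨a, rfl⟩ x hx y hy hxy
    simp only [Fin.mk.injEq] at hxy
    have hx' := Nat.div_add_mod x e
    have hy' := Nat.div_add_mod y e
    have hxe := Nat.mod_lt x he
    have hye := Nat.mod_lt y he
    have hρ : x % e = y % e := by
      have := congrArg (· % e) hxy
      simpa [Nat.add_mul_mod_self_left] using this
    rw [hρ] at hxy hx'
    have hi : x / e % m (y % e) = y / e % m (y % e) :=
      Nat.eq_of_mul_eq_mul_left he (by omega)
    have hlow : ∀ z, z ∈ Set.Ico (e * a) (e * a + k) → a ≤ z / e := fun z hz =>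
      (Nat.le_div_iff_mul_le he).2 (by rw [mul_comm]; exact hz.1)
    have hup : ∀ z, z ∈ Set.Ico (e * a) (e * a + k) → z % e = y % e →
        z / e < a + m (y % e) := by
      intro z hz hzy
      have h1 := Nat.div_add_mod z e
      by_contra hcon
      push Not at hcon
      have h2 := Nat.mul_le_mul_left e hcon
      rw [mul_add] at h2
      have h3 := hz.2
      by_cases h : y % e < r
      · have h4 : m (y % e) = q + 1 := by simp [hm, h]
        rw [h4, mul_add] at h2
        omega
      · have h4 : m (y % e) = q := by simp [hm, h]
        rw [h4] at h2
        omega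
    have h1 := hlow x hx
    have h2 := hup x hx hρ
    have h3 := hlow y hy
    have h4 := hup y hy rfl
    have : x / e = y / e := by
      have h5 : (x / e) ≡ (y / e) [MOD m (y % e)] := hi
      rcases le_total (x / e) (y / e) with h | h
      · exact h5.eq_of_abs_lt (by rw [abs_lt]; omega)
      · exact h5.eq_of_abs_lt (by rw [abs_lt]; omega)
    rw [this] at hx'
    omega
  · intro L
    have h := hcount (t - 1) t L (fun p => (⟨_, hbd p⟩ : Fin k) = ⟨t - 1, by omega⟩) (by omega) (by
      intro j
      simp only [Fin.mk.injEq]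
      have h1 : t - 1 + t * j = (e - 1) + e * (q - 1 + q * j) := by
        rw [htq, mul_add, Nat.mul_sub, ← mul_assoc]
        have : e ≤ e * q := Nat.le_mul_of_pos_right _ hq1
        omega
      have h2 : (t - 1 + t * j) % e = e - 1 := by
        rw [h1, Nat.add_mul_mod_self_left, Nat.mod_eq_of_lt (by omega)]
      have h3 : (t - 1 + t * j) / e = q - 1 + q * j := by
        rw [h1, Nat.add_mul_div_left _ _ he, Nat.div_eq_of_lt (by omega), zero_add]
      have h4 : m (e - 1) = q := by simp only [hm]; rw [if_neg (by omega)]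
      rw [h2, h3, h4, Nat.add_mul_mod_self_left, Nat.mod_eq_of_lt (by omega), htq, Nat.mul_sub]
      have : e ≤ e * q := Nat.le_mul_of_pos_right _ hq1
      omega)
    rw [sub_le_iff_le_add, div_le_iff₀ htR]
    have h1 : ((t - 1 : ℕ) : ℝ) = t - 1 := by rw [Nat.cast_sub (by omega)]; simp
    rw [h1] at h
    nlinarith
  · intro L
    have h := hcount 0 (e * m 0) L (fun p => (⟨_, hbd p⟩ : Fin k) = ⟨0, by omega⟩)
      (Nat.mul_pos he (hm0 0)) (by
      intro j
      simp only [Fin.mk.injEq, zero_add]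
      have h2 : (e * m 0 * j) % e = 0 := by rw [mul_assoc]; exact Nat.mul_mod_right _ _
      have h3 : (e * m 0 * j) / e = m 0 * j := by
        rw [mul_assoc]; exact Nat.mul_div_cancel_left _ he
      rw [h2, h3]
      simp)
    have h1 : e * m 0 ≤ 2 * t := by
      rw [htq]
      have h2 : m 0 ≤ q + 1 := by simp only [hm]; split_ifs <;> omega
      have := Nat.mul_le_mul_left e h2
      have h3 := Nat.mul_le_mul_left e hq1
      rw [mul_add] at this
      omega
    have h1' : ((e * m 0 : ℕ) : ℝ) ≤ 2 * t := by exact_mod_cast h1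
    rw [div_le_iff₀ (by positivity)]
    have h4 : (0 : ℝ) ≤ ((Finset.range L).filter fun p => (⟨_, hbd p⟩ : Fin k) = ⟨0, by omega⟩).card := by
      positivity
    simp only [Nat.cast_zero, sub_zero] at h
    rw [mul_comm _ (2 * (t : ℝ))]
    exact h.trans (mul_le_mul_of_nonneg_right h1' h4)

section PathBuilding

variable {V : Type} [DecidableEq V]

/-- A dense family of functions contains a nonempty subfamily in which every coordinate of every
member can be changed in many ways. -/
theorem exists_pruned {k : ℕ} (hk : 0 < k) {B : Finset V} {c : ℝ} (hc : 0 ≤ c)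
    (F : Finset (Fin k → V)) (hF : ∀ f ∈ F, ∀ i, f i ∈ B)
    (hcard : k * c * (B.card : ℝ) ^ k < F.card) :
    ∃ F' ⊆ F, F'.Nonempty ∧ ∀ f ∈ F', ∀ i, c * B.card ≤
      ((B.filter fun v => Function.update f i v ∈ F').card : ℝ) := by
  set sh : (i : Fin k) → Finset (Fin k → V) → Finset ({j : Fin k // j ≠ i} → V) := fun i G =>
    G.image fun f j => f j with hsh
  set val : Finset (Fin k → V) → ℝ := fun G =>
    G.card - c * B.card * ∑ i, ((sh i G).card : ℝ) with hval
  have hshF : ∀ i, ((sh i F).card : ℝ) ≤ (B.card : ℝ) ^ (k - 1) := by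
    intro i
    have h1 : sh i F ⊆ Fintype.piFinset fun _ => B := by
      intro g hg
      obtain ⟨f, hf, rfl⟩ := Finset.mem_image.1 hg
      exact Fintype.mem_piFinset.2 fun j => hF f hf j
    have h2 := Finset.card_le_card h1
    rw [Fintype.card_piFinset, Finset.prod_const, Finset.card_univ] at h2
    have h3 : Fintype.card {j : Fin k // j ≠ i} = k - 1 := by simp [Fintype.card_subtype_compl]
    rw [h3] at h2
    exact_mod_cast h2
  have hvF : 0 < val F := by
    have h1 : ∑ i, ((sh i F).card : ℝ) ≤ k * (B.card : ℝ) ^ (k - 1) := by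
      refine (Finset.sum_le_sum fun i _ => hshF i).trans (by simp)
    have h2 : c * B.card * ∑ i, ((sh i F).card : ℝ) ≤ k * c * (B.card : ℝ) ^ k := by
      calc _ ≤ c * B.card * (k * (B.card : ℝ) ^ (k - 1)) := by gcongr
        _ = k * c * (B.card : ℝ) ^ (k - 1 + 1) := by ring
        _ = _ := by rw [Nat.sub_add_cancel hk]
    simp only [hval]
    linarith
  obtain ⟨G, hG, hmax⟩ := Finset.exists_max_image F.powerset val ⟨∅, by simp⟩
  rw [Finset.mem_powerset] at hG
  refine ⟨G, hG, ?_, ?_⟩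
  · rw [Finset.nonempty_iff_ne_empty]
    rintro rfl
    have := hmax F (by simp)
    have h0 : val ∅ = 0 := by simp [hval, hsh]
    linarith
  · intro f hf i
    set K := G.filter fun g => ∀ j, j ≠ i → g j = f j with hK
    have hKG : K ⊆ G := Finset.filter_subset _ _
    have h1 := hmax (G \ K) (Finset.mem_powerset.2 (Finset.sdiff_subset.trans hG))
    have h2 : ((G \ K).card : ℝ) = G.card - K.card := by
      rw [Finset.card_sdiff_of_subset hKG, Nat.cast_sub (Finset.card_le_card hKG)]
    have h3 : ∑ j, ((sh j (G \ K)).card : ℝ) ≤ ∑ j, ((sh j G).card : ℝ) - 1 := by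
      have h4 : ∀ j, ((sh j (G \ K)).card : ℝ) ≤ (sh j G).card - if j = i then 1 else 0 := by
        intro j
        split_ifs with hj
        · subst hj
          have h5 : sh j (G \ K) ⊆ (sh j G).erase fun m => f m := by
            intro g hg
            obtain ⟨g, hg', rfl⟩ := Finset.mem_image.1 hg
            replace hg := Finset.mem_sdiff.1 hg'
            refine Finset.mem_erase.2 ⟨fun h => hg.2 ?_, Finset.mem_image_of_mem _ hg.1⟩
            exact Finset.mem_filter.2 ⟨hg.1, fun m hm => congrFun h ⟨m, hm⟩⟩
          have h6 := Finset.card_le_card h5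
          rw [Finset.card_erase_of_mem (Finset.mem_image.2 ⟨f, hf, rfl⟩)] at h6
          have h7 : 0 < (sh j G).card := Finset.card_pos.2 ⟨_, Finset.mem_image_of_mem _ hf⟩
          have : (sh j (G \ K)).card + 1 ≤ (sh j G).card := Nat.le_sub_one_iff_lt h7 |>.1 h6
          rw [le_sub_iff_add_le]
          exact_mod_cast this
        · rw [sub_zero]
          exact_mod_cast Finset.card_le_card (Finset.image_subset_image Finset.sdiff_subset)
      refine (Finset.sum_le_sum fun j _ => h4 j).trans (by simp [Finset.sum_sub_distrib])
    have h4 : c * B.card ≤ K.card := by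
      simp only [hval, h2] at h1
      have : c * B.card * ∑ j, ((sh j (G \ K)).card : ℝ) ≤
          c * B.card * (∑ j, ((sh j G).card : ℝ) - 1) := by gcongr
      linarith
    refine h4.trans ?_
    have hup : ∀ g ∈ K, Function.update f i (g i) = g := by
      intro g hg
      ext j
      by_cases hj : j = i
      · subst hj; simp
      · simp [hj, (Finset.mem_filter.1 hg).2 j hj]
    have h5 : K.card ≤ (B.filter fun v => Function.update f i v ∈ G).card := by
      refine Finset.card_le_card_of_injOn (fun g => g i) ?_ ?_
      · intro g hg
        have hg : g ∈ K := hg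
        rw [Finset.mem_coe, Finset.mem_filter]
        exact ⟨hF g (hG (hKG hg)) i, by rw [hup g hg]; exact hKG hg⟩
      · intro g hg g' hg' h
        have h : g i = g' i := h
        rw [← hup g hg, ← hup g' hg', h]
    exact_mod_cast h5

/-- A dense family of edges whose vertices satisfy prescribed weight bounds yields a long loose
path obeying these bounds along a rainbow colouring. -/
theorem exists_path_of_edges {k e : ℕ} (hk : 0 < k) {B : Finset V} {c : ℝ} (hc : 0 ≤ c)
    {E : Finset (Finset V)} {y : V → ℝ} {lev : Fin k → ℝ} (F : Finset (Fin k → V))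
    (hF : ∀ f ∈ F, (∀ i, f i ∈ B ∧ y (f i) ≤ lev i) ∧ Finset.univ.image f ∈ E)
    (hcard : k * c * (B.card : ℝ) ^ k < F.card) {col : ℕ → Fin k}
    (hcol : ∀ s, e ∣ s → Set.InjOn col (Set.Ico s (s + k))) {L : ℕ} (hL : L < c * B.card) :
    ∃ P : List V, P.length = L ∧ P.Nodup ∧ (∀ v ∈ P, v ∈ B) ∧ LoosePath E k e P ∧
      ∑ v ∈ P.toFinset, y v ≤ ∑ p ∈ Finset.range L, lev (col p) := by
  obtain ⟨F', hFF, hne, hup⟩ := exists_pruned hk hc F (fun f hf i => ((hF f hf).1 i).1) hcard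
  have key : ∀ p ≤ L, ∃ (g : ℕ → V) (f : Fin k → V), f ∈ F' ∧
      (∀ j < p, g j ∈ B ∧ y (g j) ≤ lev (col j)) ∧ Set.InjOn g (Set.Iio p) ∧
      (∀ j < p, (∀ j' < p, j < j' → col j' ≠ col j) → f (col j) = g j) ∧
      ∀ s, e ∣ s → s + k ≤ p → (Finset.Ico s (s + k)).image g ∈ E := by
    intro p
    induction p with
    | zero =>
      intro _
      obtain ⟨f, hf⟩ := hne
      exact ⟨fun _ => f ⟨0, hk⟩, f, hf, by simp, by simp, by simp, by intros; omega⟩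
    | succ p ih =>
      intro hp
      obtain ⟨g, f, hf, h1, h2, h3, h4⟩ := ih (by omega)
      obtain ⟨v, hv, hvg⟩ : ∃ v ∈ B.filter fun v => Function.update f (col p) v ∈ F',
          v ∉ (Finset.range p).image g := by
        by_contra hcon
        push Not at hcon
        have h5 := (Finset.card_le_card hcon).trans Finset.card_image_le
        rw [Finset.card_range] at h5
        have h6 := hup f hf (col p)
        have : ((B.filter fun v => Function.update f (col p) v ∈ F').card : ℝ) ≤ p := by
          exact_mod_cast h5
        have : (p : ℝ) + 1 ≤ L := by exact_mod_cast hp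
        linarith
      rw [Finset.mem_filter] at hv
      have hfv := hF _ (hFF hv.2)
      have hgv : ∀ j < p, Function.update g p v j = g j := fun j hj => by
        simp [hj.ne]
      have hfcol : ∀ j < p + 1, (∀ j' < p + 1, j < j' → col j' ≠ col j) →
          Function.update f (col p) v (col j) = Function.update g p v j := by
        intro j hj hj'
        rcases Nat.lt_succ_iff_lt_or_eq.1 hj with h | rfl
        · rw [hgv j h, Function.update_of_ne (hj' p (by omega) h).symm]
          exact h3 j h fun j' hj1 hj2 => hj' j' (by omega) hj2
        · simp
      refine ⟨Function.update g p v, Function.update f (col p) v, hv.2, ?_, ?_, hfcol, ?_⟩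
      · intro j hj
        rcases Nat.lt_succ_iff_lt_or_eq.1 hj with h | rfl
        · rw [hgv j h]; exact h1 j h
        · have := hfv.1 (col j)
          simpa using this
      · intro a ha b hb hab
        have ha : a < p + 1 := ha
        have hb : b < p + 1 := hb
        rcases Nat.lt_succ_iff_lt_or_eq.1 ha with h | rfl <;>
          rcases Nat.lt_succ_iff_lt_or_eq.1 hb with h' | rfl
        · rw [hgv a h, hgv b h'] at hab; exact h2 h h' hab
        · rw [hgv a h] at hab
          simp only [Function.update_self] at hab
          exact absurd (Finset.mem_image.2 ⟨a, by simpa using h, hab⟩) hvg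
        · rw [hgv b h'] at hab
          simp only [Function.update_self] at hab
          exact absurd (Finset.mem_image.2 ⟨b, by simpa using h', hab.symm⟩) hvg
        · rfl
      · intro s hs hsp
        rcases Nat.lt_or_ge (s + k) (p + 1) with h | h
        · have := h4 s hs (by omega)
          convert this using 1
          refine Finset.image_congr fun j hj => ?_
          simp only [Finset.coe_Ico, Set.mem_Ico] at hj
          exact hgv j (by omega)
        · have hps : p + 1 = s + k := by omega
          have hcs : (Finset.Ico s (s + k)).image col = Finset.univ := by
            refine Finset.eq_univ_of_card _ ?_
            rw [Finset.card_image_of_injOn (by simpa using hcol s hs)]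
            simp
          have h5 : (Finset.Ico s (s + k)).image (Function.update g p v) =
              Finset.univ.image (Function.update f (col p) v) := by
            rw [← hcs, Finset.image_image]
            refine Finset.image_congr fun j hj => ?_
            simp only [Finset.coe_Ico, Set.mem_Ico] at hj
            refine (hfcol j (by omega) fun j' h6 h7 h8 => ?_).symm
            have := hcol s hs (Set.mem_Ico.2 ⟨by omega, by omega⟩) (Set.mem_Ico.2 hj) h8
            omega
          rw [h5]
          exact hfv.2
  obtain ⟨g, f, -, h1, h2, -, h4⟩ := key L le_rfl
  have hnd : ((List.range L).map g).Nodup := by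
    refine List.Nodup.map_on (fun a ha b hb h => h2 ?_ ?_ h) List.nodup_range
    · simpa using ha
    · simpa using hb
  refine ⟨(List.range L).map g, by simp, hnd, ?_, ?_, ?_⟩
  · intro v hv
    obtain ⟨j, hj, rfl⟩ := List.mem_map.1 hv
    exact (h1 j (by simpa using hj)).1
  · intro p w s hpw hw hp
    have hlen := congrArg List.length hpw
    simp at hlen
    have hw' : w = (List.range' p.length k).map g := by
      have h5 : w = (((List.range L).map g).drop p.length).take k := by
        rw [hpw, List.append_assoc, List.drop_left, ← hw, List.take_left]
      rw [h5, ← List.map_drop, ← List.map_take]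
      congr 1
      refine List.ext_getElem (by simp; omega) fun i h6 h7 => ?_
      simp
    have := h4 p.length hp (by omega)
    convert this using 1
    rw [hw']
    ext v
    simp [List.mem_range'_1]
  · rw [List.sum_toFinset _ hnd]
    simp only [List.map_map]
    rw [← List.sum_toFinset _ List.nodup_range, List.toFinset_range]
    exact Finset.sum_le_sum fun j hj => (h1 j (Finset.mem_range.1 hj)).2

end PathBuilding

section CheapPaths

variable {V : Type}

theorem exists_quantile {B : Finset V} (y : V → ℝ) {α : ℝ} (hα : 0 < α) (hB : α ≤ B.card) :
    ∃ c ∈ B.image y, α ≤ ((B.filter fun v => y v ≤ c).card : ℝ) ∧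
      ((B.filter fun v => y v < c).card : ℝ) < α := by
  have hne : B.Nonempty := by
    rw [← Finset.card_pos]
    exact_mod_cast hα.trans_le hB
  set T := (B.image y).filter fun c => α ≤ ((B.filter fun v => y v ≤ c).card : ℝ) with hT
  have hTne : T.Nonempty := by
    obtain ⟨x, hx, hmax⟩ := Finset.exists_max_image B y hne
    refine ⟨y x, Finset.mem_filter.2 ⟨Finset.mem_image_of_mem _ hx, ?_⟩⟩
    rwa [Finset.filter_true_of_mem fun v hv => hmax v hv]
  obtain ⟨c, hc, hmin⟩ := Finset.exists_min_image T id hTne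
  obtain ⟨hc1, hc2⟩ := Finset.mem_filter.1 hc
  refine ⟨c, hc1, hc2, ?_⟩
  rcases (B.filter fun v => y v < c).eq_empty_or_nonempty with h | h
  · rw [h]; simpa using hα
  · obtain ⟨x, hx, hmax⟩ := Finset.exists_max_image _ y h
    obtain ⟨hxB, hxc⟩ := Finset.mem_filter.1 hx
    by_contra hcon
    push Not at hcon
    have hxT : y x ∈ T := by
      refine Finset.mem_filter.2 ⟨Finset.mem_image_of_mem _ hxB, hcon.trans ?_⟩
      refine Nat.cast_le.2 (Finset.card_le_card fun v hv => ?_)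
      exact Finset.mem_filter.2 ⟨(Finset.mem_filter.1 hv).1, hmax v hv⟩
    have := hmin _ hxT
    simp only [id] at this
    linarith

variable [DecidableEq V]

/-- Greedy counting of edges respecting weight bounds on their vertices. -/
theorem exists_many_edges {C : Finset V → Prop} {k : ℕ} {B : Finset V} {y : V → ℝ} {D a b c : ℝ}
    (hD : 0 ≤ D) {i₀ i₁ : Fin k} (hi : i₀ ≠ i₁) {E : Finset (Finset V)}
    (hE : ∀ S, C S → S.card = k → S ∈ E) {j : ℕ} (hjk : j ≤ k) (lv : ℕ → ℝ)
    (hlv0 : lv 0 = a) (hlv1 : lv 1 = b) (hlv : ∀ i, 2 ≤ i → lv i = c)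
    (Z : Finset (List V))
    (hZ : ∀ z ∈ Z, z.length = j ∧ z.Nodup ∧ C z.toFinset ∧ (∀ v ∈ z, v ∈ B) ∧
      ∀ i (h : i < z.length), y z[i] ≤ lv i)
    (hstep : ∀ S, C S → S.card < k → j ≤ S.card →
      D ≤ (((extSet C B S).filter fun v => y v ≤ lv S.card).card : ℝ)) :
    ∃ F : Finset (Fin k → V), (Z.card : ℝ) * D ^ (k - j) ≤ F.card ∧
      ∀ f ∈ F, (∀ i, f i ∈ B ∧ y (f i) ≤ if i = i₁ then a else if i = i₀ then b else c) ∧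
        Finset.univ.image f ∈ E := by
  obtain ⟨Z', hcard, hZ'⟩ := exists_many_lists (fun z => z.Nodup ∧ C z.toFinset ∧
      (∀ v ∈ z, v ∈ B) ∧ ∀ i (h : i < z.length), y z[i] ≤ lv i) D hD j Z hZ (k - j) (by
    rintro z ⟨h1, h2, h3, h4⟩ hj hl
    have hc : z.toFinset.card = z.length := List.toFinset_card_of_nodup h1
    refine ⟨_, hstep z.toFinset h2 (by omega) (by omega), fun v hv => ?_⟩
    obtain ⟨hv1, hv2⟩ := Finset.mem_filter.1 hv
    obtain ⟨hv3, hv4, hv5⟩ := mem_extSet.1 hv1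
    rw [List.mem_toFinset] at hv4
    refine ⟨?_, ?_, ?_, ?_⟩
    · rw [List.nodup_append]
      exact ⟨h1, by simp, by rintro u hu w hw rfl; simp at hw; exact hv4 (hw ▸ hu)⟩
    · convert hv5 using 1
      ext; simp
    · intro u hu
      simp only [List.mem_append, List.mem_singleton] at hu
      rcases hu with hu | rfl
      · exact h3 u hu
      · exact hv3
    · intro i hi
      rw [List.getElem_append]
      split_ifs with h
      · exact h4 i h
      · simp only [List.length_append, List.length_singleton] at hi
        have : i = z.length := by omega
        subst this
        simpa [hc] using hv2)
  have hk0 : 0 < k := i₀.pos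
  have hk1 : 1 < k := by
    by_contra hcon
    exact hi (by ext; omega)
  set τ : Equiv.Perm (Fin k) := Equiv.swap i₁ ⟨0, hk0⟩ with hτ
  set σ : Equiv.Perm (Fin k) := τ.trans (Equiv.swap (τ i₀) ⟨1, hk1⟩) with hσ
  have hτ1 : τ i₁ = ⟨0, hk0⟩ := Equiv.swap_apply_left _ _
  have hσ0 : σ i₀ = ⟨1, hk1⟩ := Equiv.swap_apply_left _ _
  have hσ1 : σ i₁ = ⟨0, hk0⟩ := by
    rw [hσ, Equiv.trans_apply, hτ1]
    refine Equiv.swap_apply_of_ne_of_ne ?_ (by simp)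
    rw [← hτ1]
    exact fun h => hi (τ.injective h).symm
  have hlen : ∀ z ∈ Z', z.length = k := fun z hz => by have := (hZ' z hz).1; omega
  refine ⟨Z'.attach.image fun z i => z.1[(σ i : ℕ)]'(by rw [hlen z.1 z.2]; exact (σ i).2), ?_, ?_⟩
  · rw [Finset.card_image_of_injective, Finset.card_attach]
    · exact hcard
    · rintro ⟨z, hz⟩ ⟨z', hz'⟩ h
      rw [Subtype.mk.injEq]
      refine List.ext_getElem (by rw [hlen z hz, hlen z' hz']) fun i h1 h2 => ?_
      have := congrFun h (σ.symm ⟨i, by rw [← hlen z hz]; exact h1⟩)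
      simpa using this
  · intro f hf
    obtain ⟨⟨z, hz⟩, -, rfl⟩ := Finset.mem_image.1 hf
    obtain ⟨-, h1, h2, h3, h4⟩ := hZ' z hz
    refine ⟨fun i => ⟨h3 _ (List.getElem_mem _), (h4 _ _).trans (le_of_eq ?_)⟩, ?_⟩
    · split_ifs with h h'
      · rw [h, hσ1]; exact hlv0
      · rw [h', hσ0]; exact hlv1
      · refine hlv _ ?_
        have h5 : (σ i : ℕ) ≠ 0 := fun h0 => h (σ.injective (by rw [hσ1]; ext; exact h0))
        have h6 : (σ i : ℕ) ≠ 1 := fun h0 => h' (σ.injective (by rw [hσ0]; ext; exact h0))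
        omega
    · have h5 : Finset.univ.image (fun i : Fin k =>
          z[(σ i : ℕ)]'(by rw [hlen z hz]; exact (σ i).2)) = z.toFinset := by
        ext v
        simp only [Finset.mem_image, Finset.mem_univ, true_and, List.mem_toFinset]
        constructor
        · rintro ⟨i, rfl⟩; exact List.getElem_mem _
        · intro hv
          obtain ⟨i, hi, rfl⟩ := List.mem_iff_getElem.1 hv
          exact ⟨σ.symm ⟨i, by rw [← hlen z hz]; exact hi⟩, by simp⟩
      rw [h5]
      exact hE _ h2 (by rw [List.toFinset_card_of_nodup h1, hlen z hz])

theorem sum_levels_le {k t : ℕ} {i₀ i₁ : Fin k} (hi : i₀ ≠ i₁) {col : ℕ → Fin k} {L : ℕ}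
    (h1 : (L : ℝ) / t - 1 ≤ ((Finset.range L).filter fun p => col p = i₁).card)
    (h0 : (L : ℝ) / (2 * t) ≤ ((Finset.range L).filter fun p => col p = i₀).card)
    {a b c : ℝ} (hac : a ≤ c) (hbc : b ≤ c) (hac1 : c - a ≤ 1) :
    ∑ p ∈ Finset.range L, (if col p = i₁ then a else if col p = i₀ then b else c) ≤
      L * (c - (c - a) / t - (c - b) / (2 * t)) + 1 := by
  have h : ∀ p, (if col p = i₁ then a else if col p = i₀ then b else c) =
      c - (c - a) * (if col p = i₁ then 1 else 0) - (c - b) * (if col p = i₀ then 1 else 0) := by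
    intro p
    split_ifs with h h' h'
    · exact absurd (h'.symm.trans h) hi
    · ring
    · ring
    · ring
  simp only [h, Finset.sum_sub_distrib, ← Finset.mul_sum, Finset.sum_boole, Finset.sum_const,
    Finset.card_range, nsmul_eq_mul]
  have h2 := mul_le_mul_of_nonneg_left h1 (sub_nonneg.2 hac)
  have h3 := mul_le_mul_of_nonneg_left h0 (sub_nonneg.2 hbc)
  have h4 : L * (c - (c - a) / t - (c - b) / (2 * t)) =
      L * c - (c - a) * ((L : ℝ) / t) - (c - b) * ((L : ℝ) / (2 * t)) := by ring
  rw [h4]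
  linarith

set_option maxHeartbeats 400000 in
open Classical in
/-- In a non-extremal complex, any weighting admits a loose path whose average weight hardly
exceeds the overall average. -/
theorem exists_cheap_path {C : Finset V → Prop} {k e t : ℕ} (he : 0 < e) (hek : e ≤ k)
    (ht : t = k / e * e) (ht3 : 3 ≤ t) (hk : 3 ≤ k)
    {E : Finset (Finset V)} (hE : ∀ S, C S → S.card = k → S ∈ E) {B : Finset V}
    {e1 m1 b b2 c : ℝ} (he1 : 0 ≤ e1) (hb : 0 < b) (hc : 0 < c)
    (he1t : e1 ≤ 1 / (4 * t)) (he1m : 6 * e1 ≤ m1) (hbt : 1 / t + e1 + b ≤ 1)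
    (hc1 : k * c < b ^ k) (hc2 : k * c < b2 * b ^ (k - 2))
    (h0 : C ∅) (h1 : ∀ v ∈ B, C {v}) (hext : HasExt C k B ((1 - 1 / t - e1) * B.card))
    (hpair : ∀ A ⊆ B, (1 / t - m1) * B.card ≤ A.card → b2 * (B.card : ℝ) ^ 2 ≤
      ((A ×ˢ A).filter fun p => p.1 ≠ p.2 ∧ C {p.1, p.2}).card)
    {y : V → ℝ} (hy : ∀ v, 0 ≤ y v ∧ y v ≤ 1) {L : ℕ} (hL : L < c * B.card) :
    ∃ P : List V, LoosePath E k e P ∧ P.Nodup ∧ P.length = L ∧ (∀ v ∈ P, v ∈ B) ∧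
      ∑ v ∈ P.toFinset, y v ≤ L * ((∑ v ∈ B, y v) / B.card + 2 * b) + 1 := by
  obtain ⟨col, i₀, i₁, hi, hcol, hcol1, hcol0⟩ := exists_colouring he hek ht ht3
  obtain ⟨N, hN⟩ : ∃ N : ℝ, N = B.card := ⟨_, rfl⟩
  have hN0 : 0 < N := by
    rw [hN]
    by_contra hcon
    have : c * (B.card : ℝ) ≤ 0 := mul_nonpos_of_nonneg_of_nonpos hc.le (not_lt.1 hcon)
    have : (0 : ℝ) ≤ L := L.cast_nonneg
    linarith
  have htR : (0 : ℝ) < t := by exact_mod_cast (by omega : 0 < t)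
  have hti : (0 : ℝ) < 1 / t := by positivity
  have hb1 : b ≤ 1 := by linarith
  obtain ⟨a, haB, ha1, ha2⟩ := exists_quantile (B := B) y (α := b * B.card) (by rw [← hN]; positivity)
    (by rw [← hN]; nlinarith)
  obtain ⟨u, huB, hu1, hu2⟩ := exists_quantile (B := B) y (α := (1 / t + e1 + b) * B.card)
    (by rw [← hN]; positivity) (by rw [← hN]; nlinarith)
  obtain ⟨xa, hxa, rfl⟩ := Finset.mem_image.1 haB
  obtain ⟨xu, hxu, rfl⟩ := Finset.mem_image.1 huB
  obtain ⟨a, ha⟩ : ∃ a, a = y xa := ⟨_, rfl⟩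
  obtain ⟨u, hu⟩ : ∃ u, u = y xu := ⟨_, rfl⟩
  have ha01 := hy xa
  have hu01 := hy xu
  rw [← ha] at ha1 ha2 ha01
  rw [← hu] at hu1 hu2 hu01
  rw [← hN] at ha1 ha2 hu1 hu2 hext hpair hL
  have hau : a ≤ u := by
    by_contra hcon
    push Not at hcon
    have h2 : ((B.filter fun v => y v ≤ u).card : ℝ) ≤ (B.filter fun v => y v < a).card := by
      refine Nat.cast_le.2 (Finset.card_le_card fun v hv => ?_)
      rw [Finset.mem_filter] at hv ⊢
      exact ⟨hv.1, hv.2.trans_lt hcon⟩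
    have : 0 < (1 / t + e1) * N := by positivity
    linarith
  have hcheap : ∀ S, C S → S.card < k →
      b * N ≤ (((extSet C B S).filter fun v => y v ≤ u).card : ℝ) := by
    intro S hS hSk
    have h2 := hext S hS hSk
    have h3 : extSet C B S ∩ (B.filter fun v => y v ≤ u) ⊆
        (extSet C B S).filter fun v => y v ≤ u := by
      intro v hv
      simp only [Finset.mem_inter, Finset.mem_filter] at hv ⊢
      exact ⟨hv.1, hv.2.2⟩
    have h4 := Finset.card_le_card h3
    have h5 := Finset.card_union_add_card_inter (extSet C B S) (B.filter fun v => y v ≤ u)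
    have h6 : (extSet C B S ∪ (B.filter fun v => y v ≤ u)).card ≤ B.card :=
      Finset.card_le_card (Finset.union_subset (Finset.filter_subset _ _)
        (Finset.filter_subset _ _))
    have h7 : ((extSet C B S).card : ℝ) + (B.filter fun v => y v ≤ u).card ≤
        N + ((extSet C B S).filter fun v => y v ≤ u).card := by
      rw [hN]
      exact_mod_cast (by omega)
    nlinarith
  have hmulN : ∀ x : ℝ, L * (x / N) = L * x / N := fun x => by ring
  have hfinish : ∀ (a' b' : ℝ) (F : Finset (Fin k → V)), a' ≤ u → b' ≤ u → u - a' ≤ 1 →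
      (∀ f ∈ F, (∀ i, f i ∈ B ∧ y (f i) ≤ if i = i₁ then a' else if i = i₀ then b' else u) ∧
        Finset.univ.image f ∈ E) → k * c * N ^ k < F.card →
      u - (u - a') / t - (u - b') / (2 * t) ≤ (∑ v ∈ B, y v) / N + 2 * b →
      ∃ P : List V, LoosePath E k e P ∧ P.Nodup ∧ P.length = L ∧ (∀ v ∈ P, v ∈ B) ∧
        ∑ v ∈ P.toFinset, y v ≤ L * ((∑ v ∈ B, y v) / B.card + 2 * b) + 1 := by
    intro a' b' F h2 h3 h4 hF hcard hle
    rw [hN] at hL hcard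
    obtain ⟨P, h5, h6, h7, h8, h9⟩ := exists_path_of_edges (by omega) hc.le F hF hcard hcol hL
    refine ⟨P, h8, h6, h5, h7, h9.trans ((sum_levels_le hi (hcol1 L) (hcol0 L) h2 h3 h4).trans ?_)⟩
    rw [← hN]
    gcongr
  have hsum : ∀ s : ℝ, 0 ≤ s → s ≤ 1 → a * N - b * N +
      s * (u - a) * (B.filter fun v => a + s * (u - a) < y v).card +
      (1 - s) * (u - a) * (N - (1 / t + e1 + b) * N) ≤ ∑ v ∈ B, y v := by
    intro s hs0 hs1
    have hD : 0 ≤ u - a := by linarith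
    have h2 : ∀ v ∈ B, a - (if y v < a then 1 else 0) +
        s * (u - a) * (if a + s * (u - a) < y v then 1 else 0) +
        (1 - s) * (u - a) * (1 - if y v < u then 1 else 0) ≤ y v := by
      intro v _
      have hv := hy v
      have h3 : 0 ≤ s * (u - a) := by positivity
      have h4 : 0 ≤ (1 - s) * (u - a) := mul_nonneg (by linarith) hD
      split_ifs <;> linarith
    have h3 := Finset.sum_le_sum h2
    simp only [Finset.sum_add_distrib, Finset.sum_sub_distrib, ← Finset.mul_sum,
      Finset.sum_boole, Finset.sum_const, nsmul_eq_mul, ← hN] at h3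
    have h4 : (1 - s) * (u - a) * (N - (1 / t + e1 + b) * N) ≤
        (1 - s) * (u - a) * (N - (B.filter fun v => y v < u).card) := by
      have : 0 ≤ (1 - s) * (u - a) := mul_nonneg (by linarith) hD
      gcongr
    linarith
  obtain ⟨s, hs⟩ : ∃ s : ℝ, s = 1 / 6 := ⟨_, rfl⟩
  set A := B.filter fun v => y v ≤ a + s * (u - a) with hA
  by_cases hAc : (1 / t - m1) * N ≤ A.card
  · have hp := hpair A (Finset.filter_subset _ _) hAc
    obtain ⟨F, hFc, hF⟩ := exists_many_edges (B := B) (y := y) (a := a + s * (u - a))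
      (b := a + s * (u - a)) (c := u) (D := b * N) (by positivity) hi hE (j := 2) (by omega)
      (fun i => if i < 2 then a + s * (u - a) else u) (by simp) (by simp)
      (fun i hi => by rw [if_neg (by omega)])
      (((A ×ˢ A).filter fun p => p.1 ≠ p.2 ∧ C {p.1, p.2}).image fun p => [p.1, p.2]) (by
        intro z hz
        obtain ⟨⟨p, q⟩, hpq, rfl⟩ := Finset.mem_image.1 hz
        simp only [Finset.mem_filter, Finset.mem_product, hA] at hpq
        obtain ⟨⟨⟨hp1, hp2⟩, hq1, hq2⟩, hne, hCpq⟩ := hpq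
        refine ⟨rfl, by simpa using hne, by simpa using hCpq, by simp [hp1, hq1], ?_⟩
        intro i hi
        have : i = 0 ∨ i = 1 := by simp at hi; omega
        rcases this with rfl | rfl
        · simpa using hp2
        · simpa using hq2)
      (fun S hS hSk hj => by
        rw [if_neg (by omega)]
        exact hcheap S hS hSk)
    rw [Finset.card_image_of_injective _ (fun p q h => by
      simp at h; exact Prod.ext h.1 h.2)] at hFc
    have hD : 0 ≤ u - a := by linarith
    refine hfinish _ _ F ?_ ?_ ?_ hF (lt_of_lt_of_le ?_ hFc) ?_
    · rw [hs]; linarith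
    · rw [hs]; linarith
    · rw [hs]; linarith
    · calc k * c * N ^ k < b2 * b ^ (k - 2) * N ^ k := by gcongr
        _ = b2 * N ^ 2 * (b * N) ^ (k - 2) := by
          have : N ^ k = N ^ 2 * N ^ (k - 2) := by rw [← pow_add]; congr 1; omega
          rw [this, mul_pow]; ring
        _ ≤ _ := by gcongr
    · have h2 := hsum 0 le_rfl (by norm_num)
      rw [zero_mul, zero_mul] at h2
      have h3 : a - b + (u - a) * (1 - (1 / t + e1 + b)) ≤ (∑ v ∈ B, y v) / N := by
        rw [le_div_iff₀ hN0]; nlinarith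
      refine le_trans ?_ (add_le_add_left h3 _)
      have h4 : (u - (a + s * (u - a))) / t = (u - a) * (5 / 6 * (1 / t)) := by rw [hs]; ring
      have h5 : (u - (a + s * (u - a))) / (2 * t) = (u - a) * (5 / 12 * (1 / t)) := by
        rw [hs]; ring
      have h6 : e1 ≤ 1 / 4 * (1 / t) := he1t.trans (le_of_eq (by ring))
      rw [h4, h5]
      have h7 : (u - a) * e1 ≤ (u - a) * (1 / 4 * (1 / t)) := mul_le_mul_of_nonneg_left h6 hD
      have h8 : (u - a) * b ≤ 1 * b := mul_le_mul_of_nonneg_right (by linarith) hb.le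
      linarith
  · push Not at hAc
    obtain ⟨F, hFc, hF⟩ := exists_many_edges (B := B) (y := y) (a := a)
      (b := u) (c := u) (D := b * N) (by positivity) hi hE (j := 0) (by omega)
      (fun i => if i = 0 then a else u) (by simp) (by simp)
      (fun i hi => by rw [if_neg (by omega)]) {[]} (by simp [h0])
      (fun S hS hSk hj => by
        split_ifs with h
        · rw [Finset.card_eq_zero] at h
          subst h
          refine ha1.trans (Nat.cast_le.2 (Finset.card_le_card fun v hv => ?_))
          rw [Finset.mem_filter] at hv ⊢
          exact ⟨mem_extSet.2 ⟨hv.1, by simp, by simpa using h1 v hv.1⟩, hv.2⟩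
        · exact hcheap S hS hSk)
    have hD : 0 ≤ u - a := by linarith
    refine hfinish _ _ F hau le_rfl (by linarith) hF (lt_of_lt_of_le ?_ hFc) ?_
    · calc k * c * N ^ k < b ^ k * N ^ k := by gcongr
        _ = _ := by simp [mul_pow]
    · have h2 := hsum s (by rw [hs]; norm_num) (by rw [hs]; norm_num)
      have h3 : N - (1 / t - m1) * N ≤ (B.filter fun v => a + s * (u - a) < y v).card := by
        have h4 := Finset.card_filter_add_card_filter_not (s := B) (fun v => y v ≤ a + s * (u - a))
        have h5 : (A.card : ℝ) + (B.filter fun v => a + s * (u - a) < y v).card = N := by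
          rw [hN]
          simp only [not_le] at h4
          exact_mod_cast h4
        linarith
      have h4 : s * (u - a) * (N - (1 / t - m1) * N) ≤
          s * (u - a) * (B.filter fun v => a + s * (u - a) < y v).card := by
        have : 0 ≤ s * (u - a) := by rw [hs]; positivity
        gcongr
      have h5 : a - b + s * (u - a) * (1 - (1 / t - m1)) +
          (1 - s) * (u - a) * (1 - (1 / t + e1 + b)) ≤ (∑ v ∈ B, y v) / N := by
        rw [le_div_iff₀ hN0]; nlinarith
      refine le_trans ?_ (add_le_add_left h5 _)
      have h6 : (u - a) / t = (u - a) * (1 / t) := by ring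
      rw [h6, sub_self, zero_div, hs]
      have h7 : (u - a) * (6 * e1) ≤ (u - a) * m1 := mul_le_mul_of_nonneg_left he1m hD
      have h8 : (u - a) * b ≤ 1 * b := mul_le_mul_of_nonneg_right (by linarith) hb.le
      have h9 : 0 ≤ (u - a) * b := by positivity
      have h10 : 0 ≤ (u - a) * e1 := by positivity
      linarith

end CheapPaths

section Inheritance

variable {V : Type} [DecidableEq V] [Fintype V]

/-- The vertices forming a face together with `u`. -/
noncomputable def nbrs (C : Finset V → Prop) (u : V) : Finset V := extSet C univ {u}

theorem mem_nbrs {C : Finset V → Prop} {u v : V} : v ∈ nbrs C u ↔ v ≠ u ∧ C {v, u} := by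
  simp [nbrs, mem_extSet]

/-- The non-neighbours of `b` having many neighbours among the non-neighbours of `b`. -/
noncomputable def richSet (C : Finset V → Prop) (μ : ℝ) (b : V) : Finset V :=
  univ.filter fun u => u ∉ nbrs C b ∧ μ / 4 * Fintype.card V ≤ ((nbrs C u \ nbrs C b).card : ℝ)

/-- The polynomially many sets whose densities are preserved when tiling. -/
noncomputable def testSet (C : Finset V → Prop) (k : ℕ) (μ : ℝ) :
    (Fin k → V) ⊕ V ⊕ V × V → Finset V :=
  Sum.elim (fun f => extSet C univ (univ.image f))
    (Sum.elim (richSet C μ) fun p => nbrs C p.1 \ nbrs C p.2)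

omit [DecidableEq V] in
theorem card_tests_le {k : ℕ} (hk : 2 ≤ k) [Nonempty V] :
    (Fintype.card ((Fin k → V) ⊕ V ⊕ V × V) : ℝ) ≤ 3 * (Fintype.card V : ℝ) ^ k := by
  have h1 : (1 : ℝ) ≤ Fintype.card V := by exact_mod_cast Fintype.card_pos
  have h2 : (Fintype.card V : ℝ) ^ 1 ≤ (Fintype.card V : ℝ) ^ k := pow_le_pow_right₀ h1 (by omega)
  have h3 : (Fintype.card V : ℝ) ^ 2 ≤ (Fintype.card V : ℝ) ^ k := pow_le_pow_right₀ h1 hk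
  simp only [Fintype.card_sum, Fintype.card_prod, Fintype.card_pi, Finset.prod_const,
    Finset.card_univ, Fintype.card_fin]
  push_cast
  nlinarith

theorem Inherits.le_card {ι : Type} {τ : ι → Finset V} {γ : ℝ} {A B : Finset V}
    (h : Inherits τ γ A B) (hA : ((univ \ A).card : ℝ) ≤ γ * Fintype.card V) (hA0 : A.Nonempty)
    (i : ι) : (((τ i).card : ℝ) / Fintype.card V - 2 * γ) * B.card ≤ (τ i ∩ B).card := by
  rcases B.eq_empty_or_nonempty with rfl | hB
  · simp
  have hB0 : (0 : ℝ) < B.card := by exact_mod_cast hB.card_pos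
  have hA1 : (0 : ℝ) < A.card := by exact_mod_cast hA0.card_pos
  have hAn : (A.card : ℝ) ≤ Fintype.card V := by exact_mod_cast Finset.card_le_univ A
  have h1 := h i
  simp only [relDens] at h1
  have h2 : ((τ i).card : ℝ) ≤ (τ i ∩ A).card + (univ \ A).card := by
    have : (τ i).card ≤ (τ i ∩ A).card + (univ \ A).card := by
      rw [← Finset.card_inter_add_card_sdiff (τ i) A]
      have := Finset.card_le_card (Finset.sdiff_subset_sdiff (Finset.subset_univ (τ i)) (subset_refl A))
      omega
    exact_mod_cast this
  have h3 : ((τ i).card : ℝ) / Fintype.card V - γ ≤ (τ i ∩ A).card / A.card := by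
    calc ((τ i).card : ℝ) / Fintype.card V - γ ≤ (τ i ∩ A).card / Fintype.card V := by
          rw [sub_le_iff_le_add, div_le_iff₀ (hA1.trans_le hAn), add_mul,
            div_mul_cancel₀ _ (hA1.trans_le hAn).ne']
          linarith
      _ ≤ _ := by gcongr
  rw [← le_div_iff₀ hB0]
  linarith

theorem card_pairs_eq_sum {C : Finset V → Prop} (A : Finset V)
    [DecidablePred fun p : V × V => p.1 ≠ p.2 ∧ C {p.1, p.2}] :
    ((A ×ˢ A).filter fun p => p.1 ≠ p.2 ∧ C {p.1, p.2}).card = ∑ u ∈ A, (nbrs C u ∩ A).card := by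
  classical
  rw [Finset.card_filter, Finset.sum_product_right]
  refine Finset.sum_congr rfl fun u _ => ?_
  rw [← Finset.card_filter]
  congr 1
  ext v
  simp only [Finset.mem_filter, Finset.mem_inter, mem_nbrs]
  tauto

theorem card_suppPairs_le_sum {C : Finset V → Prop} (A : Finset V) [DecidablePred C] :
    ((A.powersetCard 2).filter C).card ≤ ∑ u ∈ A, (nbrs C u ∩ A).card := by
  classical
  rw [← card_pairs_eq_sum]
  refine le_trans (Finset.card_le_card (t := Finset.image (fun p : V × V => {p.1, p.2}) _) ?_)
    Finset.card_image_le
  intro p hp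
  obtain ⟨hp1, hp2⟩ := Finset.mem_filter.1 hp
  obtain ⟨hpA, hpc⟩ := Finset.mem_powersetCard.1 hp1
  obtain ⟨u, v, huv, rfl⟩ := Finset.card_eq_two.1 hpc
  refine Finset.mem_image.2 ⟨(u, v), Finset.mem_filter.2 ⟨Finset.mem_product.2 ⟨hpA ?_, hpA ?_⟩,
    huv, hp2⟩, rfl⟩ <;> simp

omit [Fintype V] in
theorem card_suppPairs_insert_le {C : Finset V → Prop} (A D : Finset V) [DecidablePred C] :
    ((A.powersetCard 2).filter C).card ≤
      ((D.powersetCard 2).filter C).card + (A \ D).card * A.card := by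
  classical
  have h : (A.powersetCard 2).filter C ⊆ (D.powersetCard 2).filter C ∪
      ((A \ D) ×ˢ A).image fun p => {p.1, p.2} := by
    intro p hp
    obtain ⟨hp1, hp2⟩ := Finset.mem_filter.1 hp
    obtain ⟨hpA, hpc⟩ := Finset.mem_powersetCard.1 hp1
    rw [Finset.mem_union]
    by_cases hD : p ⊆ D
    · exact Or.inl (Finset.mem_filter.2 ⟨Finset.mem_powersetCard.2 ⟨hD, hpc⟩, hp2⟩)
    · right
      obtain ⟨u, hu, huD⟩ := Finset.not_subset.1 hD
      obtain ⟨v, hv⟩ := Finset.card_eq_one.1 (by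
        rw [Finset.card_erase_of_mem hu, hpc] : (p.erase u).card = 1)
      have hvp : v ∈ p := Finset.mem_of_mem_erase (hv ▸ Finset.mem_singleton_self v)
      refine Finset.mem_image.2 ⟨(u, v), Finset.mem_product.2
        ⟨Finset.mem_sdiff.2 ⟨hpA hu, huD⟩, hpA hvp⟩, ?_⟩
      rw [← Finset.insert_erase hu, hv]
  refine (Finset.card_le_card h).trans ((Finset.card_union_le _ _).trans ?_)
  gcongr
  exact Finset.card_image_le.trans (by rw [Finset.card_product])

theorem hasExt_of_tests {C : Finset V → Prop} {k : ℕ} {μ γ d : ℝ} {B : Finset V}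
    (h1 : ∀ v, C {v}) (hext : HasExt C k univ (d * Fintype.card V)) [Nonempty V]
    (hd1 : d ≤ 1) (hγ : 0 ≤ γ)
    (ht : ∀ i, (((testSet C k μ i).card : ℝ) / Fintype.card V - 2 * γ) * B.card ≤
      (testSet C k μ i ∩ B).card) : HasExt C k B ((d - 2 * γ) * B.card) := by
  intro S hS hSk
  have hn : (0 : ℝ) < Fintype.card V := by exact_mod_cast Fintype.card_pos
  rcases S.eq_empty_or_nonempty with rfl | hne
  · have : extSet C B ∅ = B := by
      ext v; simp [mem_extSet, h1]
    rw [this]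
    have : (0 : ℝ) ≤ B.card := B.card.cast_nonneg
    nlinarith
  · obtain ⟨f, hf⟩ : ∃ f : Fin k → V, univ.image f = S := by
      obtain ⟨g⟩ : Nonempty (S ↪ Fin k) := by
        rw [Function.Embedding.nonempty_iff_card_le]; simpa using hSk.le
      have : Nonempty S := hne.to_subtype
      refine ⟨fun i => (Function.invFun g i : S), ?_⟩
      ext v
      simp only [Finset.mem_image, Finset.mem_univ, true_and]
      constructor
      · rintro ⟨i, rfl⟩; exact Subtype.coe_prop _
      · intro hv
        exact ⟨g ⟨v, hv⟩, by rw [Function.leftInverse_invFun g.injective]⟩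
    have h2 := ht (Sum.inl f)
    simp only [testSet, Sum.elim_inl, hf] at h2
    have h3 : extSet C univ S ∩ B = extSet C B S := by
      ext v; simp only [Finset.mem_inter, mem_extSet, Finset.mem_univ, true_and]; tauto
    rw [h3] at h2
    refine le_trans ?_ h2
    have h4 := hext S hS hSk
    rw [← le_div_iff₀ hn] at h4
    gcongr

set_option maxHeartbeats 1000000 in
open Classical in
/-- Non-extremality is inherited by every set with the right densities. -/
theorem pairs_of_tests {C : Finset V → Prop} {k t : ℕ} {μ ε : ℝ} {B : Finset V} [Nonempty V]
    (hk : 2 ≤ k) (ht0 : 0 < t) (hμ : 0 < μ) (hμ1 : μ ≤ 1) (hε : ε ≤ μ / (10000 * t))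
    (h1 : ∀ v, C {v}) (hext : HasExt C k B ((1 - 1 / t - (ε + 2 * (μ / (10000 * t)))) * B.card))
    (hsup : ∀ A : Finset V, A.card = Fintype.card V / t →
      μ * (Fintype.card V : ℝ) ^ 2 ≤ ((A.powersetCard 2).filter C).card)
    (ht : ∀ i, (((testSet C k μ i).card : ℝ) / Fintype.card V - 2 * (μ / (10000 * t))) * B.card ≤
      (testSet C k μ i ∩ B).card) (A : Finset V) (hAB : A ⊆ B)
    (hA : (1 / t - μ / (100 * t)) * B.card ≤ A.card) :
    μ ^ 2 / (1000 * t) * (B.card : ℝ) ^ 2 ≤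
      ((A ×ˢ A).filter fun p => p.1 ≠ p.2 ∧ C {p.1, p.2}).card := by
  rw [card_pairs_eq_sum]
  by_contra hcon
  push Not at hcon
  push_cast at hcon
  obtain ⟨n, hn⟩ : ∃ n : ℝ, n = Fintype.card V := ⟨_, rfl⟩
  obtain ⟨N, hN⟩ : ∃ N : ℝ, N = B.card := ⟨_, rfl⟩
  obtain ⟨r, hr⟩ : ∃ r : ℝ, r = 1 / t := ⟨_, rfl⟩
  have ht1 : (1 : ℝ) ≤ t := by exact_mod_cast ht0
  have hr0 : 0 < r := by rw [hr]; positivity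
  have hr1 : r ≤ 1 := by rw [hr, div_le_one (by positivity)]; exact ht1
  have e1 : μ / (100 * t) = μ * r / 100 := by rw [hr]; field_simp
  have e2 : μ / (10000 * t) = μ * r / 10000 := by rw [hr]; field_simp
  have e3 : μ ^ 2 / (1000 * t) = μ ^ 2 * r / 1000 := by rw [hr]; field_simp
  rw [e2] at hε hext ht
  rw [e1, ← hr] at hA
  rw [e3] at hcon
  rw [← hr] at hext
  rw [← hN] at hext ht hA hcon
  rw [← hn] at ht hsup
  have hn0 : 0 < n := by rw [hn]; exact_mod_cast Fintype.card_pos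
  have hN0 : 0 < N := by
    by_contra h
    have h2 : N = 0 := le_antisymm (not_lt.1 h) (by rw [hN]; positivity)
    rw [h2] at hcon
    have : (0 : ℝ) ≤ ∑ u ∈ A, ((nbrs C u ∩ A).card : ℝ) := by positivity
    simp at hcon
    linarith
  have hμr : μ * r ≤ μ := by nlinarith
  have hμr' : μ * r ≤ r := by nlinarith
  have hμr0 : 0 < μ * r := by positivity
  -- a vertex with few neighbours inside `A`
  obtain ⟨b, hbA, hb⟩ : ∃ b ∈ A, ((nbrs C b ∩ A).card : ℝ) < μ / 100 * N := by
    by_contra h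
    push Not at h
    have h2 := Finset.sum_le_sum h
    rw [Finset.sum_const, nsmul_eq_mul] at h2
    have h3 : r / 2 * N ≤ A.card := le_trans (by nlinarith) hA
    have h4 : r / 2 * N * (μ / 100 * N) ≤ A.card * (μ / 100 * N) := by gcongr
    have h5 : μ ^ 2 * r / 1000 * N ^ 2 ≤ r / 2 * N * (μ / 100 * N) := by
      have : μ ^ 2 * r ≤ μ * r := by nlinarith
      have : 0 ≤ μ * r * N ^ 2 := by positivity
      have : μ ^ 2 * r * N ^ 2 ≤ μ * r * N ^ 2 := by gcongr
      nlinarith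
    linarith
  set M := univ \ nbrs C b with hM
  have hnbB : (1 - r - (ε + 2 * (μ * r / 10000))) * N ≤ (nbrs C b ∩ B).card := by
    have h2 := hext {b} (h1 b) (by simp; omega)
    have h3 : extSet C B {b} = nbrs C b ∩ B := by
      ext v; simp only [Finset.mem_inter, mem_extSet, nbrs, Finset.mem_univ, true_and]; tauto
    rwa [h3] at h2
  have hBsplit : ((nbrs C b ∩ B).card : ℝ) + (B \ nbrs C b).card = N := by
    rw [hN, Finset.inter_comm]
    exact_mod_cast Finset.card_inter_add_card_sdiff B (nbrs C b)
  have hAsplit : ((nbrs C b ∩ A).card : ℝ) + (A \ nbrs C b).card = A.card := by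
    rw [Finset.inter_comm]
    exact_mod_cast Finset.card_inter_add_card_sdiff A (nbrs C b)
  have hMA : (((B \ nbrs C b) \ A).card : ℝ) + (A \ nbrs C b).card = (B \ nbrs C b).card := by
    have h2 := Finset.card_sdiff_add_card_inter (B \ nbrs C b) A
    have h3 : (B \ nbrs C b) ∩ A = A \ nbrs C b := by
      ext v; simp only [Finset.mem_inter, Finset.mem_sdiff]
      exact ⟨fun h => ⟨h.2, h.1.2⟩, fun h => ⟨⟨hAB h.1, h.2⟩, h.1⟩⟩
    rw [h3] at h2
    exact_mod_cast h2
  have hout : (((B \ nbrs C b) \ A).card : ℝ) ≤ μ * 3 / 100 * N := by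
    have : μ * r * N ≤ μ * N := by gcongr
    have : ε * N ≤ μ * r / 10000 * N := by gcongr
    nlinarith
  have hcap : ∀ T : Finset V, T ⊆ M → ((T ∩ B).card : ℝ) ≤ (T ∩ A).card + μ * 3 / 100 * N := by
    intro T hT
    refine le_trans ?_ (add_le_add_right hout _)
    have h2 : T ∩ B ⊆ (T ∩ A) ∪ ((B \ nbrs C b) \ A) := by
      intro v hv
      obtain ⟨hv1, hv2⟩ := Finset.mem_inter.1 hv
      have hv3 := (Finset.mem_sdiff.1 (hT hv1)).2
      by_cases hvA : v ∈ A
      · exact Finset.mem_union_left _ (Finset.mem_inter.2 ⟨hv1, hvA⟩)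
      · exact Finset.mem_union_right _ (Finset.mem_sdiff.2
          ⟨Finset.mem_sdiff.2 ⟨hv2, hv3⟩, hvA⟩)
    exact_mod_cast (Finset.card_le_card h2).trans (Finset.card_union_le _ _)
  have hMcard : (M.card : ℝ) = n - (nbrs C b).card := by
    rw [hM, Finset.card_sdiff_of_subset (Finset.subset_univ _), Finset.card_univ,
      Nat.cast_sub (Finset.card_le_univ _), hn]
  -- the non-neighbourhood of `b` has almost `n / t` vertices
  have hMlow : (r - μ / 10) * n ≤ M.card := by
    have h2 := ht (Sum.inl fun _ => b)
    have h3 : testSet C k μ (Sum.inl fun _ => b) = nbrs C b := by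
      simp only [testSet, Sum.elim_inl, nbrs]
      congr 1
      have : Nonempty (Fin k) := ⟨⟨0, by omega⟩⟩
      ext v
      simp [eq_comm]
    rw [h3] at h2
    have h4 : ((nbrs C b ∩ B).card : ℝ) ≤ (1 - (r - μ * 3 / 100)) * N := by
      have : μ * r * N ≤ μ * N := by gcongr
      have : (0 : ℝ) ≤ ((B \ nbrs C b) \ A).card := by positivity
      nlinarith
    have h5 := le_of_mul_le_mul_right (h2.trans h4) hN0
    have h6 : ((nbrs C b).card : ℝ) / n ≤ 1 - (r - μ / 10) := by linarith
    rw [div_le_iff₀ hn0] at h6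
    linarith
  -- hence it contains many supported pairs
  have hpairs : μ * 3 / 4 * n ^ 2 ≤ ∑ u ∈ M, ((nbrs C u \ nbrs C b).card : ℝ) := by
    have hsum : (((M.powersetCard 2).filter C).card : ℝ) ≤
        ∑ u ∈ M, ((nbrs C u \ nbrs C b).card : ℝ) := by
      have h2 := card_suppPairs_le_sum (C := C) M
      refine le_trans (Nat.cast_le.2 h2) ?_
      push_cast
      refine Finset.sum_le_sum fun u _ => Nat.cast_le.2 (Finset.card_le_card fun v hv => ?_)
      rw [Finset.mem_inter, hM, Finset.mem_sdiff] at hv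
      exact Finset.mem_sdiff.2 ⟨hv.1, hv.2.2⟩
    refine le_trans ?_ hsum
    have hdiv : ((Fintype.card V / t : ℕ) : ℝ) ≤ r * n := by
      rw [hr, hn, one_div, inv_mul_eq_div]
      exact Nat.cast_div_le
    rcases le_total (Fintype.card V / t) M.card with h | h
    · obtain ⟨A₀, hA₀, hA₀c⟩ := Finset.exists_subset_card_eq h
      have h2 := hsup A₀ hA₀c
      have h3 : ((A₀.powersetCard 2).filter C).card ≤ ((M.powersetCard 2).filter C).card :=
        Finset.card_le_card (Finset.filter_subset_filter _ (Finset.powersetCard_mono hA₀))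
      have h3 : (((A₀.powersetCard 2).filter C).card : ℝ) ≤ ((M.powersetCard 2).filter C).card := by
        exact_mod_cast h3
      have : 0 ≤ μ * n ^ 2 := by positivity
      linarith
    · obtain ⟨A₀, hA₀, hA₀c⟩ := Finset.exists_superset_card_eq h (Nat.div_le_self _ _)
      have h2 := hsup A₀ hA₀c
      have h3 : (((A₀.powersetCard 2).filter C).card : ℝ) ≤ ((M.powersetCard 2).filter C).card +
          (A₀ \ M).card * A₀.card := by
        exact_mod_cast card_suppPairs_insert_le (C := C) A₀ M
      have h4 : ((A₀ \ M).card : ℝ) ≤ μ / 10 * n := by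
        rw [Finset.card_sdiff_of_subset hA₀, Nat.cast_sub (Finset.card_le_card hA₀), hA₀c]
        linarith
      have h5 : (A₀.card : ℝ) ≤ n := by rw [hn]; exact_mod_cast Finset.card_le_univ A₀
      have h6 : ((A₀ \ M).card : ℝ) * A₀.card ≤ μ / 10 * n * n := by gcongr
      have : 0 ≤ μ * n ^ 2 := by positivity
      nlinarith
  have hrichM : richSet C μ b ⊆ M := by
    intro u hu
    exact Finset.mem_sdiff.2 ⟨Finset.mem_univ _, (Finset.mem_filter.1 hu).2.1⟩
  have hrich : μ / 2 * n ≤ (richSet C μ b).card := by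
    have h2 : ∀ u ∈ M, ((nbrs C u \ nbrs C b).card : ℝ) ≤
        μ / 4 * n + n * (if u ∈ richSet C μ b then 1 else 0) := by
      intro u hu
      split_ifs with h
      · have : ((nbrs C u \ nbrs C b).card : ℝ) ≤ n := by
          rw [hn]; exact_mod_cast Finset.card_le_univ _
        have : 0 ≤ μ / 4 * n := by positivity
        linarith
      · rw [mul_zero, add_zero]
        by_contra hlt
        push Not at hlt
        exact h (Finset.mem_filter.2 ⟨Finset.mem_univ _, (Finset.mem_sdiff.1 hu).2,
          by rw [← hn]; exact hlt.le⟩)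
    have h3 := hpairs.trans (Finset.sum_le_sum h2)
    rw [Finset.sum_add_distrib, ← Finset.mul_sum M (fun u => if u ∈ richSet C μ b then (1 : ℝ) else 0),
      Finset.sum_boole, Finset.sum_const, nsmul_eq_mul, Finset.filter_mem_eq_inter, Finset.inter_eq_right.2 hrichM] at h3
    have h4 : (M.card : ℝ) ≤ n := by rw [hn]; exact_mod_cast Finset.card_le_univ M
    have h5 : (M.card : ℝ) * (μ / 4 * n) ≤ n * (μ / 4 * n) := by gcongr
    have h6 : n * (μ / 2 * n) ≤ n * (richSet C μ b).card := by nlinarith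
    exact le_of_mul_le_mul_left h6 hn0
  have hrichA : μ / 4 * N ≤ (richSet C μ b ∩ A).card := by
    have h2 := ht (Sum.inr (Sum.inl b))
    simp only [testSet, Sum.elim_inr, Sum.elim_inl] at h2
    have h3 := hcap _ hrichM
    have h4 : μ / 2 ≤ ((richSet C μ b).card : ℝ) / n := by rwa [le_div_iff₀ hn0]
    have h5 : (μ / 2 - 2 * (μ / 10000)) * N ≤
        (((richSet C μ b).card : ℝ) / n - 2 * (μ * r / 10000)) * N := by
      gcongr
    have : 0 ≤ μ * N := by positivity
    linarith
  have hlow : ∀ u ∈ richSet C μ b ∩ A, μ / 8 * N ≤ ((nbrs C u ∩ A).card : ℝ) := by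
    intro u hu
    obtain ⟨hu1, hu2⟩ := Finset.mem_inter.1 hu
    have hu3 := (Finset.mem_filter.1 hu1).2.2
    have h2 := ht (Sum.inr (Sum.inr (u, b)))
    simp only [testSet, Sum.elim_inr] at h2
    have h3 := hcap (nbrs C u \ nbrs C b)
      (Finset.sdiff_subset_sdiff (Finset.subset_univ _) (subset_refl _))
    rw [← hn] at hu3
    have h4 : μ / 4 ≤ ((nbrs C u \ nbrs C b).card : ℝ) / n := by rwa [le_div_iff₀ hn0]
    have h5 : (μ / 4 - 2 * (μ / 10000)) * N ≤
        (((nbrs C u \ nbrs C b).card : ℝ) / n - 2 * (μ * r / 10000)) * N := by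
      gcongr
    have h6 : (((nbrs C u \ nbrs C b) ∩ A).card : ℝ) ≤ (nbrs C u ∩ A).card :=
      Nat.cast_le.2 (Finset.card_le_card (Finset.inter_subset_inter_right Finset.sdiff_subset))
    have : 0 ≤ μ * N := by positivity
    linarith
  have h2 : ∑ u ∈ richSet C μ b ∩ A, ((nbrs C u ∩ A).card : ℝ) ≤
      ∑ u ∈ A, ((nbrs C u ∩ A).card : ℝ) :=
    Finset.sum_le_sum_of_subset_of_nonneg Finset.inter_subset_right fun _ _ _ => by positivity
  have h3 := (Finset.sum_le_sum hlow).trans h2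
  rw [Finset.sum_const, nsmul_eq_mul] at h3
  have h4 : μ / 4 * N * (μ / 8 * N) ≤ (richSet C μ b ∩ A).card * (μ / 8 * N) := by gcongr
  have h5 : μ ^ 2 * r / 1000 * N ^ 2 ≤ μ / 4 * N * (μ / 8 * N) := by
    have : 0 ≤ μ ^ 2 * N ^ 2 := by positivity
    have : r * (μ ^ 2 * N ^ 2) ≤ 1 * (μ ^ 2 * N ^ 2) := by gcongr
    nlinarith
  linarith

end Inheritance

section AbsorbingPath

theorem nodup_flatMap_range {V : Type} {w : ℕ → List V} {N : ℕ} (h : ∀ i < N, (w i).Nodup)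
    (hd : ∀ i < N, ∀ j < i, List.Disjoint (w i) (w j)) : ((List.range N).flatMap w).Nodup := by
  rw [List.nodup_flatMap]
  refine ⟨fun i hi => h i (by simpa using hi), ?_⟩
  refine (List.pairwise_lt_range (n := N)).imp_of_mem fun {a b} _ hb hab => ?_
  exact (hd b (by simpa using hb) a hab).symm

theorem eventually_mul_pow_le_exp (a : ℝ) (j : ℕ) {b : ℝ} (hb : 0 < b) :
    ∀ᶠ n : ℕ in Filter.atTop, a * (n : ℝ) ^ j ≤ Real.exp (b * n) := by
  have h1 := (isLittleO_pow_exp_pos_mul_atTop j hb).bound (c := 1 / (|a| + 1)) (by positivity)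
  filter_upwards [tendsto_natCast_atTop_atTop.eventually h1] with n hn
  rw [Real.norm_of_nonneg (by positivity), Real.norm_of_nonneg (by positivity), one_div,
    inv_mul_eq_div, le_div_iff₀ (by positivity)] at hn
  have h2 : (0 : ℝ) ≤ (n : ℝ) ^ j := by positivity
  have h3 := le_abs_self a
  nlinarith

theorem eventually_le_mul (a : ℝ) {b : ℝ} (hb : 0 < b) :
    ∀ᶠ n : ℕ in Filter.atTop, a ≤ b * n := by
  filter_upwards [Filter.eventually_ge_atTop ⌈a / b⌉₊] with n hn
  have := Nat.ceil_le.1 hn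
  rw [div_le_iff₀ hb] at this
  linarith

open Classical in
/-- A path assembled from sufficiently many sites absorbs every small set. -/
theorem exists_absorption {V : Type} [DecidableEq V] {C : Finset V → Prop} {k m : ℕ}
    {z w : ℕ → List V} (hz : ∀ i ≤ m, (z i).length = 2 * (k - 1) ∧ Tight C k (z i))
    (hw : ∀ i < m, Tight C k ((z i).drop (k - 1) ++ w i ++ (z (i + 1)).take (k - 1)))
    (W : Finset V) (hW : ∀ x ∈ W,
      W.card ≤ ((Finset.range (m + 1)).filter fun i => AbsorbedBy C k x (z i)).card) :
    ∃ A, Tight C k A ∧ (∃ r, A = (z 0).take (k - 1) ++ r) ∧ (∃ r, A = r ++ (z m).drop (k - 1)) ∧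
      A.Perm (absorbPath k z w (fun _ => []) m ++ W.toList) := by
  obtain ⟨f, hf, hft⟩ := (Finset.all_card_le_biUnion_card_iff_exists_injective
    (fun x : W => (Finset.range (m + 1)).filter fun i => AbsorbedBy C k x.1 (z i))).1 (by
      intro s
      rcases s.eq_empty_or_nonempty with rfl | ⟨x, hx⟩
      · simp
      · refine le_trans ?_ (Finset.card_le_card (Finset.subset_biUnion_of_mem _ hx))
        refine le_trans ?_ (hW x.1 x.2)
        exact (Finset.card_le_univ s).trans (by simp))
  set o : ℕ → List V := fun i => if h : ∃ x : W, f x = i then [h.choose.1] else [] with ho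
  have hoi : ∀ i v, v ∈ o i ↔ ∃ h : v ∈ W, f ⟨v, h⟩ = i := by
    intro i v
    simp only [ho]
    split_ifs with h
    · rw [List.mem_singleton]
      constructor
      · rintro rfl; exact ⟨h.choose.2, h.choose_spec⟩
      · rintro ⟨hv, hvi⟩
        have := hf (hvi.trans h.choose_spec.symm)
        exact congrArg Subtype.val this
    · simp only [List.not_mem_nil, false_iff]
      rintro ⟨hv, hvi⟩
      exact h ⟨_, hvi⟩
  have hperm : ((List.range (m + 1)).flatMap o).Perm W.toList := by
    rw [List.perm_ext_iff_of_nodup _ W.nodup_toList]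
    · intro v
      simp only [List.mem_flatMap, List.mem_range, hoi, Finset.mem_toList]
      constructor
      · rintro ⟨i, -, h, -⟩; exact h
      · intro h
        exact ⟨_, Finset.mem_range.1 (Finset.mem_filter.1 (hft ⟨v, h⟩)).1, h, rfl⟩
    · refine nodup_flatMap_range ?_ ?_
      · intro i _
        simp only [ho]
        split_ifs <;> simp
      · intro i _ j hj v hvi hvj
        obtain ⟨h, h1⟩ := (hoi _ _).1 hvi
        obtain ⟨h', h2⟩ := (hoi _ _).1 hvj
        omega
  refine ⟨absorbPath k z w o m, ?_, absorbPath_prefix k z w o m, absorbPath_suffix k z w o m, ?_⟩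
  · refine absorbPath_tight (fun i hi => (hz i hi).1) (fun i hi => ?_) hw
    by_cases h : ∃ x : W, f x = i
    · have h1 := (Finset.mem_filter.1 (hft h.choose)).2.2
      rw [h.choose_spec] at h1
      simp only [ho, dif_pos h]
      simpa using h1
    · simp only [ho, dif_neg h]
      simpa using (hz i hi).2
  · refine (absorbPath_perm k z w o m).trans ?_
    refine List.Perm.append ?_ hperm
    have := absorbPath_perm k z w (fun _ => []) m
    have hnil : (List.range (m + 1)).flatMap (fun _ => ([] : List V)) = [] := by simp
    rw [hnil, List.append_nil] at this
    exact this.symm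

/-- Complexes with large minimum degree contain a short path able to absorb any small set. -/
theorem exists_absorbing_path {k : ℕ} (hk : 2 ≤ k) {γ : ℝ} (hγ : 0 < γ) :
    ∃ β : ℝ, 0 < β ∧ ∀ᶠ n : ℕ in Filter.atTop, ∀ (V : Type) [DecidableEq V] [Fintype V],
      Fintype.card V = n → ∀ C : Finset V → Prop, DownClosed C → (∀ x, C {x}) →
      HasExt C k univ (3 / 5 * n) → ∃ A st en : List V, st.length + 1 = k ∧ en.length + 1 = k ∧
        Tight C k st ∧ Tight C k en ∧ A.Nodup ∧ (A.length : ℝ) ≤ γ * n ∧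
        ∀ W : Finset V, (W.card : ℝ) ≤ β * n → ∃ A', Tight C k A' ∧ (∃ r, A' = st ++ r) ∧
          (∃ r, A' = r ++ en) ∧ A'.Perm (A ++ W.toList) := by
  obtain ⟨s₀, c, hc, hcon⟩ := exists_connects_uniform k (by omega) (γ := 1 / 20) (by norm_num)
  obtain ⟨B, hB⟩ : ∃ B : ℝ, B = 3 * k + s₀ := ⟨_, rfl⟩
  have hk1 : (1 : ℝ) ≤ k := by exact_mod_cast (by omega : 1 ≤ k)
  have hB1 : 1 ≤ B := by rw [hB]; have : (0 : ℝ) ≤ s₀ := s₀.cast_nonneg; linarith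
  obtain ⟨b, hb0, hbγ, hb1⟩ : ∃ b : ℝ, 0 < b ∧ b * B ≤ γ ∧ b * B ≤ 1 / 100 := by
    refine ⟨min γ (1 / 100) / B, by positivity, ?_, ?_⟩ <;>
      rw [div_mul_cancel₀ _ (by positivity)]
    · exact min_le_left _ _
    · exact min_le_right _ _
  obtain ⟨p, hp⟩ : ∃ p : ℝ, p = (1 / 10) ^ (2 * (k - 1)) / 2 := ⟨_, rfl⟩
  have hp0 : 0 < p := by rw [hp]; positivity
  have hp1 : p ≤ 1 := by
    have : ((1 / 10 : ℝ)) ^ (2 * (k - 1)) ≤ 1 := pow_le_one₀ (by norm_num) (by norm_num)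
    rw [hp]; linarith
  refine ⟨p * b / 2, by positivity, ?_⟩
  filter_upwards [eventually_mul_pow_le_exp (Real.exp p) 1 (by positivity : 0 < p * b / 2),
    eventually_le_mul 2 hb0, eventually_le_mul (100 * (k : ℝ)) one_pos,
    eventually_le_mul (B ^ 2 / c) (b := 1 / 2) (by norm_num)]
    with n hn1 hn2 hn3 hn4 V _ _ hVn C hC hCx hext
  have hn0 : (0 : ℝ) < n := by linarith
  have hn0' : 0 < n := by exact_mod_cast hn0
  obtain ⟨m, hm⟩ : ∃ m : ℕ, m + 1 = ⌊b * n⌋₊ := by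
    have : 1 ≤ ⌊b * n⌋₊ := Nat.le_floor (by push_cast; linarith)
    exact ⟨⌊b * n⌋₊ - 1, by omega⟩
  have hM1 : ((m + 1 : ℕ) : ℝ) ≤ b * n := by rw [hm]; exact Nat.floor_le (by positivity)
  have hM2 : b * n < ((m + 1 : ℕ) : ℝ) + 1 := by rw [hm]; exact Nat.lt_floor_add_one _
  have hMB : ((m + 1 : ℕ) : ℝ) * B ≤ b * B * n := by
    calc _ ≤ b * n * B := by gcongr
      _ = _ := by ring
  have hMB' : ((m + 1 : ℕ) : ℝ) * B ≤ 1 / 100 * n := hMB.trans (by gcongr)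
  have hkB : (2 * (k - 1) : ℕ) + ((s₀ + k : ℕ) : ℝ) ≤ B := by
    rw [hB]
    exact_mod_cast (by omega : 2 * (k - 1) + (s₀ + k) ≤ 3 * k + s₀)
  have hkB1 : ((2 * (k - 1) : ℕ) : ℝ) ≤ B := by
    have : (0 : ℝ) ≤ ((s₀ + k : ℕ) : ℝ) := by positivity
    linarith
  have hkB2 : ((s₀ + k : ℕ) : ℝ) ≤ B := by
    have : (0 : ℝ) ≤ ((2 * (k - 1) : ℕ) : ℝ) := by positivity
    linarith
  have hMk1 : ((m + 1 : ℕ) : ℝ) * (2 * (k - 1) : ℕ) ≤ 1 / 100 * n := le_trans (by gcongr) hMB'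
  have hMk2 : (m : ℝ) * (s₀ + k : ℕ) ≤ 1 / 100 * n := by
    refine le_trans ?_ hMB'
    push_cast at hkB2 ⊢
    gcongr
    linarith
  obtain ⟨z, hz, hzd, hpot⟩ := exists_sites hC (by omega) hext (by omega) hCx
    (δ := 1 / 10) (by norm_num) (m + 1) (by rw [hVn]; linarith)
  set U : Finset V := (Finset.range (m + 1)).biUnion fun i => (z i).toFinset with hU
  have hUc : (U.card : ℝ) ≤ 1 / 100 * n := by
    refine le_trans ?_ hMk1
    have : U.card ≤ (m + 1) * (2 * (k - 1)) := by
      refine Finset.card_biUnion_le.trans ?_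
      refine (Finset.sum_le_card_nsmul _ _ (2 * (k - 1)) fun i hi => ?_).trans (by simp)
      rw [← (hz i (Finset.mem_range.1 hi)).1]
      exact List.toFinset_card_le _
    exact_mod_cast this
  have hRc : ((univ \ U).card : ℝ) = n - U.card := by
    rw [Finset.card_sdiff_of_subset (Finset.subset_univ _), Finset.card_univ, hVn,
      Nat.cast_sub (hVn ▸ Finset.card_le_univ _)]
  have hU0 : (0 : ℝ) ≤ U.card := by positivity
  have htake : ∀ i ≤ m, ((z i).take (k - 1)).length + 1 = k ∧ Tight C k ((z i).take (k - 1)) := by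
    intro i hi
    have h := hz i (by omega)
    exact ⟨by rw [List.length_take, h.1]; omega, h.2.2.infix (List.take_prefix _ _).isInfix⟩
  have hdrop : ∀ i ≤ m, ((z i).drop (k - 1)).length + 1 = k ∧ Tight C k ((z i).drop (k - 1)) := by
    intro i hi
    have h := hz i (by omega)
    exact ⟨by rw [List.length_drop, h.1]; omega, h.2.2.infix (List.drop_suffix _ _).isInfix⟩
  obtain ⟨w, hw, hwd⟩ := exists_connectors (by norm_num : (0 : ℝ) < 1 / 20) hc hcon hC
    (fun i => (z i).drop (k - 1)) (fun i => (z (i + 1)).take (k - 1)) (fun _ => s₀) m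
    (fun i _ => ⟨le_rfl, by omega⟩) (fun i hi => hdrop i (by omega))
    (fun i hi => htake (i + 1) (by omega)) (univ \ U) _ (hext.sdiff U)
    (by rw [hRc]; linarith) (by
      have h1 : ((s₀ + k : ℕ) : ℝ) ^ 2 ≤ B ^ 2 := by gcongr
      rw [div_le_iff₀ hc] at hn4
      rw [hRc]
      have : 0 < c * n := by positivity
      have : c * (98 / 100 * n) ≤ c * (n - U.card - m * (s₀ + k : ℕ)) := by
        gcongr
        linarith
      linarith)
  have hperm := absorbPath_perm k z w (fun _ => []) m
  have hnil : (List.range (m + 1)).flatMap (fun _ => ([] : List V)) = [] := by simp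
  rw [hnil, List.append_nil] at hperm
  refine ⟨absorbPath k z w (fun _ => []) m, (z 0).take (k - 1), (z m).drop (k - 1),
    (htake 0 (by omega)).1, (hdrop m le_rfl).1, (htake 0 (by omega)).2, (hdrop m le_rfl).2, ?_, ?_,
    ?_⟩
  · rw [hperm.nodup_iff, List.nodup_append]
    refine ⟨nodup_flatMap_range (fun i hi => (hz i hi).2.1) hzd,
      nodup_flatMap_range (fun i hi => (hw i hi).2.2.1) hwd, ?_⟩
    rintro u hu v hv rfl
    simp only [List.mem_flatMap, List.mem_range] at hu hv
    obtain ⟨i, hi, hui⟩ := hu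
    obtain ⟨j, hj, huj⟩ := hv
    refine (Finset.mem_sdiff.1 ((hw j hj).2.1 u huj)).2 (Finset.mem_biUnion.2 ⟨i, ?_, ?_⟩)
    · simpa using hi
    · simpa using hui
  · rw [hperm.length_eq, List.length_append, List.length_flatMap, List.length_flatMap]
    have h1 : ((List.range (m + 1)).map fun i => (z i).length).sum = (m + 1) * (2 * (k - 1)) := by
      rw [List.map_congr_left (g := fun _ => 2 * (k - 1)) fun i hi => (hz i (by simpa using hi)).1]
      simp
    have h2 : ((List.range m).map fun i => (w i).length).sum = m * s₀ := by
      rw [List.map_congr_left (g := fun _ => s₀) fun i hi => (hw i (by simpa using hi)).1]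
      simp
    rw [h1, h2]
    have h3 : (m + 1) * (2 * (k - 1)) + m * s₀ ≤ (m + 1) * (3 * k + s₀) := by
      have : m * s₀ ≤ (m + 1) * s₀ := Nat.mul_le_mul_right _ (by omega)
      have : (m + 1) * (2 * (k - 1)) ≤ (m + 1) * (3 * k) := Nat.mul_le_mul_left _ (by omega)
      rw [mul_add]; omega
    calc (((m + 1) * (2 * (k - 1)) + m * s₀ : ℕ) : ℝ) ≤ ((m + 1) * (3 * k + s₀) : ℕ) := by
          exact_mod_cast h3
      _ = ((m + 1 : ℕ) : ℝ) * B := by rw [hB]; push_cast; ring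
      _ ≤ γ * n := hMB.trans (by gcongr)
  · intro W hWc
    refine exists_absorption (fun i hi => ⟨(hz i (by omega)).1, (hz i (by omega)).2.2⟩)
      (fun i hi => (hw i hi).2.2.2) W fun x _ => ?_
    by_contra hcon
    push Not at hcon
    classical
    obtain ⟨N, hN⟩ : ∃ N, N = ((Finset.range (m + 1)).filter fun i =>
      AbsorbedBy C k x (z i)).card := ⟨_, rfl⟩
    rw [← hN] at hcon
    have hNW : (N : ℝ) + 1 ≤ W.card := by exact_mod_cast hcon
    have h1 : (1 / 2 : ℝ) ^ N ≤ n * (1 - p) ^ (m + 1) := by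
      rw [hVn, ← hp] at hpot
      refine le_trans ?_ hpot
      rw [hN]
      exact Finset.single_le_sum (f := fun x => (1 / 2 : ℝ) ^ ((Finset.range (m + 1)).filter
        fun i => AbsorbedBy C k x (z i)).card) (fun _ _ => by positivity) (Finset.mem_univ x)
    have h2 : Real.exp (-(N : ℝ)) ≤ (1 / 2 : ℝ) ^ N := by
      rw [← mul_neg_one, Real.exp_nat_mul]
      gcongr
      rw [Real.exp_neg, one_div]
      gcongr
      have := Real.add_one_le_exp (1 : ℝ)
      linarith
    have h3 : (1 - p) ^ (m + 1) ≤ Real.exp (-(p * (b * n - 1))) := by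
      calc (1 - p) ^ (m + 1) ≤ Real.exp (-p) ^ (m + 1) := by
            gcongr
            linarith [Real.add_one_le_exp (-p)]
        _ = Real.exp (-(p * (m + 1 : ℕ))) := by
            rw [← Real.exp_nat_mul]; congr 1; push_cast; ring
        _ ≤ _ := by
            refine Real.exp_le_exp.2 (neg_le_neg ?_)
            gcongr
            linarith
    have h4 : (n : ℝ) * Real.exp (-(p * (b * n - 1))) ≤ Real.exp (-(p * b / 2 * n)) := by
      have h5 : Real.exp (-(p * (b * n - 1))) = Real.exp p * Real.exp (-(p * b * n)) := by
        rw [← Real.exp_add]; congr 1; ring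
      have h6 : Real.exp (-(p * b / 2 * n)) =
          Real.exp (p * b / 2 * n) * Real.exp (-(p * b * n)) := by
        rw [← Real.exp_add]; congr 1; ring
      rw [h5, h6, ← mul_assoc, mul_comm (n : ℝ)]
      gcongr
      simpa using hn1
    have h5 : Real.exp (-(p * b / 2 * n)) < Real.exp (-(N : ℝ)) :=
      Real.exp_lt_exp.2 (by linarith)
    have h6 : (n : ℝ) * (1 - p) ^ (m + 1) ≤ n * Real.exp (-(p * (b * n - 1))) := by gcongr
    linarith

end AbsorbingPath

section Tiling

set_option maxHeartbeats 800000 in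
open Classical in
/-- Almost all vertices can be covered by disjoint loose paths of a fixed length, leaving a set
that still has large minimum degree. -/
theorem exists_path_tiling {k e t : ℕ} (he : 0 < e) (hek : e ≤ k) (ht : t = k / e * e)
    (ht3 : 3 ≤ t) (hk : 3 ≤ k) {μ γ η₁ : ℝ} (hμ : 0 < μ) (hμ1 : μ ≤ 1)
    (hγ : γ = μ / (10000 * t)) (hη : 0 < η₁) (hη1 : η₁ ≤ 1 / 2) (L₀ : ℕ) :
    ∃ L, L₀ ≤ L ∧ k ≤ L ∧ e ∣ L - k ∧ ∀ᶠ n : ℕ in Filter.atTop, ∀ (V : Type) [DecidableEq V] [Fintype V],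
      Fintype.card V = n → ∀ (C : Finset V → Prop) (E : Finset (Finset V)) (ε : ℝ), 0 ≤ ε →
      ε ≤ γ → (∀ S, C S → S.card = k → S ∈ E) → C ∅ → (∀ v, C {v}) →
      HasExt C k univ ((1 - 1 / t - ε) * n) →
      (∀ A : Finset V, A.card = n / t →
        μ * (n : ℝ) ^ 2 ≤ ((A.powersetCard 2).filter C).card) →
      ∀ A : Finset V, ((univ \ A).card : ℝ) ≤ γ * n →
      ∃ Ps : List (List V), (∀ P ∈ Ps, LoosePath E k e P ∧ P.length = L) ∧ Ps.flatten.Nodup ∧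
        (∀ v ∈ Ps.flatten, v ∈ A) ∧ ((A \ Ps.flatten.toFinset).card : ℝ) ≤ η₁ * n ∧
        η₁ / 2 * n ≤ ((A \ Ps.flatten.toFinset).card : ℝ) ∧
        HasExt C k (A \ Ps.flatten.toFinset)
          ((1 - 1 / t - 3 * γ) * (A \ Ps.flatten.toFinset).card) := by
  have ht3' : (3 : ℝ) ≤ t := by exact_mod_cast ht3
  have hγ0 : 0 < γ := by rw [hγ]; positivity
  have hγt : γ * (10000 * t) = μ := by rw [hγ]; field_simp
  have hγ1 : γ ≤ 1 / 30000 := by nlinarith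
  have hit : 1 / (t : ℝ) ≤ 1 / 3 := one_div_le_one_div_of_le (by norm_num) ht3'
  have hit0 : 0 < 1 / (t : ℝ) := by positivity
  obtain ⟨η, hηd⟩ : ∃ η : ℝ, η = η₁ * γ / 16 := ⟨_, rfl⟩
  have hη0 : 0 < η := by rw [hηd]; positivity
  have hη2 : η ≤ 1 := by rw [hηd]; nlinarith
  obtain ⟨b, hbd⟩ : ∃ b : ℝ, b = η / 4 := ⟨_, rfl⟩
  have hb0 : 0 < b := by rw [hbd]; positivity
  obtain ⟨c, hc0, hc1, hc2⟩ : ∃ c : ℝ, 0 < c ∧ k * c < b ^ k ∧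
      k * c < μ ^ 2 / (1000 * t) * b ^ (k - 2) := by
    have hkr : (0 : ℝ) < k := by exact_mod_cast (by omega : 0 < k)
    have hp : 0 < min (b ^ k) (μ ^ 2 / (1000 * t) * b ^ (k - 2)) := by positivity
    refine ⟨min (b ^ k) (μ ^ 2 / (1000 * t) * b ^ (k - 2)) / (2 * k), by positivity, ?_, ?_⟩
    all_goals
      rw [show ∀ x : ℝ, k * (x / (2 * k)) = x / 2 by intro x; field_simp]
    · have := min_le_left (b ^ k) (μ ^ 2 / (1000 * t) * b ^ (k - 2)); linarith
    · have := min_le_right (b ^ k) (μ ^ 2 / (1000 * t) * b ^ (k - 2)); linarith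
  obtain ⟨j, hj⟩ : ∃ j : ℕ, j = L₀ + ⌈2 / η⌉₊ := ⟨_, rfl⟩
  obtain ⟨L, hL⟩ : ∃ L : ℕ, L = k + j * e := ⟨_, rfl⟩
  have hjL : j ≤ L := by
    have := Nat.le_mul_of_pos_right j he
    omega
  have hLη : 1 ≤ L * (η / 2) := by
    have h1 : 2 / η ≤ L := (Nat.le_ceil _).trans (by exact_mod_cast (by omega : ⌈2 / η⌉₊ ≤ L))
    rw [div_le_iff₀ hη0] at h1
    linarith
  have hL0 : 0 < L := by omega
  have hL0' : (0 : ℝ) < L := by exact_mod_cast hL0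
  obtain ⟨θ, hθ⟩ : ∃ θ : ℝ, θ = η₁ ^ 2 * γ / (16 * L) := ⟨_, rfl⟩
  have hθ0 : 0 < θ := by rw [hθ]; positivity
  refine ⟨L, by omega, by omega, ⟨j, by rw [hL, mul_comm e]; omega⟩, ?_⟩
  filter_upwards [eventually_mul_pow_le_exp 3 k (by positivity : 0 < θ * γ / 2),
    eventually_le_mul (2 * (L : ℝ)) hη, eventually_le_mul ((L : ℝ) + 1) (mul_pos hc0 hη),
    Filter.eventually_gt_atTop 0] with n hn1 hn2 hn3 hn0 V _ _ hVn C E ε hε0 hε hE h0 h1 hext hsup A hA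
  have hn0' : (0 : ℝ) < n := by exact_mod_cast hn0
  have : Nonempty V := Fintype.card_pos_iff.1 (by omega)
  have hAc : ((univ \ A).card : ℝ) = n - A.card := by
    rw [Finset.card_sdiff_of_subset (Finset.subset_univ _), Finset.card_univ, hVn,
      Nat.cast_sub (hVn ▸ Finset.card_le_univ _)]
  have hAn : (A.card : ℝ) ≤ n := by exact_mod_cast hVn ▸ Finset.card_le_univ A
  have hA1 : n / 2 ≤ (A.card : ℝ) := by
    rw [hAc] at hA
    nlinarith
  have hA0 : A.Nonempty := by
    rw [← Finset.card_pos]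
    have : (0 : ℝ) < A.card := by linarith
    exact_mod_cast this
  have hηn : η₁ * n ≤ A.card := by nlinarith
  have hγ1' : γ ≤ 1 := by linarith
  have hgood : ∀ B : Finset V, Inherits (testSet C k μ) γ A B →
      HasExt C k B ((1 - 1 / t - (ε + 2 * γ)) * B.card) ∧
      ∀ D ⊆ B, (1 / t - μ / (100 * t)) * B.card ≤ D.card →
        μ ^ 2 / (1000 * t) * (B.card : ℝ) ^ 2 ≤
          ((D ×ˢ D).filter fun p => p.1 ≠ p.2 ∧ C {p.1, p.2}).card := by
    intro B hB
    have htest := hB.le_card (hVn ▸ hA) hA0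
    have he1 := hasExt_of_tests h1 (hVn ▸ hext) (by linarith) hγ0.le htest
    have he2 : HasExt C k B ((1 - 1 / t - (ε + 2 * γ)) * B.card) := he1.mono (le_of_eq (by ring))
    refine ⟨he2, ?_⟩
    rw [hγ] at htest he2 hε
    exact pairs_of_tests (by omega) (by omega) hμ hμ1 hε h1 he2 (hVn ▸ hsup) htest
  obtain ⟨Ps, hP1, hP2, hP3, hP4, hP5, hP6⟩ := exists_tiling (fun P => LoosePath E k e P)
    (testSet C k μ) (γ := γ) (lam := θ * n) (η := η) (m := η₁ * n) (L := L) A (by positivity)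
    hη0.le hL0 hn2 (by
      have : 2 * (θ * n) * L = η₁ * n * (η₁ * γ / 8) := by rw [hθ]; field_simp; ring
      rw [this]
      refine mul_le_of_le_one_right (by positivity) ?_
      nlinarith) (by
      have hq : 2 * (θ * n) * L / (η₁ * n) = η₁ * γ / 8 := by rw [hθ]; field_simp; ring
      rw [hq, hηd]
      have hX : (η₁ * γ / 8 * (η₁ * γ / 16) + (η₁ * γ / 8) ^ 2) * (A.card / L) ≤
          θ * γ / 2 * n := by
        have : θ * γ / 2 * n = η₁ ^ 2 * γ ^ 2 / 32 * (n / L) := by rw [hθ]; field_simp; ring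
        rw [this]
        gcongr
        have : 0 < η₁ ^ 2 * γ ^ 2 := by positivity
        linarith
      calc _ ≤ 3 * (n : ℝ) ^ k * Real.exp (θ * γ / 2 * n) := by
            gcongr
            rw [← hVn]
            exact card_tests_le (by omega)
        _ ≤ Real.exp (θ * γ / 2 * n) * Real.exp (θ * γ / 2 * n) := by gcongr
        _ = _ := by rw [← Real.exp_add]; congr 1; ring) (by
      intro B hBA hBm hB y hy
      obtain ⟨hB1, hB2⟩ := hgood B hB
      obtain ⟨P, hPl, hPn, hPL, hPB, hPy⟩ := exists_cheap_path he hek ht ht3 hk hE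
        (e1 := ε + 2 * γ) (m1 := μ / (100 * t)) (b := b) (b2 := μ ^ 2 / (1000 * t)) (c := c)
        (by positivity) hb0 hc0
        (by rw [le_div_iff₀ (by positivity)]; nlinarith)
        (by rw [le_div_iff₀ (by positivity)]; nlinarith)
        (by linarith) hc1 hc2 h0 (fun v _ => h1 v) hB1 hB2 hy (L := L) (by
          have : c * η₁ * n ≤ c * B.card := by rw [mul_assoc]; gcongr
          linarith)
      refine ⟨P, hPl, hPn, hPL, hPB, hPy.trans ?_⟩
      have h2 : 2 * b = η / 2 := by rw [hbd]; ring
      rw [h2, mul_add, mul_add]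
      linarith) hηn
  refine ⟨Ps, hP1, hP2, hP3, hP4.le, by linarith, ?_⟩
  refine (hgood _ hP6).1.mono ?_
  gcongr
  linarith

end Tiling

section Cycle

variable {V : Type} [DecidableEq V]

theorem LoosePath.ends {E : Finset (Finset V)} {k e L : ℕ} {P : List V} (hk : 0 < k)
    (h : LoosePath E k e P) (hn : P.Nodup) (hL : P.length = L) (hkL : k ≤ L) (he : e ∣ L - k) :
    ((P.take (k - 1)).length + 1 = k ∧ Tight (faceOf E) k (P.take (k - 1))) ∧
      ((P.drop (L - (k - 1))).length + 1 = k ∧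
        Tight (faceOf E) k (P.drop (L - (k - 1)))) := by
  refine ⟨⟨by rw [List.length_take]; omega, ?_⟩, by rw [List.length_drop]; omega, ?_⟩
  · refine tight_of_nodup (downClosed_faceOf E) k (hn.sublist (List.take_sublist _ _)) ?_
    refine ⟨_, h [] (P.take k) (P.drop k) (by simp) (by rw [List.length_take]; omega) (by simp), ?_⟩
    intro v hv
    rw [List.mem_toFinset] at hv ⊢
    exact (List.take_sublist_take_left (by omega)).subset hv
  · refine tight_of_nodup (downClosed_faceOf E) k (hn.sublist (List.drop_sublist _ _)) ?_
    refine ⟨_, h (P.take (L - k)) (P.drop (L - k)) [] (by simp) (by rw [List.length_drop]; omega)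
      (by rw [List.length_take, hL, min_eq_left (by omega)]; exact he), ?_⟩
    intro v hv
    rw [List.mem_toFinset] at hv ⊢
    exact (List.drop_sublist_drop_left P (by omega)).subset hv

/-- Connect the paths of a tiling and an absorbing path into a Hamilton cycle. -/
theorem exists_cycle_of_tiling [Fintype V] {E : Finset (Finset V)} {k e L s₀ : ℕ} {c d : ℝ}
    (hk : 0 < k) (he : 0 < e) (hek : e ≤ k) (hE : ∀ e ∈ E, e.card = k) (hc : 0 < c)
    (hcon : ∀ s, s₀ ≤ s → s ≤ s₀ + k → Connects k s (1 / 20) c) (hkL : k ≤ L) (hdvd : e ∣ L - k)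
    {Ps : List (List V)} (hPs : ∀ P ∈ Ps, LoosePath E k e P ∧ P.length = L)
    (hnd : Ps.flatten.Nodup) {A st en : List V} (hst : st.length + 1 = k)
    (hen : en.length + 1 = k) (hstT : Tight (faceOf E) k st) (henT : Tight (faceOf E) k en)
    (hA : A.Nodup) (hPA : ∀ v ∈ Ps.flatten, v ∈ univ \ A.toFinset) {R : Finset V}
    (hRd : R = (univ \ A.toFinset) \ Ps.flatten.toFinset) (hext : HasExt (faceOf E) k R d)
    (hd : (1 + 1 / 20) * (R.card : ℝ) ≤ 2 * (d - (Ps.length + 1 : ℕ) * (s₀ + k : ℕ)))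
    (hR : ((s₀ + k : ℕ) : ℝ) ^ 2 < c * (R.card - (Ps.length + 1 : ℕ) * (s₀ + k : ℕ)))
    (habs : ∀ W ⊆ R, ∃ A', Tight (faceOf E) k A' ∧ (∃ r, A' = st ++ r) ∧
      (∃ r, A' = r ++ en) ∧ A'.Perm (A ++ W.toList)) :
    ∃ l : List V, l.Nodup ∧ l.length = Fintype.card V ∧
      LoosePath E k e (l ++ l.take (k - 1)) := by
  obtain ⟨N, hN⟩ : ∃ N, N = Ps.length := ⟨_, rfl⟩
  rw [← hN] at hd hR
  obtain ⟨s, hs1, hs2, hs3⟩ : ∃ s, s₀ ≤ s ∧ s ≤ s₀ + k ∧ e ∣ L + s := by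
    refine ⟨s₀ + (e - (L + s₀) % e), by omega, ?_, ?_⟩
    · omega
    · have h1 := Nat.mod_lt (L + s₀) he
      have h2 := Nat.div_add_mod (L + s₀) e
      refine ⟨(L + s₀) / e + 1, ?_⟩
      rw [mul_add]
      omega
  set P : ℕ → List V := fun i => Ps.getD i [] with hPd
  have hPmem : ∀ i < N, P i ∈ Ps := fun i hi => by
    simp only [hPd]
    rw [List.getD_eq_getElem _ _ (by omega)]
    exact List.getElem_mem _
  have hPflat : (List.range N).flatMap P = Ps.flatten := by
    rw [List.flatMap_def]
    congr 1
    refine List.ext_getElem (by simp [hN]) fun i h1 h2 => ?_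
    simp [hPd, h2]
  have hPn : ∀ i < N, (P i).Nodup := fun i hi => (List.nodup_flatten.1 hnd).1 _ (hPmem i hi)
  have hPe := fun i (hi : i < N) => (hPs _ (hPmem i hi)).1.ends hk (hPn i hi)
    (hPs _ (hPmem i hi)).2 hkL hdvd
  obtain ⟨sl, hsl⟩ : ∃ sl : ℕ → List V, sl = fun i => if i < N then (P i).take (k - 1) else st :=
    ⟨_, rfl⟩
  obtain ⟨el, hel⟩ : ∃ el : ℕ → List V,
    el = fun i => if i < N then (P i).drop (L - (k - 1)) else en := ⟨_, rfl⟩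
  have hsl1 : ∀ i < N, sl i = (P i).take (k - 1) := fun i hi => by simp [hsl, hi]
  have hsl2 : sl N = st := by simp [hsl]
  have hel1 : ∀ i < N, el i = (P i).drop (L - (k - 1)) := fun i hi => by simp [hel, hi]
  have hel2 : el N = en := by simp [hel]
  have hslT : ∀ i ≤ N, (sl i).length + 1 = k ∧ Tight (faceOf E) k (sl i) := by
    intro i hi
    rcases hi.lt_or_eq with hi | rfl
    · rw [hsl1 i hi]; exact (hPe i hi).1
    · rw [hsl2]; exact ⟨hst, hstT⟩
  have helT : ∀ i ≤ N, (el i).length + 1 = k ∧ Tight (faceOf E) k (el i) := by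
    intro i hi
    rcases hi.lt_or_eq with hi | rfl
    · rw [hel1 i hi]; exact (hPe i hi).2
    · rw [hel2]; exact ⟨hen, henT⟩
  obtain ⟨D, hD, hDd⟩ := exists_connectors (by norm_num : (0 : ℝ) < 1 / 20) hc hcon
    (downClosed_faceOf E) el (fun i => if i < N then sl (i + 1) else sl 0) (fun _ => s) (N + 1)
    (fun _ _ => ⟨hs1, hs2⟩) (fun i hi => helT i (by omega))
    (fun i hi => by
      split_ifs with h
      · exact hslT (i + 1) h
      · exact hslT 0 (by omega)) R d hext hd hR
  obtain ⟨A', hA'T, ⟨r, hr⟩, ⟨r', hr'⟩, hA'p⟩ :=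
    habs (R \ ((List.range (N + 1)).flatMap D).toFinset) Finset.sdiff_subset
  have hchain := loosePath_chain hE (P := P) (D := D) (st := sl) (en := el) (A := A') N
    (fun i hi => (hslT i hi).1) (fun i hi => (helT i hi).1)
    (fun i hi => ⟨(P i).drop (k - 1), by rw [hsl1 i hi, List.take_append_drop]⟩)
    (fun i hi => ⟨(P i).take (L - (k - 1)), by rw [hel1 i hi, List.take_append_drop]⟩)
    ⟨r, by rw [hsl2, hr]⟩ ⟨r', by rw [hel2, hr']⟩ (fun i hi => (hPs _ (hPmem i hi)).1) hA'T
    (fun i hi => by rw [(hPs _ (hPmem i hi)).2, (hD i (by omega)).1]; exact hs3)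
    (fun i hi => by simpa [hi] using (hD i (by omega)).2.2.2)
    (by simpa using (hD N (by omega)).2.2.2)
  have hperm : ((List.range N).flatMap (fun i => P i ++ D i) ++ A' ++ D N).Perm
      (Ps.flatten ++ (List.range (N + 1)).flatMap D ++
        (A ++ (R \ ((List.range (N + 1)).flatMap D).toFinset).toList)) := by
    rw [List.perm_iff_count]
    intro v
    have h1 := (List.perm_iff_count.1 (List.flatMap_append_perm (List.range N) P D)) v
    have h2 := List.perm_iff_count.1 hA'p v
    rw [hPflat] at h1
    have h3 : List.count v ((List.range (N + 1)).flatMap D) =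
        List.count v ((List.range N).flatMap D) + List.count v (D N) := by
      rw [List.range_succ, List.flatMap_append, List.flatMap_singleton, List.count_append]
    simp only [List.count_append] at h1 h2 ⊢
    omega
  have hDR : ∀ v ∈ (List.range (N + 1)).flatMap D, v ∈ R := by
    intro v hv
    obtain ⟨i, hi, hv⟩ := List.mem_flatMap.1 hv
    exact (hD i (by simpa using hi)).2.1 v hv
  have hnodup : ((List.range N).flatMap (fun i => P i ++ D i) ++ A' ++ D N).Nodup := by
    rw [hperm.nodup_iff, List.nodup_append, List.nodup_append, List.nodup_append]
    refine ⟨⟨hnd, nodup_flatMap_range (fun i hi => (hD i hi).2.2.1) hDd, ?_⟩,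
      ⟨hA, Finset.nodup_toList _, ?_⟩, ?_⟩
    · rintro u hu v hv rfl
      have := hDR u hv
      rw [hRd, Finset.mem_sdiff, List.mem_toFinset] at this
      exact this.2 hu
    · rintro u hu v hv rfl
      rw [Finset.mem_toList, hRd] at hv
      simp only [Finset.mem_sdiff, List.mem_toFinset] at hv
      exact hv.1.1.2 hu
    · rintro u hu v hv rfl
      rw [List.mem_append] at hu hv
      rcases hv with hv | hv
      · rcases hu with hu | hu
        · have := hPA u hu
          simp only [Finset.mem_sdiff, List.mem_toFinset] at this
          exact this.2 hv
        · have := hDR u hu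
          rw [hRd] at this
          simp only [Finset.mem_sdiff, List.mem_toFinset] at this
          exact this.1.2 hv
      · rw [Finset.mem_toList, Finset.mem_sdiff, List.mem_toFinset] at hv
        rcases hu with hu | hu
        · rw [hRd, Finset.mem_sdiff, List.mem_toFinset] at hv
          exact hv.1.2 hu
        · exact hv.2 hu
  have hall : ∀ v, v ∈ (List.range N).flatMap (fun i => P i ++ D i) ++ A' ++ D N := by
    intro v
    rw [hperm.mem_iff]
    simp only [List.mem_append, Finset.mem_toList, Finset.mem_sdiff, List.mem_toFinset, hRd,
      Finset.mem_univ, true_and]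
    tauto
  refine ⟨_, hnodup, ?_, ?_⟩
  · rw [← List.toFinset_card_of_nodup hnodup, ← Finset.card_univ]
    congr 1
    ext v
    simpa using hall v
  · convert hchain using 2
    rcases Nat.eq_zero_or_pos N with h0 | h0
    · rw [h0] at hsl2 ⊢
      rw [hsl2, hr]
      simp only [List.range_zero, List.flatMap_nil, List.nil_append, List.append_assoc]
      exact List.take_left' (by omega)
    · obtain ⟨M, rfl⟩ : ∃ M, N = M + 1 := ⟨N - 1, by omega⟩
      have h1 : P 0 = sl 0 ++ (P 0).drop (k - 1) := by
        rw [hsl1 0 h0, List.take_append_drop]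
      rw [List.range_succ_eq_map, List.flatMap_cons, h1]
      simp only [List.append_assoc]
      exact List.take_left' (by have := (hslT 0 (by omega)).1; omega)

end Cycle

theorem hasExt_faceOf {V : Type} [DecidableEq V] [Fintype V] {E : Finset (Finset V)} {k : ℕ}
    (hE : ∀ e ∈ E, e.card = k) {d : ℝ} (h : ∀ S : Finset V, S.card = k - 1 → (∃ e ∈ E, S ⊆ e) →
      d ≤ ((E.filter fun e => S ⊆ e).card : ℝ)) : HasExt (faceOf E) k univ d := by
  rintro S ⟨e, he, hSe⟩ hSk
  obtain ⟨T, hST, hTe, hT⟩ := Finset.exists_subsuperset_card_eq hSe (n := k - 1) (by omega)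
    (by rw [hE e he]; omega)
  refine (h T hT ⟨e, he, hTe⟩).trans ?_
  have hsub : (E.filter fun e => T ⊆ e) ⊆
      (extSet (faceOf E) univ S).image fun v => insert v T := by
    intro e' he'
    rw [Finset.mem_filter] at he'
    have h1 : (e' \ T).card = 1 := by
      rw [Finset.card_sdiff_of_subset he'.2, hE e' he'.1]
      omega
    obtain ⟨v, hv⟩ := Finset.card_eq_one.1 h1
    have hv' : v ∈ e' \ T := by rw [hv]; exact Finset.mem_singleton_self v
    rw [Finset.mem_sdiff] at hv'
    refine Finset.mem_image.2 ⟨v, mem_extSet.2 ⟨Finset.mem_univ _, fun h => hv'.2 (hST h), e',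
      he'.1, Finset.insert_subset hv'.1 (hST.trans he'.2)⟩, ?_⟩
    rw [← Finset.sdiff_union_of_subset he'.2, hv, Finset.insert_eq]
  exact_mod_cast (Finset.card_le_card hsub).trans Finset.card_image_le

theorem three_le_floor_mul {k l t : ℕ} (hk : 3 ≤ k) (hl : 1 ≤ l) (hlk : l ≤ k - 1)
    (hne : ¬(k = 3 ∧ l = 1)) (ht : t = k / (k - l) * (k - l)) : 3 ≤ t := by
  obtain ⟨e, he⟩ : ∃ e, e = k - l := ⟨_, rfl⟩
  rw [← he] at ht
  have h1 := Nat.div_add_mod' k e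
  have h2 := Nat.mod_lt k (by omega : 0 < e)
  have h3 : e ≤ t := by
    rw [ht]
    exact Nat.le_mul_of_pos_left e (Nat.div_pos (by omega) (by omega))
  omega

/-- The non-extremal case: if `δ*(G) ≥ (1 - 1/t - ε)n` and every set of `⌊n/t⌋`
vertices contains at least `μn²` supported pairs, then `G` has a Hamilton
ℓ-cycle. -/
theorem hamilton_ell_cycle_nonextremal
    (k l t : ℕ) (hk : 3 ≤ k) (hl : 1 ≤ l) (hlk : l ≤ k - 1)
    (hne : ¬(k = 3 ∧ l = 1)) (ht : t = k / (k - l) * (k - l)) :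
    ∃ μ₀ : ℝ, 0 < μ₀ ∧ ∀ μ : ℝ, 0 < μ → μ ≤ μ₀ →
      ∃ ε₀ : ℝ, 0 < ε₀ ∧ ∀ ε : ℝ, 0 < ε → ε ≤ ε₀ →
        ∃ n₀ : ℕ, ∀ n : ℕ, n₀ ≤ n → (k - l) ∣ n →
          ∀ E : Finset (Finset (Fin n)),
            (∀ e ∈ E, e.card = k) →
            (∀ v : Fin n, ∃ e ∈ E, v ∈ e) →
            (∀ S : Finset (Fin n), S.card = k - 1 → (∃ e ∈ E, S ⊆ e) →
              (1 - 1 / (t : ℝ) - ε) * (n : ℝ) ≤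
                ((E.filter fun e => S ⊆ e).card : ℝ)) →
            (∀ A : Finset (Fin n), A.card = n / t →
              μ * (n : ℝ) ^ 2 ≤ (suppPairs E A : ℝ)) →
            HamCycle k l E := by
  have ht3 := three_le_floor_mul hk hl hlk hne ht
  have ht3' : (3 : ℝ) ≤ t := by exact_mod_cast ht3
  have hit : 1 / (t : ℝ) ≤ 1 / 3 := one_div_le_one_div_of_le (by norm_num) ht3'
  refine ⟨1, one_pos, fun μ hμ hμ1 => ?_⟩
  obtain ⟨γ, hγ⟩ : ∃ γ : ℝ, γ = μ / (10000 * t) := ⟨_, rfl⟩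
  have hγ0 : 0 < γ := by rw [hγ]; positivity
  have hγt : γ * (10000 * t) = μ := by rw [hγ]; field_simp
  have hγ1 : γ ≤ 1 / 30000 := by nlinarith
  refine ⟨γ, hγ0, fun ε hε0 hε => ?_⟩
  obtain ⟨s₀, c, hc, hcon⟩ := exists_connects_uniform k (by omega) (γ := 1 / 20) (by norm_num)
  obtain ⟨β, hβ, habs⟩ := exists_absorbing_path (k := k) (by omega) hγ0
  obtain ⟨η, hη0, hηβ, hη1⟩ : ∃ η : ℝ, 0 < η ∧ η ≤ β ∧ η ≤ 1 / 2 :=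
    ⟨min β (1 / 2), by positivity, min_le_left _ _, min_le_right _ _⟩
  obtain ⟨L, hL0, hkL, hLd, htile⟩ := exists_path_tiling (by omega) (Nat.sub_le k l) ht ht3 hk hμ
    hμ1 hγ hη0 hη1 ⌈80 * ((s₀ + k : ℕ) : ℝ) / η⌉₊
  have hLs : 80 * ((s₀ + k : ℕ) : ℝ) ≤ L * η :=
    (div_le_iff₀ hη0).1 ((Nat.le_ceil _).trans (by exact_mod_cast hL0))
  rw [← Filter.eventually_atTop]
  filter_upwards [habs, htile, Filter.eventually_ge_atTop L,
    eventually_le_mul (((s₀ + k : ℕ) : ℝ) ^ 2 + 1) (by positivity : 0 < c * η / 4)]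
    with n hn1 hn2 hnL hn3 hdvd E hE hiso hdeg hsup
  have h1 : ∀ v : Fin n, faceOf E {v} := fun v => by
    obtain ⟨e, he, hv⟩ := hiso v
    exact ⟨e, he, by simpa using hv⟩
  have hn0 : 0 < n := by omega
  have hn0' : (0 : ℝ) < n := by exact_mod_cast hn0
  have hext := hasExt_faceOf hE hdeg
  obtain ⟨A, st, en, hst, hen, hstT, henT, hA, hAl, hAabs⟩ := hn1 (Fin n) (Fintype.card_fin n) _
    (downClosed_faceOf E) h1 (hext.mono (by gcongr; linarith))
  obtain ⟨Ps, hPs, hPn, hPA, hR1, hR2, hRext⟩ := hn2 (Fin n) (Fintype.card_fin n) (faceOf E) E ε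
    hε0.le hε (by
      rintro S ⟨e, he, hSe⟩ hS
      rwa [Finset.eq_of_subset_of_card_le hSe (by rw [hE e he, hS])])
    (downClosed_faceOf E _ _ (Finset.empty_subset _) (h1 ⟨0, hn0⟩)) h1 hext
    (fun A hA => (hsup A hA).trans (le_of_eq (by rw [suppPairs]; congr!)))
    (univ \ A.toFinset) (by
      refine le_trans ?_ hAl
      rw [Finset.sdiff_sdiff_eq_self (Finset.subset_univ _)]
      exact_mod_cast A.toFinset_card_le)
  obtain ⟨R, hR⟩ : ∃ R, R = (univ \ A.toFinset) \ Ps.flatten.toFinset := ⟨_, rfl⟩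
  rw [← hR] at hR1 hR2 hRext
  have hN : ((Ps.length + 1 : ℕ) : ℝ) * L ≤ 2 * n := by
    have h2 : Ps.flatten.length = Ps.length * L := by
      rw [List.length_flatten, List.map_congr_left (g := fun _ => L) fun P hP => (hPs P hP).2]
      simp
    have h3 : Ps.flatten.length ≤ n := by
      simpa using hPn.length_le_card
    have h4 : (Ps.length + 1) * L ≤ 2 * n := by rw [add_mul]; omega
    exact_mod_cast h4
  have hNs : ((Ps.length + 1 : ℕ) : ℝ) * (s₀ + k : ℕ) ≤ R.card / 20 := by
    have h2 : ((Ps.length + 1 : ℕ) : ℝ) * (80 * ((s₀ + k : ℕ) : ℝ)) ≤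
        (Ps.length + 1 : ℕ) * (L * η) := by gcongr
    have h3 : ((Ps.length + 1 : ℕ) : ℝ) * (L * η) ≤ 2 * n * η := by
      rw [← mul_assoc]; gcongr
    linarith
  have hR0 : (0 : ℝ) < R.card := lt_of_lt_of_le (by positivity) hR2
  obtain ⟨cyc, hc1, hc2, hc3⟩ := exists_cycle_of_tiling (by omega) (by omega : 0 < k - l)
    (Nat.sub_le k l) hE hc hcon hkL hLd hPs hPn hst hen hstT henT hA hPA hR hRext
    (by
      have : (19 / 30 : ℝ) * R.card ≤ (1 - 1 / t - 3 * γ) * R.card := by gcongr; linarith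
      linarith)
    (by
      have h2 : c * (η / 2 * n) ≤ c * R.card := by gcongr
      have h3 : c * (R.card / 2) ≤ c * (R.card - (Ps.length + 1 : ℕ) * (s₀ + k : ℕ)) := by
        gcongr
        linarith
      linarith)
    (fun W hW => hAabs W (by
      have h2 : (W.card : ℝ) ≤ R.card := by exact_mod_cast Finset.card_le_card hW
      have h3 : η * n ≤ β * n := by gcongr
      linarith))
  exact hamCycle_of_list hn0 (by omega) (by omega) hdvd cyc hc1 (by rw [hc2, Fintype.card_fin]) hc3
end
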